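/- arXiv:math/0106229 — 2 statements merged into one kernel-verified Lean document; each statement's English description precedes it below -/
import Mathlib

section
/- (Combinatorial Riemann–Roch) Let P be a simple lattice multi-polytope over a complete simplicial multi-fan Δ of dimension n. Let c_1(P) = Σ_i c_i x̄_i ∈ H^2(Δ)⊗ℝ be its first Chern class and T(Δ) = Σ_{g∈G_Δ} ∏_{i=1}^d x̄_i/(1 − ρ_i(g)e^{−x̄_i}) the Todd class. Then ∫_Δ e^{c_1(P)} T(Δ) = ♯(P), the number of lattice points of P counted with Duistermaat–Heckman multiplicity. -/
open Finset

/-- The pairing between a covector and a vector in `ℝⁿ`. -/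
def dotp {n : ℕ} (x y : Fin n → ℝ) : ℝ := ∑ k, x k * y k

/-- A (simplicial) multi-fan of dimension `n` with rays indexed by `{1,…,d}`:
an augmented simplicial set `S`, ray vectors `v i` spanning the simplicial cones
`C(I) = pos span {v i : i ∈ I}`, and a weight `w` on simplices (the difference
`w = w⁺ − w⁻` of the two weight functions, restricted to top simplices is what matters). -/
structure MultiFan (n d : ℕ) where
  S : Finset (Finset (Fin d))
  empty_mem : ∅ ∈ S
  downClosed : ∀ I ∈ S, ∀ J ⊆ I, J ∈ S
  card_le : ∀ I ∈ S, I.card ≤ n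
  v : Fin d → (Fin n → ℝ)
  indep : ∀ I ∈ S, LinearIndependent ℝ (fun i : {x // x ∈ I} => v i.1)
  w : Finset (Fin d) → ℤ

namespace MultiFan

variable {n d : ℕ}

/-- `x` is generic for the projected multi-fan `Δ_K`: it avoids every linear subspace
spanned by a cone (containing `C(K)`) of dimension `< n`. -/
def GenericFor (Δ : MultiFan n d) (K : Finset (Fin d)) (x : Fin n → ℝ) : Prop :=
  ∀ L ∈ Δ.S, K ⊆ L → L.card < n → x ∉ Submodule.span ℝ (Δ.v '' (L : Set (Fin d)))

def Generic (Δ : MultiFan n d) (x : Fin n → ℝ) : Prop := Δ.GenericFor ∅ x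

/-- `x` lies (mod the span of `C(K)`) in the projected cone `C_K(I)`. -/
def InProjCone (Δ : MultiFan n d) (K I : Finset (Fin d)) (x : Fin n → ℝ) : Prop :=
  ∃ a : Fin d → ℝ, (∀ j ∈ I \ K, 0 ≤ a j) ∧
    (x - ∑ j ∈ I \ K, a j • Δ.v j) ∈ Submodule.span ℝ (Δ.v '' (K : Set (Fin d)))

open scoped Classical in
/-- `d_x` for the projected multi-fan `Δ_K`: the sum of the weights of top cones whose
projection contains the projection of `x`. -/
noncomputable def dv (Δ : MultiFan n d) (K : Finset (Fin d)) (x : Fin n → ℝ) : ℤ :=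
  ∑ I ∈ Δ.S.filter (fun I => I.card = n ∧ K ⊆ I ∧ Δ.InProjCone K I x), Δ.w I

/-- Pre-completeness of the projected multi-fan `Δ_K`. -/
def PreCompleteAt (Δ : MultiFan n d) (K : Finset (Fin d)) : Prop :=
  (∃ I ∈ Δ.S, K ⊆ I ∧ I.card = n) ∧
  ∀ x y : Fin n → ℝ, Δ.GenericFor K x → Δ.GenericFor K y → Δ.dv K x = Δ.dv K y

/-- Completeness: every projected multi-fan is pre-complete. -/
def Complete (Δ : MultiFan n d) : Prop := ∀ K ∈ Δ.S, Δ.PreCompleteAt K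

open scoped Classical in
/-- The Duistermaat–Heckman function of the simple multi-polytope `(Δ, {F_i})`, where
`F_i = {u : ⟨u, v i⟩ = c i}`, the data `uu I i = u_i^I` is the dual basis of `{v i : i ∈ I}`
and `ξ ∈ V` is a generic vector.  For `I ∈ Σ^{(n)}` the coefficient of `u − u_I` on `u_i^I`
is `⟨u, v i⟩ − c i`, so membership in the cone `C^*(I)^+` is expressed by the conditions below. -/
noncomputable def DH (Δ : MultiFan n d) (c : Fin d → ℝ)
    (uu : Finset (Fin d) → Fin d → (Fin n → ℝ)) (ξ : Fin n → ℝ) (u : Fin n → ℝ) : ℤ :=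
  ∑ I ∈ Δ.S.filter (fun I => I.card = n),
    if (∀ i ∈ I, (0 < dotp (uu I i) ξ ∧ c i ≤ dotp u (Δ.v i)) ∨
                 (dotp (uu I i) ξ < 0 ∧ dotp u (Δ.v i) ≤ c i))
    then (-1 : ℤ) ^ (I.filter fun i => 0 < dotp (uu I i) ξ).card * Δ.w I
    else 0

/-- `uu I i = u_i^I` is the basis dual to `{v i : i ∈ I}` for each top simplex `I`. -/
def DualBasis (Δ : MultiFan n d) (uu : Finset (Fin d) → Fin d → (Fin n → ℝ)) : Prop :=
  ∀ I ∈ Δ.S, I.card = n → ∀ i ∈ I, ∀ j ∈ I,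
    dotp (uu I i) (Δ.v j) = if i = j then 1 else 0

/-- Genericity of `ξ` needed for the DH function: `⟨u_i^I, ξ⟩ ≠ 0` for all `I, i`. -/
def GenericDual (Δ : MultiFan n d) (uu : Finset (Fin d) → Fin d → (Fin n → ℝ))
    (ξ : Fin n → ℝ) : Prop :=
  ∀ I ∈ Δ.S, I.card = n → ∀ i ∈ I, dotp (uu I i) ξ ≠ 0

end MultiFan

/-- A (simplicial) multi-fan in the lattice `N = ℤⁿ`: the ray vectors `v i` are the
primitive integral generators of the one-dimensional cones. -/
structure LMultiFan (n d : ℕ) where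
  S : Finset (Finset (Fin d))
  empty_mem : ∅ ∈ S
  downClosed : ∀ I ∈ S, ∀ J ⊆ I, J ∈ S
  card_le : ∀ I ∈ S, I.card ≤ n
  v : Fin d → (Fin n → ℤ)
  indep : ∀ I ∈ S, LinearIndependent ℝ (fun i : {x // x ∈ I} => fun k => ((v i.1 k : ℝ)))
  w : Finset (Fin d) → ℤ

namespace LMultiFan

variable {n d : ℕ}

/-- The underlying real multi-fan. -/
def toMF (Δ : LMultiFan n d) : MultiFan n d where
  S := Δ.S
  empty_mem := Δ.empty_mem
  downClosed := Δ.downClosed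
  card_le := Δ.card_le
  v := fun i k => (Δ.v i k : ℝ)
  indep := Δ.indep
  w := Δ.w

/-- The vertices `u_I = ∑_{i∈I} c_i u_i^I` of the multi-polytope with constants `c` all lie
in the lattice `N^* = ℤⁿ`, i.e. the multi-polytope is a lattice multi-polytope. -/
def LatticeVertices (Δ : LMultiFan n d) (c : Fin d → ℝ)
    (uu : Finset (Fin d) → Fin d → (Fin n → ℝ)) : Prop :=
  ∀ I ∈ Δ.S, I.card = n → ∀ k : Fin n, ∃ m : ℤ, (∑ i ∈ I, c i * uu I i k) = (m : ℝ)

/-- `♯(P) = ∑_{u ∈ N^*} DH_{P_+}(u)`, where `P_+` is the small outward enlargement of the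
lattice multi-polytope `P` (each hyperplane `⟨·, v_i⟩ = c_i` is moved in the direction of
`v_i`; since all `c_i` are integers, moving by `1/2` realizes the small enlargement). -/
noncomputable def sharpP (Δ : LMultiFan n d) (c : Fin d → ℝ)
    (uu : Finset (Fin d) → Fin d → (Fin n → ℝ)) (ξ : Fin n → ℝ) : ℤ :=
  ∑ᶠ u : Fin n → ℤ, Δ.toMF.DH (fun i => c i + 1/2) uu ξ (fun k => (u k : ℝ))

/-- `♯(P°) = ∑_{u ∈ N^*} DH_{P_−}(u)`, with `P_−` the small inward shrinking of `P`. -/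
noncomputable def sharpInt (Δ : LMultiFan n d) (c : Fin d → ℝ)
    (uu : Finset (Fin d) → Fin d → (Fin n → ℝ)) (ξ : Fin n → ℝ) : ℤ :=
  ∑ᶠ u : Fin n → ℤ, Δ.toMF.DH (fun i => c i - 1/2) uu ξ (fun k => (u k : ℝ))

end LMultiFan

open scoped Classical in
/-- The restriction `ι_I^*` over `ℂ`. -/
noncomputable def iotaC {n d : ℕ} (uu : Finset (Fin d) → Fin d → (Fin n → ℚ))
    (I : Finset (Fin d)) : MvPolynomial (Fin d) ℂ →ₐ[ℂ] MvPolynomial (Fin n) ℂ :=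
  MvPolynomial.aeval
    (fun i => if i ∈ I then ∑ k : Fin n, ((uu I i k : ℂ)) • MvPolynomial.X k else 0)

open scoped Classical in
/-- The index map `π_!` over `ℂ`. -/
noncomputable def piShriekC {n d : ℕ} (Δ : LMultiFan n d)
    (uu : Finset (Fin d) → Fin d → (Fin n → ℚ)) (x : MvPolynomial (Fin d) ℂ) :
    FractionRing (MvPolynomial (Fin n) ℂ) :=
  ∑ I ∈ Δ.S.filter (fun I => I.card = n),
    algebraMap (MvPolynomial (Fin n) ℂ) (FractionRing (MvPolynomial (Fin n) ℂ))
      (MvPolynomial.C ((Δ.w I : ℂ) /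
        (Nat.card ((Fin n → ℤ) ⧸ Submodule.span ℤ (Δ.v '' (I : Set (Fin d)))) : ℂ))) *
    (algebraMap (MvPolynomial (Fin n) ℂ) _ (iotaC uu I x) /
     algebraMap (MvPolynomial (Fin n) ℂ) _
       (∏ i ∈ I, ∑ k : Fin n, ((uu I i k : ℂ)) • MvPolynomial.X k))

/-- `G_Δ = ∪_{I∈Σ^{(n)}} G_I ⊆ ℝ^d/ℤ^d`, realized by its canonical representatives in
`[0,1)^d`: the classes `[a]` with `a_j = 0` off some `I ∈ Σ^{(n)}` and `∑_{i∈I} a_i v_i ∈ N`. -/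
def GD {n d : ℕ} (Δ : LMultiFan n d) : Set (Fin d → ℝ) :=
  {a | (∀ i, 0 ≤ a i ∧ a i < 1) ∧
       ∃ I ∈ Δ.S, I.card = n ∧ (∀ j, j ∉ I → a j = 0) ∧
         ∀ k : Fin n, ∃ m : ℤ, (∑ i ∈ I, a i * (Δ.v i k : ℝ)) = (m : ℝ)}

/-- `ρ_i(g) = exp(2π√−1 a_i)` for `g = [a] ∈ ℝ^d/ℤ^d`. -/
noncomputable def rho {d : ℕ} (i : Fin d) (a : Fin d → ℝ) : ℂ :=
  Complex.exp (2 * (Real.pi : ℂ) * Complex.I * (a i : ℂ))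

/-- `td ρ k` is the `k`-th Maclaurin coefficient of the Todd series `x/(1 − ρ e^{−x})`,
characterized for `k ≤ n` by the identity
`(∑_k td ρ k x^k)(1 − ρ e^{−x}) ≡ x  (mod x^{n+2})`. -/
def ToddCoeffs (n : ℕ) (td : ℂ → ℕ → ℂ) : Prop :=
  ∀ ρ : ℂ, ∀ m : ℕ, m ≤ n + 1 →
    (∑ k ∈ Finset.range (m+1), td ρ k *
      (if m - k = 0 then 1 - ρ else -ρ * (-1 : ℂ)^(m-k) / ((Nat.factorial (m-k) : ℂ))))
    = (if m = 1 then 1 else 0)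

/-- The Todd class `T(Δ) = ∑_{g∈G_Δ} ∏_i x_i/(1 − ρ_i(g)e^{−x_i})` of the multi-fan,
truncated at degree `n` in each variable (which suffices to determine all components of
total degree `≤ n`, the only ones surviving in `H^*(Δ)`). -/
noncomputable def toddPoly {n d : ℕ} (Δ : LMultiFan n d) (td : ℂ → ℕ → ℂ) :
    MvPolynomial (Fin d) ℂ :=
  ∑ᶠ a : ↥(GD Δ), ∏ i : Fin d,
    ∑ k ∈ Finset.range (n+1), td (rho i (a : Fin d → ℝ)) k • MvPolynomial.X i ^ k

/-- `e^{c_1^T(P)} = ∏_i e^{c_i x_i}`, truncated at degree `n` in each variable. -/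
noncomputable def expPoly (n : ℕ) {d : ℕ} (c : Fin d → ℝ) : MvPolynomial (Fin d) ℂ :=
  ∏ i : Fin d, ∑ k ∈ Finset.range (n+1),
    (((c i : ℂ)) ^ k / (Nat.factorial k : ℂ)) • MvPolynomial.X i ^ k

section LinAlg
variable {F : Type*} [Field F] {n d : ℕ}

lemma dual_symm {I : Finset (Fin d)} (hc : I.card = n) {u v : Fin d → Fin n → F}
    (h : ∀ i ∈ I, ∀ j ∈ I, ∑ k, u i k * v j k = if i = j then 1 else 0) (k l : Fin n) :
    ∑ i ∈ I, u i k * v i l = if k = l then 1 else 0 := by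
  let e : Fin n ≃ I := (finCongr hc.symm).trans I.equivFin.symm
  let A : Matrix (Fin n) (Fin n) F := fun a b => u (e a) b
  let B : Matrix (Fin n) (Fin n) F := fun a b => v (e b) a
  have hAB : A * B = 1 := by
    ext a b
    rw [Matrix.mul_apply, Matrix.one_apply]
    have := h (e a) (e a).2 (e b) (e b).2
    simp only [A, B]
    rw [this]
    have : ((e a : Fin d) = e b) ↔ a = b := by
      rw [Subtype.coe_inj, e.injective.eq_iff]
    simp [this]
  have hBA : B * A = 1 := mul_eq_one_comm.mp hAB
  have h2 := congrFun (congrFun hBA l) k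
  rw [Matrix.mul_apply, Matrix.one_apply] at h2
  have : ∑ i ∈ I, u i k * v i l = ∑ a : Fin n, B l a * A a k := by
    rw [← Finset.sum_coe_sort I, ← e.sum_comp]
    exact Finset.sum_congr rfl fun a _ => mul_comm _ _
  rw [this, h2]
  simp [eq_comm]

lemma expand_vec {I : Finset (Fin d)} (hc : I.card = n) {u v : Fin d → Fin n → F}
    (h : ∀ i ∈ I, ∀ j ∈ I, ∑ k, u i k * v j k = if i = j then 1 else 0) (x : Fin n → F) (l : Fin n) :
    x l = ∑ i ∈ I, (∑ k, u i k * x k) * v i l := by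
  have := dual_symm hc h
  calc x l = ∑ k, x k * (if k = l then 1 else 0) := by simp
    _ = ∑ k, x k * ∑ i ∈ I, u i k * v i l := by simp only [this]
    _ = ∑ i ∈ I, (∑ k, u i k * x k) * v i l := by
      simp only [Finset.mul_sum, Finset.sum_mul]
      rw [Finset.sum_comm]
      exact Finset.sum_congr rfl fun i _ => Finset.sum_congr rfl fun k _ => by ring

lemma expand_cov {I : Finset (Fin d)} (hc : I.card = n) {u v : Fin d → Fin n → F}
    (h : ∀ i ∈ I, ∀ j ∈ I, ∑ k, u i k * v j k = if i = j then 1 else 0) (x : Fin n → F) (l : Fin n) :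
    x l = ∑ i ∈ I, (∑ k, x k * v i k) * u i l := by
  have := dual_symm hc h
  calc x l = ∑ k, x k * (if l = k then 1 else 0) := by simp
    _ = ∑ k, x k * ∑ i ∈ I, u i l * v i k := by simp only [this]
    _ = ∑ i ∈ I, (∑ k, x k * v i k) * u i l := by
      simp only [Finset.mul_sum, Finset.sum_mul]
      rw [Finset.sum_comm]
      exact Finset.sum_congr rfl fun i _ => Finset.sum_congr rfl fun k _ => by ring

end LinAlg

section MF
variable {n d : ℕ}

lemma dotp_add_right (x y z : Fin n → ℝ) : dotp x (y + z) = dotp x y + dotp x z := by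
  simp [dotp, mul_add, Finset.sum_add_distrib]
lemma dotp_sub_right (x y z : Fin n → ℝ) : dotp x (y - z) = dotp x y - dotp x z := by
  simp [dotp, mul_sub, Finset.sum_sub_distrib]
lemma dotp_smul_right (x y : Fin n → ℝ) (a : ℝ) : dotp x (a • y) = a * dotp x y := by
  simp only [dotp, Finset.mul_sum, Pi.smul_apply, smul_eq_mul]
  exact Finset.sum_congr rfl fun k _ => by ring
lemma dotp_smul_left (x y : Fin n → ℝ) (a : ℝ) : dotp (a • x) y = a * dotp x y := by
  simp only [dotp, Finset.mul_sum, Pi.smul_apply, smul_eq_mul]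
  exact Finset.sum_congr rfl fun k _ => by ring
lemma dotp_neg_right (x y : Fin n → ℝ) : dotp x (-y) = - dotp x y := by
  simp [dotp]
lemma dotp_sum_right {ι : Type*} (s : Finset ι) (x : Fin n → ℝ) (f : ι → Fin n → ℝ) :
    dotp x (∑ i ∈ s, f i) = ∑ i ∈ s, dotp x (f i) := by
  simp only [dotp, Finset.sum_apply, Finset.mul_sum]
  rw [Finset.sum_comm]
lemma dotp_comm (x y : Fin n → ℝ) : dotp x y = dotp y x := by
  simp only [dotp, mul_comm]

lemma dotp_span_zero {s : Set (Fin n → ℝ)} {x y : Fin n → ℝ} (h : ∀ z ∈ s, dotp x z = 0)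
    (hy : y ∈ Submodule.span ℝ s) : dotp x y = 0 := by
  induction hy using Submodule.span_induction with
  | mem z hz => exact h z hz
  | zero => simp [dotp]
  | add a b _ _ ha hb => rw [dotp_add_right, ha, hb, add_zero]
  | smul a b _ hb => rw [dotp_smul_right, hb, mul_zero]

variable {Δ : MultiFan n d} {uu : Finset (Fin d) → Fin d → (Fin n → ℝ)}

lemma mf_vec (h : Δ.DualBasis uu) {I : Finset (Fin d)} (hI : I ∈ Δ.S) (hc : I.card = n)
    (x : Fin n → ℝ) : x = ∑ i ∈ I, dotp (uu I i) x • Δ.v i := by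
  funext l
  rw [Finset.sum_apply]
  exact expand_vec hc (u := uu I) (v := Δ.v) (h I hI hc) x l

lemma mf_cov (h : Δ.DualBasis uu) {I : Finset (Fin d)} (hI : I ∈ Δ.S) (hc : I.card = n)
    (x : Fin n → ℝ) : x = ∑ i ∈ I, dotp x (Δ.v i) • uu I i := by
  funext l
  rw [Finset.sum_apply]
  exact expand_cov hc (u := uu I) (v := Δ.v) (h I hI hc) x l

lemma mf_pair (h : Δ.DualBasis uu) {I : Finset (Fin d)} (hI : I ∈ Δ.S) (hc : I.card = n)
    (x y : Fin n → ℝ) : dotp x y = ∑ i ∈ I, dotp x (Δ.v i) * dotp (uu I i) y := by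
  conv_lhs => rw [mf_vec h hI hc y]
  rw [dotp_sum_right]
  exact Finset.sum_congr rfl fun i _ => by rw [dotp_smul_right, mul_comm]

lemma inProjCone_iff (h : Δ.DualBasis uu) {I K : Finset (Fin d)} (hI : I ∈ Δ.S) (hc : I.card = n)
    (hK : K ⊆ I) (x : Fin n → ℝ) :
    Δ.InProjCone K I x ↔ ∀ i ∈ I \ K, 0 ≤ dotp (uu I i) x := by
  constructor
  · rintro ⟨a, ha, hx⟩ i hi
    have hi' := Finset.mem_sdiff.mp hi
    have h0 : dotp (uu I i) (x - ∑ j ∈ I \ K, a j • Δ.v j) = 0 := by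
      refine dotp_span_zero ?_ hx
      rintro _ ⟨j, hj, rfl⟩
      have := h I hI hc i hi'.1 j (hK hj)
      rw [this, if_neg]
      rintro rfl
      exact hi'.2 hj
    rw [dotp_sub_right, dotp_sum_right, sub_eq_zero] at h0
    rw [h0]
    refine Finset.sum_nonneg fun j hj => ?_
    rw [dotp_smul_right, h I hI hc i hi'.1 j (Finset.mem_sdiff.mp hj).1]
    split_ifs
    · simpa using ha j hj
    · simp
  · intro hpos
    refine ⟨fun i => dotp (uu I i) x, hpos, ?_⟩
    have : x - ∑ j ∈ I \ K, dotp (uu I j) x • Δ.v j = ∑ j ∈ K, dotp (uu I j) x • Δ.v j := by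
      rw [sub_eq_iff_eq_add, add_comm, Finset.sum_sdiff hK]
      exact mf_vec h hI hc x
    rw [this]
    exact Submodule.sum_mem _ fun j hj => Submodule.smul_mem _ _
      (Submodule.subset_span ⟨j, hj, rfl⟩)

lemma genericFor_of_dual (hC : Δ.Complete) (h : Δ.DualBasis uu) {ξ : Fin n → ℝ}
    (hξ : Δ.GenericDual uu ξ) (K : Finset (Fin d)) : Δ.GenericFor K ξ := by
  intro L hL _ hLn hmem
  obtain ⟨⟨I, hI, hLI, hc⟩, -⟩ := hC L hL
  have : ∃ i ∈ I, i ∉ L := by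
    by_contra! hcon
    have := Finset.card_le_card (show I ⊆ L from hcon)
    omega
  obtain ⟨i, hi, hiL⟩ := this
  apply hξ I hI hc i hi
  refine dotp_span_zero ?_ hmem
  rintro _ ⟨j, hj, rfl⟩
  rw [h I hI hc i hi j (hLI hj), if_neg]
  rintro rfl
  exact hiL hj

lemma genericDual_neg {ξ : Fin n → ℝ} (hξ : Δ.GenericDual uu ξ) : Δ.GenericDual uu (-ξ) := by
  intro I hI hc i hi
  rw [dotp_neg_right]
  exact neg_ne_zero.mpr (hξ I hI hc i hi)

open scoped Classical in
/-- product form of the DH term -/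
lemma dh_term {y : Fin d → ℝ} {α : Fin d → ℝ} (I : Finset (Fin d)) (hα : ∀ i ∈ I, α i ≠ 0)
    (c : Fin d → ℝ) (hy : ∀ i ∈ I, y i ≠ c i) :
    (if (∀ i ∈ I, (0 < α i ∧ c i ≤ y i) ∨ (α i < 0 ∧ y i ≤ c i))
      then (-1 : ℤ) ^ (I.filter fun i => 0 < α i).card else 0) =
    ∏ i ∈ I, (- (if c i < y i then (1:ℤ) else 0) + (if α i < 0 then (1:ℤ) else 0)) := by
  split_ifs with hh
  · rw [← Finset.prod_const, Finset.prod_filter]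
    refine Finset.prod_congr rfl fun i hi => ?_
    rcases hh i hi with ⟨h1, h2⟩ | ⟨h1, h2⟩
    · rw [if_pos h1, if_pos (lt_of_le_of_ne h2 (hy i hi).symm), if_neg (not_lt.mpr h1.le)]; rfl
    · rw [if_neg (not_lt.mpr h1.le), if_neg (not_lt.mpr h2), if_pos h1]; rfl
  · push Not at hh
    obtain ⟨i, hi, h1, h2⟩ := hh
    symm
    apply Finset.prod_eq_zero hi
    rcases lt_or_gt_of_ne (hα i hi) with h | h
    · rw [if_pos h, if_pos (h2 h)]; rfl
    · rw [if_neg (not_lt.mpr h.le), if_neg (not_lt.mpr (h1 h).le)]; rfl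

open scoped Classical in
lemma DH_eq (hC : Δ.Complete) (h : Δ.DualBasis uu) {ξ : Fin n → ℝ} (hξ : Δ.GenericDual uu ξ)
    (c : Fin d → ℝ) (u : Fin n → ℝ)
    (hu : ∀ I ∈ Δ.S, I.card = n → ∀ i ∈ I, dotp u (Δ.v i) ≠ c i) :
    Δ.DH c uu ξ u = ∑ K ∈ Δ.S, (∏ i ∈ K, -(if c i < dotp u (Δ.v i) then (1:ℤ) else 0)) *
      Δ.dv K (-ξ) := by
  have step : Δ.DH c uu ξ u = ∑ I ∈ Δ.S.filter (fun I => I.card = n), ∑ K ∈ Δ.S,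
      if K ⊆ I then (∏ i ∈ K, -(if c i < dotp u (Δ.v i) then (1:ℤ) else 0)) *
        (if Δ.InProjCone K I (-ξ) then Δ.w I else 0) else 0 := by
    unfold MultiFan.DH
    refine Finset.sum_congr rfl fun I hI => ?_
    obtain ⟨hI, hc⟩ := Finset.mem_filter.mp hI
    have e := dh_term (y := fun i => dotp u (Δ.v i)) (α := fun i => dotp (uu I i) ξ) I
      (hξ I hI hc) c (hu I hI hc)
    have e2 := congrArg (· * Δ.w I) e
    simp only [ite_mul, zero_mul] at e2
    rw [Finset.prod_add, Finset.sum_mul] at e2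
    refine e2.trans ?_
    rw [← Finset.sum_filter]
    have hs : Δ.S.filter (fun K => K ⊆ I) = I.powerset := by
      ext K
      simp only [Finset.mem_filter, Finset.mem_powerset]
      exact ⟨fun h => h.2, fun h => ⟨Δ.downClosed I hI K h, h⟩⟩
    rw [hs]
    refine Finset.sum_congr rfl fun K hK => ?_
    rw [Finset.mem_powerset] at hK
    rw [mul_assoc]
    congr 1
    rw [inProjCone_iff h hI hc hK]
    split_ifs with hh
    · rw [Finset.prod_eq_one, one_mul]
      intro i hi
      have h1 := hh i hi
      rw [dotp_neg_right] at h1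
      rw [if_pos]
      exact lt_of_le_of_ne (by linarith) (hξ I hI hc i (Finset.mem_sdiff.mp hi).1)
    · push Not at hh
      obtain ⟨i, hi, h1⟩ := hh
      rw [Finset.prod_eq_zero hi, zero_mul]
      rw [dotp_neg_right] at h1
      rw [if_neg]
      linarith
  rw [step, Finset.sum_comm]
  refine Finset.sum_congr rfl fun K hK => ?_
  unfold MultiFan.dv
  rw [← Finset.sum_filter, ← Finset.mul_sum, ← Finset.sum_filter, Finset.filter_filter,
    Finset.filter_filter]

lemma DH_indep (hC : Δ.Complete) (h : Δ.DualBasis uu) {ξ ξ' : Fin n → ℝ}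
    (hξ : Δ.GenericDual uu ξ) (hξ' : Δ.GenericDual uu ξ')
    (c : Fin d → ℝ) (u : Fin n → ℝ)
    (hu : ∀ I ∈ Δ.S, I.card = n → ∀ i ∈ I, dotp u (Δ.v i) ≠ c i) :
    Δ.DH c uu ξ u = Δ.DH c uu ξ' u := by
  classical
  rw [DH_eq hC h hξ c u hu, DH_eq hC h hξ' c u hu]
  refine Finset.sum_congr rfl fun K hK => ?_
  rw [(hC K hK).2 (-ξ) (-ξ') (genericFor_of_dual hC h (genericDual_neg hξ) K)
    (genericFor_of_dual hC h (genericDual_neg hξ') K)]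

lemma DH_bound (h : Δ.DualBasis uu) (c : Fin d → ℝ) (ξ : Fin n → ℝ) :
    ∃ m : ℝ, ∀ u, Δ.DH c uu ξ u ≠ 0 → m ≤ dotp u ξ := by
  classical
  refine ⟨-∑ I ∈ Δ.S.filter (fun I => I.card = n), |∑ i ∈ I, c i * dotp (uu I i) ξ|, ?_⟩
  intro u hu
  obtain ⟨I, hI, hne⟩ := Finset.exists_ne_zero_of_sum_ne_zero hu
  have hle := Finset.single_le_sum
    (f := fun I : Finset (Fin d) => |∑ i ∈ I, c i * dotp (uu I i) ξ|)
    (fun I _ => abs_nonneg _) hI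
  obtain ⟨hI, hc⟩ := Finset.mem_filter.mp hI
  have hcond := (ite_ne_right_iff.mp hne).1
  have : ∑ i ∈ I, c i * dotp (uu I i) ξ ≤ dotp u ξ := by
    rw [mf_pair h hI hc u ξ]
    refine Finset.sum_le_sum fun i hi => ?_
    rcases hcond i hi with ⟨h1, h2⟩ | ⟨h1, h2⟩
    · exact mul_le_mul_of_nonneg_right h2 h1.le
    · exact mul_le_mul_of_nonpos_right h2 h1.le
  have h3 := neg_abs_le (∑ i ∈ I, c i * dotp (uu I i) ξ)
  linarith

lemma exists_perturb (Δ : MultiFan n d) {uu : Finset (Fin d) → Fin d → (Fin n → ℝ)} {ξ : Fin n → ℝ} (hξ : Δ.GenericDual uu ξ) (η : Fin n → ℝ) :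
    ∃ δ : ℝ, 0 < δ ∧ Δ.GenericDual uu (ξ + δ • η) := by
  have : ∀ᶠ δ : ℝ in nhdsWithin 0 (Set.Ioi 0), ∀ I ∈ Δ.S, I.card = n → ∀ i ∈ I,
      dotp (uu I i) (ξ + δ • η) ≠ 0 := by
    apply Filter.Eventually.filter_mono nhdsWithin_le_nhds
    rw [Filter.eventually_all_finset]
    intro I hI
    by_cases hc : I.card = n
    swap
    · simp [hc]
    simp only [hc, forall_true_left]
    rw [Filter.eventually_all_finset]
    intro i hi
    have hcont : Continuous fun δ : ℝ => dotp (uu I i) (ξ + δ • η) := by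
      unfold dotp
      simp only [Pi.add_apply, Pi.smul_apply, smul_eq_mul]
      fun_prop
    have := hcont.continuousAt.eventually_ne (x := 0) (y := 0) (by simpa using hξ I hI hc i hi)
    exact this
  obtain ⟨δ, h1, h2⟩ := (this.and self_mem_nhdsWithin).exists
  exact ⟨δ, h2, h1⟩

lemma DH_finite (hC : Δ.Complete) (h : Δ.DualBasis uu) {ξ : Fin n → ℝ}
    (hξ : Δ.GenericDual uu ξ) (c : Fin d → ℝ)
    (hu : ∀ u : Fin n → ℤ, ∀ I ∈ Δ.S, I.card = n → ∀ i ∈ I,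
      dotp (fun k => (u k : ℝ)) (Δ.v i) ≠ c i) :
    (Function.support fun u : Fin n → ℤ => Δ.DH c uu ξ (fun k => (u k : ℝ))).Finite := by
  have key : ∀ ξ', Δ.GenericDual uu ξ' → ∃ m : ℝ, ∀ u : Fin n → ℤ,
      Δ.DH c uu ξ (fun k => (u k : ℝ)) ≠ 0 → |dotp (fun k => (u k : ℝ)) ξ'| ≤ m := by
    intro ξ' hξ'
    obtain ⟨m1, h1⟩ := DH_bound h c ξ'
    obtain ⟨m2, h2⟩ := DH_bound h c (-ξ')
    refine ⟨max (-m1) (-m2), fun u hne => ?_⟩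
    have a1 := h1 _ (by rwa [← DH_indep hC h hξ hξ' c _ (hu u)])
    have a2 := h2 _ (by rwa [← DH_indep hC h hξ (genericDual_neg hξ') c _ (hu u)])
    rw [dotp_neg_right] at a2
    rw [abs_le]
    have b1 := le_max_left (-m1) (-m2)
    have b2 := le_max_right (-m1) (-m2)
    constructor <;> linarith
  have key2 : ∀ k : Fin n, ∃ M : ℝ, ∀ u : Fin n → ℤ,
      Δ.DH c uu ξ (fun k => (u k : ℝ)) ≠ 0 → |(u k : ℝ)| ≤ M := by
    intro k
    obtain ⟨δ, hδ, hg⟩ := exists_perturb Δ hξ (Pi.single k 1)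
    obtain ⟨m1, h1⟩ := key ξ hξ
    obtain ⟨m2, h2⟩ := key _ hg
    refine ⟨(m1 + m2) / δ, fun u hne => ?_⟩
    have a1 := h1 u hne
    have a2 := h2 u hne
    rw [dotp_add_right, dotp_smul_right] at a2
    have : dotp (fun k => (u k : ℝ)) (Pi.single k 1) = u k := by
      simp [dotp, Pi.single_apply]
    rw [this] at a2
    rw [le_div_iff₀ hδ, ← abs_of_pos hδ, ← abs_mul]
    rw [abs_le] at a1 a2 ⊢
    constructor <;> linarith
  choose M hM using key2
  apply Set.Finite.subset (Set.Finite.pi' (t := fun k => Set.Icc (-⌈M k⌉) ⌈M k⌉)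
    (fun k => Set.finite_Icc _ _))
  intro u hu k
  have := abs_le.mp (hM k u hu)
  have h1 := Int.le_ceil (M k)
  constructor
  · have : (-⌈M k⌉ : ℝ) ≤ u k := by linarith
    exact_mod_cast this
  · have : (u k : ℝ) ≤ ⌈M k⌉ := by linarith
    exact_mod_cast this

open scoped Classical in
lemma wall_cond (hC : Δ.Complete) (h : Δ.DualBasis uu) {J : Finset (Fin d)} (hJ : J ∈ Δ.S)
    (hJc : J.card + 1 = n) (ℓ : Fin n → ℝ) (hℓ : ℓ ≠ 0) (hℓJ : ∀ j ∈ J, dotp ℓ (Δ.v j) = 0) :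
    ∑ I ∈ Δ.S.filter (fun I => I.card = n ∧ J ⊆ I),
      (Δ.w I : ℝ) * SignType.sign (∑ i ∈ I, dotp ℓ (Δ.v i)) = 0 := by
  have hpos : 0 < dotp ℓ ℓ := by
    have h0 : 0 ≤ dotp ℓ ℓ := Finset.sum_nonneg fun i _ => mul_self_nonneg _
    refine lt_of_le_of_ne h0 fun h1 => hℓ ?_
    have := (Finset.sum_eq_zero_iff_of_nonneg (fun i _ => mul_self_nonneg (ℓ i))).mp h1.symm
    funext i
    simpa using this i (Finset.mem_univ _)
  have hgen : ∀ x, dotp ℓ x ≠ 0 → Δ.GenericFor J x := by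
    intro x hx L hL hJL hLn hmem
    have : J = L := Finset.eq_of_subset_of_card_le hJL (by omega)
    subst this
    apply hx
    refine dotp_span_zero ?_ hmem
    rintro _ ⟨j, hj, rfl⟩
    exact hℓJ j hj
  have hs : ∀ I ∈ Δ.S, I.card = n → J ⊆ I → (∑ i ∈ I, dotp ℓ (Δ.v i)) ≠ 0 ∧
      ∀ x, Δ.InProjCone J I x ↔ 0 ≤ dotp ℓ x * (∑ i ∈ I, dotp ℓ (Δ.v i)) := by
    intro I hI hc hJI
    have : (I \ J).card = 1 := by rw [Finset.card_sdiff_of_subset hJI]; omega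
    obtain ⟨i, hi⟩ := Finset.card_eq_one.mp this
    have hsum : ∑ i ∈ I, dotp ℓ (Δ.v i) = dotp ℓ (Δ.v i) := by
      rw [← Finset.sum_sdiff hJI, hi, Finset.sum_singleton, Finset.sum_eq_zero hℓJ, add_zero]
    have hpair : ∀ x, dotp ℓ x = dotp ℓ (Δ.v i) * dotp (uu I i) x := by
      intro x
      rw [mf_pair h hI hc ℓ x, ← Finset.sum_sdiff hJI, hi, Finset.sum_singleton,
        Finset.sum_eq_zero (s := J), add_zero]
      intro j hj
      rw [hℓJ j hj, zero_mul]
    have hne : dotp ℓ (Δ.v i) ≠ 0 := by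
      intro h0
      have := hpair ℓ
      rw [h0, zero_mul] at this
      exact hpos.ne' this
    refine ⟨hsum ▸ hne, fun x => ?_⟩
    rw [inProjCone_iff h hI hc hJI, hi, hsum, hpair x]
    simp only [Finset.mem_singleton, forall_eq]
    have : 0 < dotp ℓ (Δ.v i) * dotp ℓ (Δ.v i) := mul_self_pos.mpr hne
    rw [show dotp ℓ (Δ.v i) * dotp (uu I i) x * dotp ℓ (Δ.v i) =
      (dotp ℓ (Δ.v i) * dotp ℓ (Δ.v i)) * dotp (uu I i) x by ring]
    exact (mul_nonneg_iff_of_pos_left this).symm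
  have hd := (hC J hJ).2 ℓ (-ℓ) (hgen _ hpos.ne') (hgen _ (by
    rw [dotp_neg_right]; exact neg_ne_zero.mpr hpos.ne'))
  unfold MultiFan.dv at hd
  have conv : ∀ x, (((∑ I ∈ Δ.S.filter (fun I => I.card = n ∧ J ⊆ I ∧ Δ.InProjCone J I x), Δ.w I
      : ℤ)) : ℝ) = ∑ I ∈ Δ.S.filter (fun I => I.card = n ∧ J ⊆ I),
        if Δ.InProjCone J I x then (Δ.w I : ℝ) else 0 := by
    intro x
    rw [← Finset.sum_filter, Finset.filter_filter]
    push_cast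
    simp only [and_assoc]
  have hd' := congrArg (fun z : ℤ => (z : ℝ)) hd
  rw [conv, conv, ← sub_eq_zero, ← Finset.sum_sub_distrib] at hd'
  rw [← hd']
  refine Finset.sum_congr rfl fun I hI => ?_
  obtain ⟨hI, hc, hJI⟩ := Finset.mem_filter.mp hI
  obtain ⟨h1, h2⟩ := hs I hI hc hJI
  rw [h2, h2, dotp_neg_right]
  rcases lt_or_gt_of_ne h1 with hlt | hgt
  · rw [sign_neg hlt, if_neg, if_pos]
    · simp
    · nlinarith
    · nlinarith
  · rw [sign_pos hgt, if_pos, if_neg]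
    · simp
    · nlinarith
    · nlinarith

end MF


section Card
variable {n d : ℕ}

/-- order of `G_I ≅ N/N_I` -/
noncomputable def gcard (Δ : LMultiFan n d) (I : Finset (Fin d)) : ℕ :=
  Nat.card ((Fin n → ℤ) ⧸ Submodule.span ℤ (Δ.v '' (I : Set (Fin d))))

/-- rational dual basis property -/
def QDual (Δ : LMultiFan n d) (uu : Finset (Fin d) → Fin d → (Fin n → ℚ)) : Prop :=
  ∀ I ∈ Δ.S, I.card = n → ∀ i ∈ I, ∀ j ∈ I,
    ∑ k, uu I i k * (Δ.v j k : ℚ) = if i = j then 1 else 0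

lemma qdual_of (Δ : LMultiFan n d) (uu : Finset (Fin d) → Fin d → (Fin n → ℚ))
    (huu : Δ.toMF.DualBasis (fun I i k => ((uu I i k : ℝ)))) : QDual Δ uu := by
  intro I hI hc i hi j hj
  have := huu I hI hc i hi j hj
  simp only [dotp, LMultiFan.toMF] at this
  have h2 : ((∑ k, uu I i k * (Δ.v j k : ℚ) : ℚ) : ℝ) = ((if i = j then 1 else 0 : ℚ) : ℝ) := by
    rw [Rat.cast_sum]
    push_cast
    rw [this]
    split_ifs <;> simp
  exact_mod_cast h2

variable {Δ : LMultiFan n d} {uu : Finset (Fin d) → Fin d → (Fin n → ℚ)}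

lemma gcard_det (h : QDual Δ uu) {I : Finset (Fin d)} (hI : I ∈ Δ.S) (hc : I.card = n)
    (f : Fin n → Fin d) (hf : Function.Injective f) (hr : ∀ i, i ∈ I ↔ ∃ k, f k = i) :
    (Matrix.det (Matrix.of fun a b => Δ.v (f a) b)).natAbs = gcard Δ I := by
  have hli : LinearIndependent ℤ (fun a => Δ.v (f a)) := by
    rw [Fintype.linearIndependent_iff]
    intro g hg a
    have h1 : ∀ l, ∑ b, (g b : ℚ) * (Δ.v (f b) l : ℚ) = 0 := by
      intro l
      have := congrFun hg l
      simp only [Finset.sum_apply, Pi.smul_apply, smul_eq_mul, Pi.zero_apply] at this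
      exact_mod_cast this
    have h2 : ∑ l, uu I (f a) l * ∑ b, (g b : ℚ) * (Δ.v (f b) l : ℚ) = g a := by
      simp only [Finset.mul_sum]
      rw [Finset.sum_comm]
      have : ∀ b, ∑ l, uu I (f a) l * ((g b : ℚ) * (Δ.v (f b) l : ℚ)) =
          if a = b then (g b : ℚ) else 0 := by
        intro b
        have h3 := h I hI hc (f a) ((hr _).mpr ⟨a, rfl⟩) (f b) ((hr _).mpr ⟨b, rfl⟩)
        simp only [hf.eq_iff] at h3
        calc _ = (g b : ℚ) * ∑ l, uu I (f a) l * (Δ.v (f b) l : ℚ) := by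
              rw [Finset.mul_sum]; exact Finset.sum_congr rfl fun l _ => by ring
          _ = _ := by rw [h3]; simp
      simp [this]
    simp only [h1, mul_zero, Finset.sum_const_zero] at h2
    exact_mod_cast h2.symm
  have hspan : Set.range (fun a => Δ.v (f a)) = Δ.v '' (I : Set (Fin d)) := by
    ext x
    simp only [Set.mem_range, Set.mem_image, Finset.mem_coe]
    constructor
    · rintro ⟨a, rfl⟩
      exact ⟨f a, (hr _).mpr ⟨a, rfl⟩, rfl⟩
    · rintro ⟨i, hi, rfl⟩
      obtain ⟨a, rfl⟩ := (hr _).mp hi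
      exact ⟨a, rfl⟩
  unfold gcard
  rw [← hspan, ← Submodule.natAbs_det_basis_change (Pi.basisFun ℤ (Fin n)) _ (Module.Basis.span hli)]
  have h0 : ((↑) ∘ (Module.Basis.span hli) : Fin n → Fin n → ℤ) = fun a => Δ.v (f a) := by
    funext a
    simp [Module.Basis.span_apply]
  rw [h0, Pi.basisFun_det_apply]

lemma exists_enum {I : Finset (Fin d)} (hc : I.card = n) : ∃ f : Fin n → Fin d,
    Function.Injective f ∧ ∀ i, i ∈ I ↔ ∃ k, f k = i := by
  let e : Fin n ≃ I := (finCongr hc.symm).trans I.equivFin.symm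
  refine ⟨fun a => e a, Subtype.val_injective.comp e.injective, fun i => ⟨fun hi =>
    ⟨e.symm ⟨i, hi⟩, by simp⟩, ?_⟩⟩
  rintro ⟨k, rfl⟩
  exact (e k).2

lemma gcard_ratio (h : QDual Δ uu) {J : Finset (Fin d)} {i i' : Fin d} (hi : i ∉ J) (hi' : i' ∉ J)
    (hI : insert i J ∈ Δ.S) (hI' : insert i' J ∈ Δ.S) (hJ : J.card + 1 = n) :
    (gcard Δ (insert i' J) : ℚ) =
      |∑ k, uu (insert i J) i k * (Δ.v i' k : ℚ)| * gcard Δ (insert i J) := by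
  have hc : (insert i J).card = n := by rw [Finset.card_insert_of_notMem hi, hJ]
  have hc' : (insert i' J).card = n := by rw [Finset.card_insert_of_notMem hi', hJ]
  obtain ⟨f, hf, hr⟩ := exists_enum hc
  obtain ⟨a, ha⟩ := (hr i).mp (Finset.mem_insert_self _ _)
  have hne : ∀ b, b ≠ a → f b ∈ J := by
    intro b hb
    have := (hr (f b)).mpr ⟨b, rfl⟩
    rw [Finset.mem_insert] at this
    rcases this with h1 | h1
    · exact absurd (hf (h1.trans ha.symm)) hb
    · exact h1
  have hf' : Function.Injective (Function.update f a i') := by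
    intro b c hbc
    by_cases h1 : b = a <;> by_cases h2 : c = a
    · rw [h1, h2]
    · subst h1
      rw [Function.update_self, Function.update_of_ne h2] at hbc
      exact absurd (hbc ▸ hne c h2) hi'
    · subst h2
      rw [Function.update_self, Function.update_of_ne h1] at hbc
      exact absurd (hbc ▸ hne b h1) hi'
    · rw [Function.update_of_ne h1, Function.update_of_ne h2] at hbc
      exact hf hbc
  have hr' : ∀ j, j ∈ insert i' J ↔ ∃ k, Function.update f a i' k = j := by
    intro j
    rw [Finset.mem_insert]
    constructor
    · rintro (rfl | hj)
      · exact ⟨a, by simp⟩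
      · obtain ⟨k, hk⟩ := (hr j).mp (Finset.mem_insert_of_mem hj)
        refine ⟨k, ?_⟩
        rw [Function.update_of_ne, hk]
        rintro rfl
        rw [ha] at hk
        exact hi (hk ▸ hj)
    · rintro ⟨k, rfl⟩
      by_cases hk : k = a
      · subst hk; simp
      · rw [Function.update_of_ne hk]
        exact Or.inr (hne k hk)
  have d1 := gcard_det h hI hc f hf hr
  have d2 := gcard_det h hI' hc' _ hf' hr'
  rw [← d1, ← d2, Nat.cast_natAbs, Nat.cast_natAbs, Int.cast_abs, Int.cast_abs, ← abs_mul]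
  congr 1
  let A : Matrix (Fin n) (Fin n) ℚ := Matrix.of fun b l => (Δ.v (f b) l : ℚ)
  have e1 : ((Matrix.det (Matrix.of fun b l => Δ.v (f b) l) : ℤ) : ℚ) = A.det := by
    rw [Int.cast_det]; rfl
  have e2 : ((Matrix.det (Matrix.of fun b l => Δ.v (Function.update f a i' b) l) : ℤ) : ℚ) = (A.updateRow a (fun l => (Δ.v i' l : ℚ))).det := by
    rw [Int.cast_det]
    congr 1
    ext b l
    by_cases hb : b = a
    · subst hb; simp
    · simp [Matrix.updateRow_ne hb, Function.update_of_ne hb, A]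
  rw [e1, e2]
  have hrow : (fun l => (Δ.v i' l : ℚ)) =
      ∑ b, (∑ k, uu (insert i J) (f b) k * (Δ.v i' k : ℚ)) • A b := by
    funext l
    have := expand_vec hc (h _ hI hc) (fun l => (Δ.v i' l : ℚ)) l
    rw [this, Finset.sum_apply]
    have himg : insert i J = Finset.univ.image f := by
      ext j; rw [hr]; simp
    conv_lhs => rw [himg]
    rw [Finset.sum_image (fun x _ y _ hxy => hf hxy)]
    rw [← himg]
    rfl
  rw [hrow, Matrix.det_updateRow_sum, ha]
  rfl

lemma gcard_pos (h : QDual Δ uu) {I : Finset (Fin d)} (hI : I ∈ Δ.S) (hc : I.card = n) :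
    gcard Δ I ≠ 0 := by
  obtain ⟨f, hf, hr⟩ := exists_enum hc
  rw [← gcard_det h hI hc f hf hr]
  rw [Int.natAbs_ne_zero]
  intro h0
  let A : Matrix (Fin n) (Fin n) ℚ := Matrix.of fun b l => (Δ.v (f b) l : ℚ)
  let B : Matrix (Fin n) (Fin n) ℚ := Matrix.of fun l b => uu I (f b) l
  have e1 : ((Matrix.det (Matrix.of fun b l => Δ.v (f b) l) : ℤ) : ℚ) = A.det := by
    rw [Int.cast_det]; rfl
  have hAB : A * B = 1 := by
    ext a b
    rw [Matrix.mul_apply, Matrix.one_apply]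
    have := h I hI hc (f b) ((hr _).mpr ⟨b, rfl⟩) (f a) ((hr _).mpr ⟨a, rfl⟩)
    simp only [hf.eq_iff] at this
    simp only [A, B, Matrix.of_apply, mul_comm] at this ⊢
    rw [this]
    simp [eq_comm]
  have := congrArg Matrix.det hAB
  rw [Matrix.det_mul, ← e1, h0] at this
  simp at this

end Card


section Reg
variable {R : Type*} [CommRing R] [IsDomain R]

/-- regularity of a fraction at a prime element -/
def Reg (p : R) (x : FractionRing R) : Prop :=
  ∃ a b : R, ¬ p ∣ b ∧ x = algebraMap R (FractionRing R) a / algebraMap R (FractionRing R) b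

lemma alg_ne {b p : R} (hb : ¬ p ∣ b) : algebraMap R (FractionRing R) b ≠ 0 := by
  intro h
  apply hb
  rw [(IsFractionRing.injective R (FractionRing R)).eq_iff' (map_zero _)] at h
  rw [h]
  exact dvd_zero _

lemma Reg.add {p : R} (hp : Prime p) {x y : FractionRing R} (hx : Reg p x) (hy : Reg p y) :
    Reg p (x + y) := by
  obtain ⟨a, b, hb, rfl⟩ := hx
  obtain ⟨a', b', hb', rfl⟩ := hy
  refine ⟨a * b' + b * a', b * b', hp.not_dvd_mul hb hb', ?_⟩
  rw [div_add_div _ _ (alg_ne hb) (alg_ne hb')]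
  simp

lemma Reg.mul_alg {p : R} {x : FractionRing R} (hx : Reg p x) (r : R) :
    Reg p (algebraMap R (FractionRing R) r * x) := by
  obtain ⟨a, b, hb, rfl⟩ := hx
  refine ⟨r * a, b, hb, ?_⟩
  rw [map_mul, mul_div_assoc]

lemma Reg.zero {p : R} (hp : Prime p) : Reg p (0 : FractionRing R) :=
  ⟨0, 1, hp.not_dvd_one, by simp⟩

lemma Reg.sum {ι : Type*} {p : R} (hp : Prime p) (s : Finset ι) (x : ι → FractionRing R)
    (h : ∀ i ∈ s, Reg p (x i)) : Reg p (∑ i ∈ s, x i) := by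
  classical
  induction s using Finset.induction_on with
  | empty => simpa using Reg.zero hp
  | insert a s ha ih =>
    rw [Finset.sum_insert ha]
    exact (h a (Finset.mem_insert_self _ _)).add hp (ih fun i hi => h i (Finset.mem_insert_of_mem hi))

lemma exists_of_reg [UniqueFactorizationMonoid R] (x : FractionRing R)
    (h : ∀ p : R, Prime p → Reg p x) : ∃ r : R, x = algebraMap R (FractionRing R) r := by
  have hred := IsFractionRing.num_den_reduced R x
  have hx := IsFractionRing.mk'_num_den' R x
  by_cases hu : IsUnit (IsFractionRing.den R x : R)
  · obtain ⟨u, hu⟩ := hu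
    refine ⟨IsFractionRing.num R x * (u⁻¹ : Rˣ), ?_⟩
    refine hx.symm.trans ?_
    rw [← hu, map_mul, div_eq_mul_inv]
    congr 1
    apply inv_eq_of_mul_eq_one_right
    rw [← map_mul]; simp
  · exfalso
    have h0 : (IsFractionRing.den R x : R) ≠ 0 := nonZeroDivisors.coe_ne_zero _
    obtain ⟨p, hp, hpd⟩ := WfDvdMonoid.exists_irreducible_factor hu h0
    have hp' : Prime p := UniqueFactorizationMonoid.irreducible_iff_prime.mp hp
    obtain ⟨a, b, hb, hab⟩ := h p hp'
    rw [← hx] at hab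
    have hd0 : algebraMap R (FractionRing R) (IsFractionRing.den R x : R) ≠ 0 := by
      rw [Ne, (IsFractionRing.injective R (FractionRing R)).eq_iff' (map_zero _)]
      exact h0
    rw [div_eq_div_iff hd0 (alg_ne hb), ← map_mul, ← map_mul,
      (IsFractionRing.injective R (FractionRing R)).eq_iff] at hab
    have : p ∣ IsFractionRing.num R x * b := by
      rw [hab]; exact hpd.mul_left _
    rcases hp'.dvd_or_dvd this with h1 | h1
    · exact hp.not_isUnit (hred h1 hpd)
    · exact hb h1

/-- evaluation of an identity between fractions -/
lemma eval_frac {ι F : Type*} [Field F] (φ : R →+* F) (s : Finset ι) (a g : ι → R)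
    (hg : ∀ i ∈ s, φ (g i) ≠ 0) (p : R)
    (h : ∑ i ∈ s, algebraMap R (FractionRing R) (a i) / algebraMap R (FractionRing R) (g i) =
      algebraMap R (FractionRing R) p) :
    ∑ i ∈ s, φ (a i) / φ (g i) = φ p := by
  classical
  have alg0 : ∀ x : R, φ x ≠ 0 → algebraMap R (FractionRing R) x ≠ 0 := by
    intro x hx h0
    rw [(IsFractionRing.injective R (FractionRing R)).eq_iff' (map_zero _)] at h0
    exact hx (by rw [h0, map_zero])
  have key : ∀ t ⊆ s, ∃ N D : R, φ D ≠ 0 ∧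
      ∑ i ∈ t, algebraMap R (FractionRing R) (a i) / algebraMap R (FractionRing R) (g i) =
        algebraMap R (FractionRing R) N / algebraMap R (FractionRing R) D ∧
      ∑ i ∈ t, φ (a i) / φ (g i) = φ N / φ D := by
    intro t
    induction t using Finset.induction_on with
    | empty => exact fun _ => ⟨0, 1, by simp, by simp, by simp⟩
    | insert b t hb ih =>
      intro ht
      obtain ⟨N, D, h1, h2, h3⟩ := ih fun i hi => ht (Finset.mem_insert_of_mem hi)
      have hgb := hg b (ht (Finset.mem_insert_self _ _))
      refine ⟨a b * D + g b * N, g b * D, by rw [map_mul]; exact mul_ne_zero hgb h1, ?_, ?_⟩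
      · rw [Finset.sum_insert hb, h2, div_add_div _ _ (alg0 _ hgb) (alg0 _ h1)]
        simp
      · rw [Finset.sum_insert hb, h3, div_add_div _ _ hgb h1]
        simp
  obtain ⟨N, D, h1, h2, h3⟩ := key s (Finset.Subset.refl _)
  rw [h3]
  rw [h2, div_eq_iff (alg0 _ h1), ← map_mul,
    (IsFractionRing.injective R (FractionRing R)).eq_iff] at h
  rw [h, map_mul, mul_div_cancel_right₀ _ h1]

end Reg

section Lin
variable {n : ℕ}
open MvPolynomial

/-- the linear form with rational coefficients `u` -/
noncomputable def lin (u : Fin n → ℚ) : MvPolynomial (Fin n) ℂ :=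
  ∑ k : Fin n, ((u k : ℂ)) • MvPolynomial.X k

lemma lin_eval (u x : Fin n → ℚ) : eval (fun k => (x k : ℂ)) (lin u) = ((∑ k, u k * x k : ℚ) : ℂ) := by
  simp [lin, smul_eval]

lemma lin_smul (a : ℚ) (u : Fin n → ℚ) : lin (a • u) = C (a : ℂ) * lin u := by
  simp only [lin, Finset.mul_sum, Pi.smul_apply, smul_eq_mul]
  refine Finset.sum_congr rfl fun k _ => ?_
  rw [smul_eq_C_mul, smul_eq_C_mul, ← mul_assoc, ← C_mul]
  push_cast; rfl

lemma lin_sub (u v : Fin n → ℚ) : lin (u - v) = lin u - lin v := by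
  simp only [lin, ← Finset.sum_sub_distrib, Pi.sub_apply]
  refine Finset.sum_congr rfl fun k _ => ?_
  rw [← sub_smul]
  push_cast; rfl

lemma lin_ne_zero {u : Fin n → ℚ} (hu : u ≠ 0) : lin u ≠ 0 := by
  intro h
  apply hu
  funext k
  have := lin_eval u (Pi.single k 1)
  rw [h, map_zero] at this
  simp only [Pi.single_apply, mul_ite, mul_one, mul_zero, Finset.sum_ite_eq', Finset.mem_univ,
    if_true] at this
  exact_mod_cast this.symm

lemma lin_degree (u : Fin n → ℚ) : (lin u).totalDegree ≤ 1 := by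
  refine totalDegree_finsetSum_le fun k _ => ?_
  exact (totalDegree_smul_le _ _).trans (by simp)

lemma dvd_lin {p : MvPolynomial (Fin n) ℂ} (hp : Prime p) {u : Fin n → ℚ} (hu : u ≠ 0)
    (h : p ∣ lin u) : ∃ a : ℂ, a ≠ 0 ∧ lin u = C a * p := by
  obtain ⟨q, hq⟩ := h
  have h0 := lin_ne_zero hu
  have hq0 : q ≠ 0 := by rintro rfl; simp at hq; exact h0 hq
  have hdeg := lin_degree u
  rw [hq, totalDegree_mul_of_isDomain hp.ne_zero hq0] at hdeg
  have hp1 : p.totalDegree ≠ 0 := by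
    intro h1
    rw [totalDegree_eq_zero_iff_eq_C] at h1
    apply hp.not_isUnit
    rw [h1]
    apply IsUnit.map
    rw [isUnit_iff_ne_zero]
    intro h2
    rw [h2, C_0] at h1
    exact hp.ne_zero h1
  have hq1 : q.totalDegree = 0 := by omega
  rw [totalDegree_eq_zero_iff_eq_C] at hq1
  refine ⟨q.coeff 0, ?_, ?_⟩
  · intro h2
    rw [h2, C_0] at hq1
    exact hq0 hq1
  · rw [hq, mul_comm, ← hq1]

lemma aeval_dvd {d : ℕ} (P : MvPolynomial (Fin n) ℂ) (a b : Fin d → MvPolynomial (Fin n) ℂ)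
    (h : ∀ k, P ∣ a k - b k) (f : MvPolynomial (Fin d) ℂ) :
    P ∣ aeval a f - aeval b f := by
  have : (Ideal.Quotient.mkₐ ℂ (Ideal.span {P})).comp (aeval a) =
      (Ideal.Quotient.mkₐ ℂ (Ideal.span {P})).comp (aeval b) := by
    apply MvPolynomial.algHom_ext
    intro k
    simp only [AlgHom.comp_apply, aeval_X, Ideal.Quotient.mkₐ_eq_mk]
    rw [Ideal.Quotient.eq, Ideal.mem_span_singleton]
    exact h k
  have h2 := DFunLike.congr_fun this f
  simp only [AlgHom.comp_apply, Ideal.Quotient.mkₐ_eq_mk] at h2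
  rwa [Ideal.Quotient.eq, Ideal.mem_span_singleton] at h2

end Lin

section Wall
variable {n d : ℕ} {Δ : LMultiFan n d} {uu : Finset (Fin d) → Fin d → (Fin n → ℚ)}
open MvPolynomial

lemma uu_ne_zero (h : QDual Δ uu) {I : Finset (Fin d)} (hI : I ∈ Δ.S) (hc : I.card = n)
    {i : Fin d} (hi : i ∈ I) : uu I i ≠ 0 := by
  intro h0
  have := h I hI hc i hi i hi
  rw [h0] at this
  simp at this

/-- pairing of a rational covector with a ray vector -/
def pr (Δ : LMultiFan n d) (ℓ : Fin n → ℚ) (i : Fin d) : ℚ := ∑ k, ℓ k * (Δ.v i k : ℚ)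

lemma dvd_uu (h : QDual Δ uu) {I : Finset (Fin d)} (hI : I ∈ Δ.S) (hc : I.card = n)
    {i : Fin d} (hi : i ∈ I) {ℓ : Fin n → ℚ} (hP : Prime (lin ℓ)) (hd : lin ℓ ∣ lin (uu I i)) :
    pr Δ ℓ i ≠ 0 ∧ ∀ j ∈ I, j ≠ i → pr Δ ℓ j = 0 := by
  obtain ⟨a, ha, hae⟩ := dvd_lin hP (uu_ne_zero h hI hc hi) hd
  have key : ∀ j ∈ I, (if i = j then 1 else 0 : ℂ) = a * (pr Δ ℓ j : ℂ) := by
    intro j hj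
    have := congrArg (eval (fun k => ((Δ.v j k : ℚ) : ℂ))) hae
    rw [lin_eval, map_mul, lin_eval, eval_C, h I hI hc i hi j hj] at this
    unfold pr
    rw [← this]
    split_ifs <;> simp
  constructor
  · intro h0
    have := key i hi
    rw [h0] at this
    simp at this
  · intro j hj hji
    have := key j hj
    rw [if_neg (Ne.symm hji)] at this
    have := (mul_eq_zero.mp this.symm).resolve_left ha
    exact_mod_cast this

lemma wall_struct (h : QDual Δ uu) {I J : Finset (Fin d)} (hI : I ∈ Δ.S) (hc : I.card = n)
    (hJI : J ⊆ I) (hJc : J.card + 1 = n) {ℓ : Fin n → ℚ} (hℓ : ℓ ≠ 0)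
    (hJ : ∀ j ∈ J, pr Δ ℓ j = 0) :
    ∃ i, i ∉ J ∧ I = insert i J ∧ pr Δ ℓ i ≠ 0 ∧ ℓ = pr Δ ℓ i • uu I i ∧
      (∀ y : Fin n → ℚ, (∀ j ∈ J, pr Δ y j = 0) → y = pr Δ y i • uu I i) := by
  have : (I \ J).card = 1 := by rw [Finset.card_sdiff_of_subset hJI]; omega
  obtain ⟨i, hi⟩ := Finset.card_eq_one.mp this
  have hiI : i ∈ I \ J := by rw [hi]; exact Finset.mem_singleton_self _
  obtain ⟨hiI, hiJ⟩ := Finset.mem_sdiff.mp hiI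
  have hins : I = insert i J := by
    rw [← Finset.sdiff_union_of_subset hJI, hi]; rfl
  have hy : ∀ y : Fin n → ℚ, (∀ j ∈ J, pr Δ y j = 0) → y = pr Δ y i • uu I i := by
    intro y hy
    funext l
    rw [expand_cov hc (h I hI hc) y l, ← Finset.sum_sdiff hJI, hi, Finset.sum_singleton,
      Finset.sum_eq_zero (s := J), add_zero]
    · rfl
    · intro j hj
      have := hy j hj
      unfold pr at this
      rw [this, zero_mul]
  refine ⟨i, hiJ, hins, ?_, hy ℓ hJ, hy⟩
  intro h0
  have := hy ℓ hJ
  rw [h0, zero_smul] at this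
  exact hℓ this

/-- one term of the index map -/
noncomputable def term (Δ : LMultiFan n d) (uu : Finset (Fin d) → Fin d → (Fin n → ℚ))
    (f : MvPolynomial (Fin d) ℂ) (I : Finset (Fin d)) : FractionRing (MvPolynomial (Fin n) ℂ) :=
  algebraMap (MvPolynomial (Fin n) ℂ) (FractionRing (MvPolynomial (Fin n) ℂ))
      (MvPolynomial.C ((Δ.w I : ℂ) / (gcard Δ I : ℂ))) *
    (algebraMap (MvPolynomial (Fin n) ℂ) _ (iotaC uu I f) /
     algebraMap (MvPolynomial (Fin n) ℂ) _ (∏ i ∈ I, lin (uu I i)))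

lemma piShriek_eq (f : MvPolynomial (Fin d) ℂ) :
    piShriekC Δ uu f = ∑ I ∈ Δ.S.filter (fun I => I.card = n), term Δ uu f I := by
  unfold piShriekC term gcard lin
  congr!

open scoped Classical in
lemma wall_reg (hC : Δ.toMF.Complete) (huu : Δ.toMF.DualBasis (fun I i k => ((uu I i k : ℝ))))
    {J : Finset (Fin d)} (hJS : J ∈ Δ.S) (hJc : J.card + 1 = n) {ℓ : Fin n → ℚ} (hℓ : ℓ ≠ 0)
    (hJ : ∀ j ∈ J, pr Δ ℓ j = 0) (hP : Prime (lin ℓ)) (f : MvPolynomial (Fin d) ℂ) :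
    Reg (lin ℓ) (∑ I ∈ Δ.S.filter (fun I => I.card = n ∧ J ⊆ I), term Δ uu f I) := by
  have h := qdual_of Δ uu huu
  rcases (Δ.S.filter (fun I => I.card = n ∧ J ⊆ I)).eq_empty_or_nonempty with he | ⟨I1, hI1⟩
  · rw [he]; simpa using Reg.zero hP
  obtain ⟨hI1, hc1, hJ1⟩ := Finset.mem_filter.mp hI1
  set σ : Finset (Fin d) → ℚ := fun I => ∑ i ∈ I, pr Δ ℓ i with hσ
  have hσi : ∀ i, i ∉ J → σ (insert i J) = pr Δ ℓ i := by
    intro i hi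
    simp only [hσ]
    rw [Finset.sum_insert hi, Finset.sum_eq_zero hJ, add_zero]
  set a0 : Fin d → MvPolynomial (Fin n) ℂ := fun k => if k ∈ J then lin (uu I1 k) else 0 with ha0
  -- the key congruence
  have hcongr : ∀ I ∈ Δ.S, I.card = n → J ⊆ I → ∀ q : MvPolynomial (Fin d) ℂ,
      lin ℓ ∣ iotaC uu I q - aeval a0 q := by
    intro I hI hc hJI q
    obtain ⟨i, hiJ, hins, hpi, hℓi, hy⟩ := wall_struct h hI hc hJI hJc hℓ hJ
    unfold iotaC
    apply aeval_dvd
    have hdi : ∀ y : Fin n → ℚ, (∀ j ∈ J, pr Δ y j = 0) → lin ℓ ∣ lin y := by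
      intro y hyJ
      have e : y = (pr Δ y i * (pr Δ ℓ i)⁻¹) • ℓ := by
        conv_lhs => rw [hy y hyJ]
        conv_rhs => rw [hℓi]
        rw [smul_smul, mul_assoc]
        congr 1
        rw [← hℓi, inv_mul_cancel₀ hpi, mul_one]
      rw [e, lin_smul]
      exact dvd_mul_left _ _
    intro k
    simp only [ha0]
    by_cases hkJ : k ∈ J
    · rw [if_pos (hJI hkJ), if_pos hkJ]
      change lin ℓ ∣ lin (uu I k) - lin (uu I1 k)
      rw [← lin_sub]
      apply hdi
      intro j hj
      have e1 := h I hI hc k (hJI hkJ) j (hJI hj)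
      have e2 := h I1 hI1 hc1 k (hJ1 hkJ) j (hJ1 hj)
      unfold pr
      simp only [Pi.sub_apply, sub_mul, Finset.sum_sub_distrib]
      rw [e1, e2, sub_self]
    · rw [if_neg hkJ, sub_zero]
      by_cases hkI : k ∈ I
      · rw [if_pos hkI]
        apply hdi
        intro j hj
        have := h I hI hc k hkI j (hJI hj)
        unfold pr
        rw [this, if_neg]
        rintro rfl
        exact hkJ hj
      · rw [if_neg hkI]
        exact dvd_zero _
  set g : Finset (Fin d) → MvPolynomial (Fin n) ℂ := fun I => ∏ j ∈ J, lin (uu I j) with hg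
  have hgi : ∀ I, J ⊆ I → g I = iotaC uu I (∏ j ∈ J, X j) := by
    intro I hJI
    unfold iotaC
    rw [map_prod]
    refine Finset.prod_congr rfl fun j hj => ?_
    rw [aeval_X, if_pos (hJI hj)]
    rfl
  have hgnd : ∀ I ∈ Δ.S, I.card = n → J ⊆ I → ¬ lin ℓ ∣ g I := by
    intro I hI hc hJI hdv
    obtain ⟨j, hj, hdj⟩ := (hP.dvd_finsetProd_iff _).mp hdv
    exact (dvd_uu h hI hc (hJI hj) hP hdj).1 (hJ j hj)
  set κ : ℚ := |σ I1| / gcard Δ I1 with hκ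
  have hterm : ∀ I ∈ Δ.S, I.card = n → J ⊆ I → ∃ r, Reg (lin ℓ) r ∧
      term Δ uu f I = algebraMap (MvPolynomial (Fin n) ℂ) (FractionRing (MvPolynomial (Fin n) ℂ))
        (C (((κ * (Δ.w I * SignType.sign (σ I)) : ℚ)) : ℂ)) *
        (algebraMap _ _ (iotaC uu I1 f) / algebraMap _ _ (lin ℓ * g I1)) + r := by
    intro I hI hc hJI
    obtain ⟨i1, hi1J, hins1, hpi1, hℓi1, -⟩ := wall_struct h hI1 hc1 hJ1 hJc hℓ hJ
    obtain ⟨i, hiJ, hins, hpi, hℓi, -⟩ := wall_struct h hI hc hJI hJc hℓ hJ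
    have hσI : σ I = pr Δ ℓ i := by rw [hins]; exact hσi i hiJ
    have hσ1 : σ I1 = pr Δ ℓ i1 := by rw [hins1]; exact hσi i1 hi1J
    have hratio := gcard_ratio h hi1J hiJ (hins1 ▸ hI1) (hins ▸ hI) hJc
    rw [← hins, ← hins1] at hratio
    have hpr : pr Δ ℓ i = pr Δ ℓ i1 * ∑ k, uu I1 i1 k * (Δ.v i k : ℚ) := by
      conv_lhs => rw [hℓi1]
      unfold pr
      simp only [Pi.smul_apply, smul_eq_mul, Finset.mul_sum, mul_assoc]
    have hG1 : (gcard Δ I1 : ℚ) ≠ 0 := by exact_mod_cast gcard_pos h hI1 hc1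
    have hG : (gcard Δ I : ℚ) ≠ 0 := by exact_mod_cast gcard_pos h hI hc
    -- coefficient identity
    have hcoef : (Δ.w I : ℚ) / gcard Δ I * σ I = κ * (Δ.w I * SignType.sign (σ I)) := by
      have e1 : κ * gcard Δ I = |σ I| := by
        rw [hκ, hσI, hσ1, hpr, abs_mul, hratio]
        field_simp
      have e2 : σ I = |σ I| * SignType.sign (σ I) := (abs_mul_sign _).symm
      rw [div_mul_eq_mul_div, div_eq_iff hG]
      conv_lhs => rw [e2]
      rw [← e1]
      ring
    -- divisibility
    have hdv : lin ℓ ∣ iotaC uu I f * g I1 - iotaC uu I1 f * g I := by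
      rw [hgi I hJI, hgi I1 hJ1]
      have d1 := hcongr I hI hc hJI f
      have d2 := hcongr I1 hI1 hc1 hJ1 f
      have d3 := hcongr I hI hc hJI (∏ j ∈ J, X j)
      have d4 := hcongr I1 hI1 hc1 hJ1 (∏ j ∈ J, X j)
      have d5 := dvd_sub d1 d2
      have d6 := dvd_sub d3 d4
      have := dvd_sub (d5.mul_right (iotaC uu I1 (∏ j ∈ J, X j)))
        (d6.mul_right (iotaC uu I1 f))
      convert this using 1
      ring
    obtain ⟨q, hq⟩ := hdv
    have n1 := hgnd I hI hc hJI
    have n2 := hgnd I1 hI1 hc1 hJ1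
    have hprod : C ((σ I : ℚ) : ℂ) * ∏ i ∈ I, lin (uu I i) = lin ℓ * g I := by
      conv_rhs => rw [hℓi]
      rw [lin_smul, hσI]
      conv_lhs =>
        rw [show ∏ i ∈ I, lin (uu I i) = ∏ k ∈ insert i J, lin (uu I k) by rw [← hins]]
        rw [Finset.prod_insert hiJ]
      simp only [hg]
      ring
    have a1 := alg_ne n1
    have a2 := alg_ne n2
    have aP : algebraMap (MvPolynomial (Fin n) ℂ) (FractionRing (MvPolynomial (Fin n) ℂ)) (lin ℓ) ≠ 0 := by
      rw [Ne, (IsFractionRing.injective (MvPolynomial (Fin n) ℂ) (FractionRing (MvPolynomial (Fin n) ℂ))).eq_iff' (map_zero _)]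
      exact hP.ne_zero
    have hσ0 : ((σ I : ℚ) : ℂ) ≠ 0 := by
      rw [hσI]; exact_mod_cast hpi
    have aσ : algebraMap (MvPolynomial (Fin n) ℂ) (FractionRing (MvPolynomial (Fin n) ℂ)) (C ((σ I : ℚ) : ℂ)) ≠ 0 := by
      rw [Ne, (IsFractionRing.injective (MvPolynomial (Fin n) ℂ) (FractionRing (MvPolynomial (Fin n) ℂ))).eq_iff' (map_zero _)]
      rwa [C_eq_zero]
    refine ⟨algebraMap (MvPolynomial (Fin n) ℂ) _ (C (((κ * (Δ.w I * SignType.sign (σ I)) : ℚ)) : ℂ)) *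
      (algebraMap _ _ q / algebraMap _ _ (g I * g I1)), ?_, ?_⟩
    · exact Reg.mul_alg ⟨q, _, hP.not_dvd_mul n1 n2, rfl⟩ _
    · rw [← mul_add, ← hcoef]
      have e1 : algebraMap (MvPolynomial (Fin n) ℂ) (FractionRing (MvPolynomial (Fin n) ℂ)) (iotaC uu I1 f) /
            algebraMap _ _ (lin ℓ * g I1) + algebraMap _ _ q / algebraMap _ _ (g I * g I1) =
          algebraMap _ _ (iotaC uu I f) / algebraMap _ _ (lin ℓ * g I) := by
        have := congrArg (algebraMap (MvPolynomial (Fin n) ℂ) (FractionRing (MvPolynomial (Fin n) ℂ))) hq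
        simp only [map_mul, map_sub] at this ⊢
        rw [div_add_div _ _ (mul_ne_zero aP a2) (mul_ne_zero a1 a2), div_eq_div_iff
          (mul_ne_zero (mul_ne_zero aP a2) (mul_ne_zero a1 a2)) (mul_ne_zero aP a1)]
        linear_combination -(algebraMap _ _ (lin ℓ) * algebraMap _ _ (g I1) * algebraMap _ _ (g I)) * this
      rw [e1, ← hprod]
      unfold term
      have e3 : (((Δ.w I : ℚ) / gcard Δ I * σ I : ℚ) : ℂ) =
          (Δ.w I : ℂ) / (gcard Δ I : ℂ) * ((σ I : ℚ) : ℂ) := by push_cast; rfl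
      rw [e3, C_mul, map_mul, map_mul]
      have aux : ∀ A S F G : FractionRing (MvPolynomial (Fin n) ℂ), S ≠ 0 →
          A * (F / G) = A * S * (F / (S * G)) := by
        intro A S F G hS
        rw [← mul_div_mul_left F G hS]
        ring
      exact aux _ _ _ _ aσ
  choose! r hr1 hr2 using hterm
  rw [Finset.sum_congr rfl (g := fun I => algebraMap (MvPolynomial (Fin n) ℂ) (FractionRing (MvPolynomial (Fin n) ℂ))
        (C (((κ * (Δ.w I * SignType.sign (σ I)) : ℚ)) : ℂ)) *
        (algebraMap _ _ (iotaC uu I1 f) / algebraMap _ _ (lin ℓ * g I1)) + r I) (fun I hI => by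
      obtain ⟨hI, hc, hJI⟩ := Finset.mem_filter.mp hI
      exact hr2 I hI hc hJI), Finset.sum_add_distrib, ← Finset.sum_mul, ← map_sum, ← map_sum]
  have hwall : ∑ I ∈ Δ.S.filter (fun I => I.card = n ∧ J ⊆ I),
      (((κ * (Δ.w I * SignType.sign (σ I)) : ℚ)) : ℂ) = 0 := by
    rw [← Rat.cast_sum, ← Finset.mul_sum]
    have hℓR : (fun k => (ℓ k : ℝ)) ≠ 0 := by
      intro h0
      apply hℓ
      funext k
      have := congrFun h0 k
      simpa using this
    have hprR : ∀ i, dotp (fun k => (ℓ k : ℝ)) (Δ.toMF.v i) = (pr Δ ℓ i : ℝ) := by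
      intro i
      simp [dotp, pr, LMultiFan.toMF]
    have hw := wall_cond hC huu (J := J) hJS hJc _ hℓR (fun j hj => by rw [hprR, hJ j hj]; simp)
    simp only [hprR] at hw
    have hw2 : ∑ I ∈ Δ.S.filter (fun I => I.card = n ∧ J ⊆ I), (Δ.w I : ℚ) * SignType.sign (σ I) = 0 := by
      have : ((∑ I ∈ Δ.S.filter (fun I => I.card = n ∧ J ⊆ I), (Δ.w I : ℚ) * SignType.sign (σ I) : ℚ) : ℝ) = 0 := by
        rw [← hw]
        push_cast
        refine Finset.sum_congr rfl fun I _ => ?_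
        have : (∑ i ∈ I, (pr Δ ℓ i : ℝ)) = ((σ I : ℚ) : ℝ) := by simp [hσ]
        rw [this]
        have hsgn : SignType.sign ((σ I : ℚ) : ℝ) = SignType.sign (σ I) := by
          rcases lt_trichotomy (σ I) 0 with h | h | h
          · rw [sign_neg h, sign_neg (by exact_mod_cast h)]
          · rw [h]; simp
          · rw [sign_pos h, sign_pos (by exact_mod_cast h)]
        rw [hsgn]
        congr 1
        cases SignType.sign (σ I) <;> simp
      exact_mod_cast this
    rw [hw2]; simp
  rw [hwall]
  simp only [map_zero, zero_mul, zero_add]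
  refine Reg.sum hP _ _ fun I hI => ?_
  obtain ⟨hI, hc, hJI⟩ := Finset.mem_filter.mp hI
  exact hr1 I hI hc hJI

lemma term_reg {p : MvPolynomial (Fin n) ℂ} (hp : Prime p) (f : MvPolynomial (Fin d) ℂ)
    (I : Finset (Fin d)) (h : ∀ i ∈ I, ¬ p ∣ lin (uu I i)) : Reg p (term Δ uu f I) := by
  unfold term
  refine Reg.mul_alg ⟨_, _, ?_, rfl⟩ _
  rw [hp.dvd_finsetProd_iff]
  push Not
  exact h

lemma piShriek_poly (hC : Δ.toMF.Complete)
    (huu : Δ.toMF.DualBasis (fun I i k => ((uu I i k : ℝ)))) (f : MvPolynomial (Fin d) ℂ) :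
    ∃ p : MvPolynomial (Fin n) ℂ, piShriekC Δ uu f = algebraMap _ _ p := by
  classical
  have h := qdual_of Δ uu huu
  apply exists_of_reg
  intro p hp
  rw [piShriek_eq]
  by_cases hall : ∀ I ∈ Δ.S, I.card = n → ∀ i ∈ I, ¬ p ∣ lin (uu I i)
  · refine Reg.sum hp _ _ fun I hI => ?_
    obtain ⟨hI, hc⟩ := Finset.mem_filter.mp hI
    exact term_reg hp f I (hall I hI hc)
  push Not at hall
  obtain ⟨I0, hI0, hc0, i0, hi0, hdv⟩ := hall
  set ℓ := uu I0 i0 with hℓdef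
  have hℓ : ℓ ≠ 0 := uu_ne_zero h hI0 hc0 hi0
  obtain ⟨a, ha, hae⟩ := dvd_lin hp hℓ hdv
  have hassoc : Associated p (lin ℓ) := by
    rw [hae]
    have hu : IsUnit (C a : MvPolynomial (Fin n) ℂ) := (isUnit_iff_ne_zero.mpr ha).map C
    exact ((associated_isUnit_mul_left_iff hu).mpr (Associated.refl p)).symm
  have hP : Prime (lin ℓ) := hassoc.prime hp
  suffices hs : Reg (lin ℓ) (∑ I ∈ Δ.S.filter (fun I => I.card = n), term Δ uu f I) by
    obtain ⟨x, y, hy, hxy⟩ := hs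
    exact ⟨x, y, fun hd => hy (hassoc.dvd_iff_dvd_left.mp hd), hxy⟩
  let N : Finset (Fin d) → Finset (Fin d) := fun I => I.filter fun i => pr Δ ℓ i = 0
  rw [← Finset.sum_filter_add_sum_filter_not _ (fun I => (N I).card + 1 = n)]
  refine Reg.add hP ?_ ?_
  · rw [← Finset.sum_fiberwise_of_maps_to (t := ((Δ.S.filter (fun I => I.card = n)).filter
      (fun I => (N I).card + 1 = n)).image N) (fun I hI => Finset.mem_image_of_mem N hI)]
    refine Reg.sum hP _ _ fun J hJ => ?_
    obtain ⟨I2, hI2, rfl⟩ := Finset.mem_image.mp hJ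
    obtain ⟨hI2', hN2⟩ := Finset.mem_filter.mp hI2
    obtain ⟨hI2S, hc2⟩ := Finset.mem_filter.mp hI2'
    have hJS : N I2 ∈ Δ.S := Δ.downClosed I2 hI2S _ (Finset.filter_subset _ _)
    have hJ0 : ∀ j ∈ N I2, pr Δ ℓ j = 0 := fun j hj => (Finset.mem_filter.mp hj).2
    convert wall_reg hC huu hJS hN2 hℓ hJ0 hP f using 2
    ext I
    simp only [Finset.mem_filter]
    constructor
    · rintro ⟨⟨⟨h1, h2⟩, h3⟩, h4⟩
      exact ⟨h1, h2, h4 ▸ Finset.filter_subset _ _⟩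
    · rintro ⟨h1, h2, h3⟩
      obtain ⟨i, hiJ, hins, hpi, -⟩ := wall_struct h h1 h2 h3 hN2 hℓ hJ0
      have : N I = N I2 := by
        ext j
        constructor
        · intro hj
          obtain ⟨hj1, hj2⟩ := Finset.mem_filter.mp hj
          rw [hins, Finset.mem_insert] at hj1
          rcases hj1 with rfl | hj1
          · exact absurd hj2 hpi
          · exact hj1
        · intro hj
          exact Finset.mem_filter.mpr ⟨h3 hj, hJ0 j hj⟩
      exact ⟨⟨⟨h1, h2⟩, this ▸ hN2⟩, this⟩
  · refine Reg.sum hP _ _ fun I hI => ?_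
    obtain ⟨hI', hN⟩ := Finset.mem_filter.mp hI
    obtain ⟨hIS, hc⟩ := Finset.mem_filter.mp hI'
    refine term_reg hP f I fun i hi hd => hN ?_
    obtain ⟨h1, h2⟩ := dvd_uu h hIS hc hi hP hd
    have : N I = I.erase i := by
      ext j
      simp only [N, Finset.mem_filter, Finset.mem_erase]
      constructor
      · rintro ⟨h3, h4⟩
        exact ⟨fun e => h1 (e ▸ h4), h3⟩
      · rintro ⟨h3, h4⟩
        exact ⟨h4, h2 j h4 h3⟩
    rw [this, Finset.card_erase_add_one hi, hc]

end Wall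


section Char
variable {n d : ℕ} {Δ : LMultiFan n d} {uu : Finset (Fin d) → Fin d → (Fin n → ℚ)}

/-- the lattice quotient `N/N_I` -/
abbrev QI (Δ : LMultiFan n d) (I : Finset (Fin d)) : Type :=
  (Fin n → ℤ) ⧸ Submodule.span ℤ (Δ.v '' (I : Set (Fin d)))

/-- pairing of a rational covector with a lattice vector -/
def prx (u : Fin n → ℚ) (x : Fin n → ℤ) : ℚ := ∑ k, u k * (x k : ℚ)

lemma prx_add (u : Fin n → ℚ) (x y : Fin n → ℤ) : prx u (x + y) = prx u x + prx u y := by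
  simp [prx, mul_add, Finset.sum_add_distrib]

lemma prx_sub (u : Fin n → ℚ) (x y : Fin n → ℤ) : prx u (x - y) = prx u x - prx u y := by
  simp [prx, mul_sub, Finset.sum_sub_distrib]

lemma prx_span (h : QDual Δ uu) {I : Finset (Fin d)} (hI : I ∈ Δ.S) (hc : I.card = n)
    {i : Fin d} (hi : i ∈ I) {x : Fin n → ℤ}
    (hx : x ∈ Submodule.span ℤ (Δ.v '' (I : Set (Fin d)))) : ∃ m : ℤ, prx (uu I i) x = m := by
  induction hx using Submodule.span_induction with
  | mem z hz =>
    obtain ⟨j, hj, rfl⟩ := hz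
    refine ⟨if i = j then 1 else 0, ?_⟩
    unfold prx
    rw [h I hI hc i hi j hj]
    split_ifs <;> simp
  | zero => exact ⟨0, by simp [prx]⟩
  | add a b _ _ ha hb =>
    obtain ⟨m, hm⟩ := ha
    obtain ⟨m', hm'⟩ := hb
    exact ⟨m + m', by rw [prx_add, hm, hm']; push_cast; rfl⟩
  | smul a b _ hb =>
    obtain ⟨m, hm⟩ := hb
    refine ⟨a * m, ?_⟩
    push_cast
    rw [← hm]
    unfold prx
    rw [Finset.mul_sum]
    refine Finset.sum_congr rfl fun k _ => ?_
    simp only [Pi.smul_apply, smul_eq_mul]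
    push_cast
    ring

/-- `ρ_i` of the class of `x` -/
noncomputable def zeta (uu : Finset (Fin d) → Fin d → (Fin n → ℚ)) (I : Finset (Fin d)) (i : Fin d)
    (x : Fin n → ℤ) : ℂ :=
  Complex.exp (2 * (Real.pi : ℂ) * Complex.I * ((prx (uu I i) x : ℚ) : ℂ))

lemma zeta_norm (I : Finset (Fin d)) (i : Fin d) (x : Fin n → ℤ) : ‖zeta uu I i x‖ = 1 := by
  unfold zeta
  have : 2 * (Real.pi : ℂ) * Complex.I * ((prx (uu I i) x : ℚ) : ℂ) =
      ((2 * Real.pi * (prx (uu I i) x : ℝ) : ℝ) : ℂ) * Complex.I := by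
    push_cast; ring
  rw [this, Complex.norm_exp_ofReal_mul_I]

lemma zeta_ne (I : Finset (Fin d)) (i : Fin d) (x : Fin n → ℤ) : zeta uu I i x ≠ 0 :=
  Complex.exp_ne_zero _

lemma zeta_add (I : Finset (Fin d)) (i : Fin d) (x y : Fin n → ℤ) :
    zeta uu I i (x + y) = zeta uu I i x * zeta uu I i y := by
  unfold zeta
  rw [← Complex.exp_add, prx_add]
  push_cast
  ring_nf

lemma exp_int (m : ℤ) : Complex.exp (2 * (Real.pi : ℂ) * Complex.I * (m : ℂ)) = 1 := by
  rw [Complex.exp_eq_one_iff]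
  exact ⟨m, by ring⟩

lemma zeta_span (h : QDual Δ uu) {I : Finset (Fin d)} (hI : I ∈ Δ.S) (hc : I.card = n)
    {i : Fin d} (hi : i ∈ I) {x : Fin n → ℤ}
    (hx : x ∈ Submodule.span ℤ (Δ.v '' (I : Set (Fin d)))) : zeta uu I i x = 1 := by
  obtain ⟨m, hm⟩ := prx_span h hI hc hi hx
  unfold zeta
  rw [hm]
  push_cast
  exact exp_int m

lemma mk_out_sub {I : Finset (Fin d)} (q : QI Δ I) (x : Fin n → ℤ)
    (h : q = Submodule.Quotient.mk x) :
    q.out - x ∈ Submodule.span ℤ (Δ.v '' (I : Set (Fin d))) := by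
  rw [← Submodule.Quotient.eq]
  rw [← h]
  exact Quotient.out_eq q

lemma zeta_out (h : QDual Δ uu) {I : Finset (Fin d)} (hI : I ∈ Δ.S) (hc : I.card = n)
    {i : Fin d} (hi : i ∈ I) (q : QI Δ I) (x : Fin n → ℤ)
    (hq : q = Submodule.Quotient.mk x) : zeta uu I i q.out = zeta uu I i x := by
  have := zeta_span h hI hc hi (mk_out_sub q x hq)
  have e : q.out = (q.out - x) + x := by abel
  rw [e, zeta_add, this, one_mul]

lemma qi_finite (h : QDual Δ uu) {I : Finset (Fin d)} (hI : I ∈ Δ.S) (hc : I.card = n) :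
    Finite (QI Δ I) := Nat.finite_of_card_ne_zero (gcard_pos h hI hc)

/-- the character indexed by `k` -/
noncomputable def chi (uu : Finset (Fin d) → Fin d → (Fin n → ℚ)) (I : Finset (Fin d)) (k : Fin d → ℤ)
    (x : Fin n → ℤ) : ℂ := ∏ i ∈ I, zeta uu I i x ^ k i

lemma chi_add (I : Finset (Fin d)) (k : Fin d → ℤ) (x y : Fin n → ℤ) :
    chi uu I k (x + y) = chi uu I k x * chi uu I k y := by
  unfold chi
  rw [← Finset.prod_mul_distrib]
  exact Finset.prod_congr rfl fun i _ => by rw [zeta_add, mul_zpow]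

lemma chi_out (h : QDual Δ uu) {I : Finset (Fin d)} (hI : I ∈ Δ.S) (hc : I.card = n)
    (k : Fin d → ℤ) (q : QI Δ I) (x : Fin n → ℤ)
    (hq : q = Submodule.Quotient.mk x) : chi uu I k q.out = chi uu I k x :=
  Finset.prod_congr rfl fun i hi => by rw [zeta_out h hI hc hi q x hq]

lemma chi_eq (I : Finset (Fin d)) (k : Fin d → ℤ) (x : Fin n → ℤ) :
    chi uu I k x = Complex.exp (2 * (Real.pi : ℂ) * Complex.I *
      (((∑ l, (∑ i ∈ I, k i * uu I i l) * x l : ℚ)) : ℂ)) := by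
  unfold chi zeta
  simp_rw [← Complex.exp_int_mul]
  rw [← Complex.exp_sum]
  congr 1
  have : ∑ l, (∑ i ∈ I, k i * uu I i l) * (x l : ℚ) = ∑ i ∈ I, k i * prx (uu I i) x := by
    unfold prx
    simp only [Finset.sum_mul, Finset.mul_sum]
    rw [Finset.sum_comm]
    exact Finset.sum_congr rfl fun i _ => Finset.sum_congr rfl fun l _ => by ring
  rw [this]
  push_cast
  rw [Finset.mul_sum]
  exact Finset.sum_congr rfl fun i _ => by ring

lemma chi_one_iff (I : Finset (Fin d)) (k : Fin d → ℤ) :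
    (∀ x, chi uu I k x = 1) ↔ ∀ l, ∃ m : ℤ, ∑ i ∈ I, (k i : ℚ) * uu I i l = m := by
  constructor
  · intro hx l
    have := hx (Pi.single l 1)
    rw [chi_eq, Complex.exp_eq_one_iff] at this
    obtain ⟨m, hm⟩ := this
    refine ⟨m, ?_⟩
    have h2 : (2 * (Real.pi : ℂ) * Complex.I) ≠ 0 := Complex.two_pi_I_ne_zero
    rw [mul_comm (m : ℂ)] at hm
    have h3 := mul_left_cancel₀ h2 hm
    have h4 : (∑ l', (∑ i ∈ I, (k i : ℚ) * uu I i l') * ((Pi.single l 1 : Fin n → ℤ) l' : ℚ)) =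
        ∑ i ∈ I, (k i : ℚ) * uu I i l := by
      rw [Finset.sum_eq_single l]
      · simp
      · intro b _ hb; simp [Pi.single_apply, hb]
      · simp
    rw [h4] at h3
    exact_mod_cast h3
  · intro hl x
    choose m hm using hl
    rw [chi_eq]
    simp_rw [hm]
    have := exp_int (∑ l, m l * x l)
    push_cast at this ⊢
    exact this

open scoped Classical in
lemma chi_orth (h : QDual Δ uu) {I : Finset (Fin d)} (hI : I ∈ Δ.S) (hc : I.card = n)
    [Fintype (QI Δ I)] (k : Fin d → ℤ) :
    ∑ q : QI Δ I, chi uu I k q.out =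
      if ∀ l, ∃ m : ℤ, ∑ i ∈ I, (k i : ℚ) * uu I i l = m then (gcard Δ I : ℂ) else 0 := by
  split_ifs with hl
  · rw [← chi_one_iff] at hl
    simp only [hl]
    unfold gcard
    rw [Nat.card_eq_fintype_card]
    simp
  · rw [← chi_one_iff] at hl
    push Not at hl
    obtain ⟨x, hx⟩ := hl
    have e : ∑ q : QI Δ I, chi uu I k q.out = chi uu I k x * ∑ q : QI Δ I, chi uu I k q.out := by
      rw [Finset.mul_sum]
      rw [← Equiv.sum_comp (Equiv.addLeft (Submodule.Quotient.mk x : QI Δ I))]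
      refine Finset.sum_congr rfl fun q _ => ?_
      rw [← chi_add]
      apply chi_out h hI hc
      rw [Submodule.Quotient.mk_add]
      simp only [Equiv.coe_addLeft]
      congr 1
      exact (Quotient.out_eq q).symm
    have e2 : (1 - chi uu I k x) * ∑ q : QI Δ I, chi uu I k q.out = 0 := by
      linear_combination e
    rcases mul_eq_zero.mp e2 with h1 | h1
    · exact absurd (by linear_combination -h1) hx
    · exact h1

open scoped Classical in
/-- the canonical representative of the class of `x` -/
noncomputable def repA (uu : Finset (Fin d) → Fin d → (Fin n → ℚ)) (I : Finset (Fin d))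
    (x : Fin n → ℤ) : Fin d → ℝ := fun i => if i ∈ I then Int.fract (prx (uu I i) x : ℝ) else 0

lemma rho_repA {I : Finset (Fin d)} {i : Fin d} (hi : i ∈ I) (x : Fin n → ℤ) :
    rho i (repA uu I x) = zeta uu I i x := by
  unfold rho repA zeta
  rw [if_pos hi]
  have : (prx (uu I i) x : ℝ) = Int.fract (prx (uu I i) x : ℝ) + ⌊(prx (uu I i) x : ℝ)⌋ :=
    (Int.fract_add_floor _).symm
  have h2 : ((prx (uu I i) x : ℚ) : ℂ) = ((Int.fract (prx (uu I i) x : ℝ) : ℝ) : ℂ) +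
      ((⌊(prx (uu I i) x : ℝ)⌋ : ℤ) : ℂ) := by
    have h3 := congrArg (fun r : ℝ => (r : ℂ)) this
    push_cast at h3
    exact h3
  rw [h2, mul_add, Complex.exp_add, exp_int, mul_one]

/-- the group `G_I` as a set of representatives -/
def GI (Δ : LMultiFan n d) (I : Finset (Fin d)) : Set (Fin d → ℝ) :=
  {a | (∀ i, 0 ≤ a i ∧ a i < 1) ∧ (∀ j, j ∉ I → a j = 0) ∧
         ∀ k : Fin n, ∃ m : ℤ, (∑ i ∈ I, a i * (Δ.v i k : ℝ)) = (m : ℝ)}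

lemma vec_real (h : QDual Δ uu) {I : Finset (Fin d)} (hI : I ∈ Δ.S) (hc : I.card = n)
    (x : Fin n → ℤ) (l : Fin n) : (x l : ℝ) = ∑ i ∈ I, (prx (uu I i) x : ℝ) * (Δ.v i l : ℝ) := by
  have := expand_vec hc (h I hI hc) (fun k => (x k : ℚ)) l
  have h2 := congrArg (fun r : ℚ => (r : ℝ)) this
  unfold prx
  push_cast at h2 ⊢
  exact h2

lemma repA_mem (h : QDual Δ uu) {I : Finset (Fin d)} (hI : I ∈ Δ.S) (hc : I.card = n)
    (x : Fin n → ℤ) : repA uu I x ∈ GI Δ I := by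
  refine ⟨fun i => ?_, fun j hj => by simp [repA, hj], fun k => ?_⟩
  · unfold repA
    split_ifs
    · exact ⟨Int.fract_nonneg _, Int.fract_lt_one _⟩
    · simp
  · refine ⟨x k - ∑ i ∈ I, ⌊(prx (uu I i) x : ℝ)⌋ * Δ.v i k, ?_⟩
    push_cast
    rw [vec_real h hI hc x k, ← Finset.sum_sub_distrib]
    refine Finset.sum_congr rfl fun i hi => ?_
    rw [← sub_mul]
    unfold repA
    rw [if_pos hi]
    rfl

lemma repA_inj (h : QDual Δ uu) {I : Finset (Fin d)} (hI : I ∈ Δ.S) (hc : I.card = n) :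
    Function.Injective (fun q : QI Δ I => repA uu I q.out) := by
  intro q q' hqq
  have hfl : ∀ i ∈ I, (prx (uu I i) q.out : ℝ) - (prx (uu I i) q'.out : ℝ) =
      ((⌊(prx (uu I i) q.out : ℝ)⌋ - ⌊(prx (uu I i) q'.out : ℝ)⌋ : ℤ) : ℝ) := by
    intro i hi
    have := congrFun hqq i
    simp only [repA, if_pos hi] at this
    unfold Int.fract at this
    push_cast
    linarith
  have hv : q.out - q'.out = ∑ i ∈ I,
      (⌊(prx (uu I i) q.out : ℝ)⌋ - ⌊(prx (uu I i) q'.out : ℝ)⌋) • Δ.v i := by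
    funext l
    have e1 := vec_real h hI hc q.out l
    have e2 := vec_real h hI hc q'.out l
    have : ((q.out l - q'.out l : ℤ) : ℝ) = ((∑ i ∈ I,
      (⌊(prx (uu I i) q.out : ℝ)⌋ - ⌊(prx (uu I i) q'.out : ℝ)⌋) * Δ.v i l : ℤ) : ℝ) := by
      rw [Int.cast_sub, e1, e2, ← Finset.sum_sub_distrib, Int.cast_sum]
      refine Finset.sum_congr rfl fun i hi => ?_
      rw [← sub_mul, hfl i hi, Int.cast_mul]
    rw [Finset.sum_apply]
    simp only [Pi.sub_apply, Pi.smul_apply, smul_eq_mul]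
    exact_mod_cast this
  have hm : q.out - q'.out ∈ Submodule.span ℤ (Δ.v '' (I : Set (Fin d))) := by
    rw [hv]
    exact Submodule.sum_mem _ fun i hi => Submodule.smul_mem _ _ (Submodule.subset_span ⟨i, hi, rfl⟩)
  rw [← Submodule.Quotient.eq] at hm
  have a1 : (Submodule.Quotient.mk q.out : QI Δ I) = q := Quotient.out_eq q
  have a2 : (Submodule.Quotient.mk q'.out : QI Δ I) = q' := Quotient.out_eq q'
  rw [← a1, ← a2, hm]

lemma repA_surj (h : QDual Δ uu) {I : Finset (Fin d)} (hI : I ∈ Δ.S) (hc : I.card = n)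
    {a : Fin d → ℝ} (ha : a ∈ GI Δ I) : ∃ q : QI Δ I, repA uu I q.out = a := by
  obtain ⟨h1, h2, h3⟩ := ha
  choose x hx using h3
  refine ⟨Submodule.Quotient.mk x, ?_⟩
  have hxa : ∀ i ∈ I, (prx (uu I i) x : ℝ) = a i := by
    intro i hi
    unfold prx
    push_cast
    simp_rw [← hx, Finset.mul_sum]
    rw [Finset.sum_comm]
    have : ∀ j ∈ I, ∑ k, (uu I i k : ℝ) * (a j * (Δ.v j k : ℝ)) = if i = j then a j else 0 := by
      intro j hj
      have e := congrArg (fun r : ℚ => (r : ℝ)) (h I hI hc i hi j hj)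
      push_cast at e
      calc _ = a j * ∑ k, (uu I i k : ℝ) * (Δ.v j k : ℝ) := by
            rw [Finset.mul_sum]; exact Finset.sum_congr rfl fun k _ => by ring
        _ = _ := by rw [e]; split_ifs <;> simp
    rw [Finset.sum_congr rfl this]
    simp [hi]
  funext i
  unfold repA
  split_ifs with hi
  · obtain ⟨m, hm⟩ := prx_span h hI hc hi (mk_out_sub (Δ := Δ) (I := I) (Submodule.Quotient.mk x) x rfl)
    rw [prx_sub, sub_eq_iff_eq_add] at hm
    rw [hm]
    push_cast
    rw [hxa i hi, Int.fract_intCast_add, Int.fract_eq_self.mpr (h1 i)]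
  · exact (h2 i hi).symm

lemma GI_finite (h : QDual Δ uu) {I : Finset (Fin d)} (hI : I ∈ Δ.S) (hc : I.card = n) :
    (GI Δ I).Finite := by
  have := qi_finite h hI hc
  apply Set.Finite.subset (Set.finite_range (fun q : QI Δ I => repA uu I q.out))
  intro a ha
  exact repA_surj h hI hc ha

lemma GD_finite (h : QDual Δ uu) : (GD Δ).Finite := by
  have : (⋃ I ∈ {I | I ∈ Δ.S ∧ I.card = n}, GI Δ I).Finite := by
    apply Set.Finite.biUnion
    · exact Set.Finite.subset Δ.S.finite_toSet (fun I hI => hI.1)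
    · intro I hI
      exact GI_finite h hI.1 hI.2
  refine this.subset ?_
  rintro a ⟨h1, I, hI, hc, h2, h3⟩
  exact Set.mem_biUnion (⟨hI, hc⟩ : I ∈ {I | I ∈ Δ.S ∧ I.card = n}) ⟨h1, h2, h3⟩

lemma td_zero_one {td : ℂ → ℕ → ℂ} (htd : ToddCoeffs n td) : td 1 0 = 1 := by
  have := htd 1 1 (by omega)
  simpa [Finset.sum_range_succ] using this

lemma td_zero_ne {td : ℂ → ℕ → ℂ} (htd : ToddCoeffs n td) {ρ : ℂ} (hρ : ρ ≠ 1) : td ρ 0 = 0 := by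
  have := htd ρ 0 (by omega)
  simp at this
  rcases this with h | h
  · exact h
  · exact absurd (by linear_combination -h) hρ

open MvPolynomial in
lemma iota_todd (h : QDual Δ uu) {I : Finset (Fin d)} (hI : I ∈ Δ.S) (hc : I.card = n)
    [Fintype (QI Δ I)] {td : ℂ → ℕ → ℂ} (htd : ToddCoeffs n td) :
    iotaC uu I (toddPoly Δ td) = ∑ q : QI Δ I, ∏ i ∈ I, ∑ k ∈ Finset.range (n+1),
      td (zeta uu I i q.out) k • lin (uu I i) ^ k := by
  classical
  unfold toddPoly
  rw [finsum_set_coe_eq_finsum_mem (GD Δ) (f := fun a => ∏ i : Fin d,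
    ∑ k ∈ Finset.range (n+1), td (rho i a) k • (MvPolynomial.X i : MvPolynomial (Fin d) ℂ) ^ k)]
  rw [finsum_mem_eq_finite_toFinset_sum _ (GD_finite h), map_sum]
  have hsub : Finset.univ.image (fun q : QI Δ I => repA uu I q.out) ⊆ (GD_finite h).toFinset := by
    intro a ha
    obtain ⟨q, -, rfl⟩ := Finset.mem_image.mp ha
    rw [Set.Finite.mem_toFinset]
    obtain ⟨h1, h2, h3⟩ := repA_mem h hI hc q.out
    exact ⟨h1, I, hI, hc, h2, h3⟩
  have hX : ∀ (i : Fin d) (ρ : ℂ), iotaC uu I (∑ k ∈ Finset.range (n+1),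
      td ρ k • (MvPolynomial.X i : MvPolynomial (Fin d) ℂ) ^ k) =
      if i ∈ I then ∑ k ∈ Finset.range (n+1), td ρ k • lin (uu I i) ^ k else C (td ρ 0) := by
    intro i ρ
    rw [map_sum]
    split_ifs with hi
    · refine Finset.sum_congr rfl fun k _ => ?_
      rw [map_smul, map_pow]
      unfold iotaC
      rw [aeval_X, if_pos hi]
      rfl
    · rw [Finset.sum_eq_single 0]
      · rw [map_smul, map_pow, pow_zero, smul_eq_C_mul, mul_one]
      · intro k _ hk
        rw [map_smul, map_pow]
        unfold iotaC
        rw [aeval_X, if_neg hi, zero_pow hk, smul_zero]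
      · simp
  rw [← Finset.sum_subset hsub]
  · rw [Finset.sum_image (fun x _ y _ hxy => repA_inj h hI hc hxy)]
    refine Finset.sum_congr rfl fun q _ => ?_
    rw [map_prod]
    simp_rw [hX]
    rw [← Finset.prod_subset (Finset.subset_univ I)]
    · refine Finset.prod_congr rfl fun i hi => ?_
      rw [if_pos hi, rho_repA hi]
    · intro i _ hi
      rw [if_neg hi]
      have : rho i (repA uu I q.out) = 1 := by simp [rho, repA, hi]
      rw [this, td_zero_one htd, C_1]
  · intro a ha hna
    rw [Set.Finite.mem_toFinset] at ha
    obtain ⟨h1, I', hI', hc', h2, h3⟩ := ha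
    have : ∃ j, j ∉ I ∧ a j ≠ 0 := by
      by_contra! hcon
      apply hna
      have : a ∈ GI Δ I := by
        refine ⟨h1, hcon, fun k => ?_⟩
        obtain ⟨m, hm⟩ := h3 k
        refine ⟨m, ?_⟩
        rw [← hm]
        rw [Finset.sum_subset (Finset.subset_univ I), Finset.sum_subset (Finset.subset_univ I')]
        · intro j _ hj; rw [h2 j hj, zero_mul]
        · intro j _ hj; rw [hcon j hj, zero_mul]
      obtain ⟨q, hq⟩ := repA_surj h hI hc this
      exact Finset.mem_image.mpr ⟨q, Finset.mem_univ _, hq⟩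
    obtain ⟨j, hj, haj⟩ := this
    rw [map_prod]
    apply Finset.prod_eq_zero (Finset.mem_univ j)
    rw [hX, if_neg hj, td_zero_ne htd, C_0]
    intro hρ
    unfold rho at hρ
    rw [Complex.exp_eq_one_iff] at hρ
    obtain ⟨m, hm⟩ := hρ
    rw [mul_comm (m : ℂ)] at hm
    have h4 := mul_left_cancel₀ Complex.two_pi_I_ne_zero hm
    have h5 : a j = (m : ℝ) := by exact_mod_cast h4
    have h6 := h1 j
    rw [h5] at h6
    have h7 : 0 ≤ m := by exact_mod_cast h6.1
    have h8 : m < 1 := by exact_mod_cast h6.2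
    have : m = 0 := by omega
    rw [this] at h5
    simp at h5
    exact haj h5

end Char


section Gen

lemma geo (z : ℂ) (hz : z ≠ 0) (hz1 : ‖z‖ ≠ 1) (C : ℤ) :
    HasSum (fun m : ℤ => (-(if C < m then (1:ℂ) else 0) + (if 1 < ‖z‖ then (1:ℂ) else 0)) * z ^ m)
      (z ^ C / (1 - z⁻¹)) := by
  have hzz : z ≠ 1 := by rintro rfl; simp at hz1
  rcases lt_or_gt_of_ne hz1 with h | h
  · have inj : Function.Injective (fun j : ℕ => C + 1 + (j : ℤ)) := by
      intro a b hab; simpa using hab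
    rw [← Function.Injective.hasSum_iff inj]
    · have := (hasSum_geometric_of_norm_lt_one h).mul_left (-z ^ (C + 1))
      have e1 : -z ^ (C + 1) * (1 - z)⁻¹ = z ^ C / (1 - z⁻¹) := by
        rw [zpow_add₀ hz, zpow_one]
        have : 1 - z ≠ 0 := sub_ne_zero.mpr (Ne.symm hzz)
        have h2 : z - 1 ≠ 0 := sub_ne_zero.mpr hzz
        have : 1 - z⁻¹ = (z - 1) / z := by field_simp
        rw [this]
        field_simp
        ring
      rw [e1] at this
      refine this.congr_fun ?_
      intro j
      have h1 : C < C + 1 + (j : ℤ) := by omega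
      simp only [Function.comp, if_pos h1, if_neg (not_lt.mpr h.le)]
      rw [zpow_add₀ hz (C + 1), zpow_natCast]
      ring
    · intro m hm
      have : ¬ C < m := by
        intro hlt
        exact hm ⟨(m - C - 1).toNat, by simp only; omega⟩
      simp [this, not_lt.mpr h.le]
  · have inj : Function.Injective (fun j : ℕ => C - (j : ℤ)) := by
      intro a b hab; simpa using hab
    rw [← Function.Injective.hasSum_iff inj]
    · have hi : ‖z⁻¹‖ < 1 := by rw [norm_inv]; exact inv_lt_one_of_one_lt₀ h
      have := (hasSum_geometric_of_norm_lt_one hi).mul_left (z ^ C)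
      rw [← div_eq_mul_inv] at this
      refine this.congr_fun ?_
      intro j
      have h1 : ¬ C < C - (j : ℤ) := by omega
      simp only [Function.comp, if_neg h1, if_pos h]
      rw [zpow_sub₀ hz, zpow_natCast, inv_pow]
      ring
    · intro m hm
      have : C < m := by
        by_contra hlt
        exact hm ⟨(C - m).toNat, by simp only; omega⟩
      simp [this, h]

lemma hasSum_pi_prod : ∀ (m : ℕ) (g : Fin m → ℤ → ℂ) (s : Fin m → ℂ),
    (∀ i, HasSum (g i) (s i)) → HasSum (fun k : Fin m → ℤ => ∏ i, g i (k i)) (∏ i, s i) := by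
  intro m
  induction m with
  | zero =>
    intro g s _
    simp only [Finset.univ_eq_empty, Finset.prod_empty]
    simp
  | succ m ih =>
    intro g s hg
    have h1 := ih (fun i => g i.succ) (fun i => s i.succ) (fun i => hg i.succ)
    have h0 := hg 0
    have hs : Summable (fun x : ℤ × (Fin m → ℤ) => g 0 x.1 * ∏ i, g (Fin.succ i) (x.2 i)) :=
      summable_mul_of_summable_norm (f := g 0) (g := fun k : Fin m → ℤ => ∏ i, g (Fin.succ i) (k i)) h0.summable.norm h1.summable.norm
    have h2 := h0.mul h1 hs
    rw [Fin.prod_univ_succ, ← (Fin.consEquiv (fun _ => ℤ)).hasSum_iff]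
    refine h2.congr_fun ?_
    intro x
    simp [Function.comp, Fin.prod_univ_succ]

end Gen


section Cone
variable {n d : ℕ} {Δ : LMultiFan n d} {uu : Finset (Fin d) → Fin d → (Fin n → ℚ)}

/-- integral pairing -/
def ipr (Δ : LMultiFan n d) (u : Fin n → ℤ) (i : Fin d) : ℤ := ∑ k, u k * Δ.v i k

lemma ipr_cov (h : QDual Δ uu) {I : Finset (Fin d)} (hI : I ∈ Δ.S) (hc : I.card = n)
    (u : Fin n → ℤ) (l : Fin n) : (u l : ℚ) = ∑ i ∈ I, (ipr Δ u i : ℚ) * uu I i l := by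
  have := expand_cov hc (h I hI hc) (fun k => (u k : ℚ)) l
  unfold ipr
  push_cast
  exact this

lemma ipr_of (h : QDual Δ uu) {I : Finset (Fin d)} (hI : I ∈ Δ.S) (hc : I.card = n)
    (k : Fin d → ℤ) (m : Fin n → ℤ) (hm : ∀ l, ∑ i ∈ I, (k i : ℚ) * uu I i l = m l)
    {j : Fin d} (hj : j ∈ I) : ipr Δ m j = k j := by
  have : ((ipr Δ m j : ℤ) : ℚ) = k j := by
    unfold ipr
    push_cast
    simp_rw [← hm, Finset.sum_mul]
    rw [Finset.sum_comm]
    have : ∀ i ∈ I, ∑ l, (k i : ℚ) * uu I i l * (Δ.v j l : ℚ) = if i = j then (k i : ℚ) else 0 := by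
      intro i hi
      have e := h I hI hc i hi j hj
      calc _ = (k i : ℚ) * ∑ l, uu I i l * (Δ.v j l : ℚ) := by
            rw [Finset.mul_sum]; exact Finset.sum_congr rfl fun k _ => by ring
        _ = _ := by rw [e]; split_ifs <;> simp
    rw [Finset.sum_congr rfl this]
    simp [hj]
  exact_mod_cast this

lemma ipr_xi (h : QDual Δ uu) {I : Finset (Fin d)} (hI : I ∈ Δ.S) (hc : I.card = n)
    (u : Fin n → ℤ) (ξ : Fin n → ℝ) (α : Fin d → ℝ)
    (hα : ∀ i ∈ I, α i = ∑ k, (uu I i k : ℝ) * ξ k) :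
    ∑ k, (u k : ℝ) * ξ k = ∑ i ∈ I, (ipr Δ u i : ℝ) * α i := by
  have e : ∀ l, (u l : ℝ) = ∑ i ∈ I, (ipr Δ u i : ℝ) * (uu I i l : ℝ) := by
    intro l
    have := congrArg (fun r : ℚ => (r : ℝ)) (ipr_cov h hI hc u l)
    push_cast at this
    exact this
  simp_rw [e, Finset.sum_mul]
  rw [Finset.sum_comm]
  refine Finset.sum_congr rfl fun i hi => ?_
  rw [hα i hi, Finset.mul_sum]
  exact Finset.sum_congr rfl fun k _ => by ring

open scoped Classical in
lemma cone_sum (h : QDual Δ uu) {I : Finset (Fin d)} (hI : I ∈ Δ.S) (hc : I.card = n)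
    [Fintype (QI Δ I)] (ξ : Fin n → ℝ) (α : Fin d → ℝ)
    (hα : ∀ i ∈ I, α i = ∑ k, (uu I i k : ℝ) * ξ k) (hα0 : ∀ i ∈ I, α i ≠ 0)
    (C : Fin d → ℤ) (hCl : ∀ l, ∃ m : ℤ, ∑ i ∈ I, (C i : ℚ) * uu I i l = m) (t : ℝ) (ht : t < 0) :
    HasSum (fun u : Fin n → ℤ =>
      (∏ i ∈ I, (-(if C i < ipr Δ u i then (1:ℂ) else 0) + (if α i < 0 then (1:ℂ) else 0))) *
        Complex.exp ((t * ∑ k, (u k : ℝ) * ξ k : ℝ) : ℂ))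
      ((gcard Δ I : ℂ)⁻¹ * ∑ q : QI Δ I, ∏ i ∈ I, Complex.exp ((t * (C i * α i) : ℝ) : ℂ) /
        (1 - zeta uu I i q.out * Complex.exp (-((t * α i : ℝ) : ℂ)))) := by
  obtain ⟨f, hf, hfI⟩ := exists_enum hc
  have hfm : ∀ a, f a ∈ I := fun a => (hfI _).mpr ⟨a, rfl⟩
  have hprod : ∀ F : Fin d → ℂ, ∏ i ∈ I, F i = ∏ a, F (f a) := by
    intro F
    have : I = Finset.univ.image f := by
      ext i; rw [hfI]; simp
    rw [this, Finset.prod_image (fun a _ b _ hab => hf hab)]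
  have hcC : ∀ q : QI Δ I, chi uu I C q.out = 1 := fun q => (chi_one_iff I C).mpr hCl _
  have hg0 : (gcard Δ I : ℂ) ≠ 0 := by exact_mod_cast gcard_pos h hI hc
  -- the one-variable series
  let z : QI Δ I → Fin d → ℂ := fun q i => (zeta uu I i q.out)⁻¹ * Complex.exp ((t * α i : ℝ) : ℂ)
  have hz0 : ∀ q i, z q i ≠ 0 := fun q i =>
    mul_ne_zero (inv_ne_zero (zeta_ne _ _ _)) (Complex.exp_ne_zero _)
  have hzn : ∀ q i, ‖z q i‖ = Real.exp (t * α i) := by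
    intro q i
    simp only [z]
    rw [norm_mul, norm_inv, zeta_norm, inv_one, one_mul, Complex.norm_exp, Complex.ofReal_re]
  have hz1 : ∀ q, ∀ i ∈ I, ‖z q i‖ ≠ 1 := by
    intro q i hi
    rw [hzn]
    intro h1
    rw [Real.exp_eq_one_iff] at h1
    exact (mul_ne_zero ht.ne (hα0 i hi)) h1
  have hzlt : ∀ q i, (1 < ‖z q i‖) = (α i < 0) := by
    intro q i
    rw [hzn, Real.one_lt_exp_iff]
    exact propext ⟨fun h => by nlinarith, fun h => mul_pos_of_neg_of_neg ht h⟩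
  have hq : ∀ q : QI Δ I, HasSum (fun k : Fin n → ℤ => ∏ a,
      ((-(if C (f a) < k a then (1:ℂ) else 0) + (if α (f a) < 0 then (1:ℂ) else 0)) *
        z q (f a) ^ (k a))) (∏ a, z q (f a) ^ C (f a) / (1 - (z q (f a))⁻¹)) := by
    intro q
    apply hasSum_pi_prod n (fun a m => ((-(if C (f a) < m then (1:ℂ) else 0) + (if α (f a) < 0 then (1:ℂ) else 0)) *
        z q (f a) ^ m))
    intro a
    have := geo (z q (f a)) (hz0 _ _) (hz1 q _ (hfm a)) (C (f a))
    simp only [hzlt] at this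
    exact this
  have hsum := hasSum_sum (s := Finset.univ) (fun q _ => hq q)
  have hval : ∀ q : QI Δ I, (∏ a, z q (f a) ^ C (f a) / (1 - (z q (f a))⁻¹)) =
      ∏ i ∈ I, Complex.exp ((t * (C i * α i) : ℝ) : ℂ) /
        (1 - zeta uu I i q.out * Complex.exp (-((t * α i : ℝ) : ℂ))) := by
    intro q
    rw [← hprod (fun i => z q i ^ C i / (1 - (z q i)⁻¹))]
    rw [Finset.prod_div_distrib, Finset.prod_div_distrib]
    congr 1
    · have e1 : ∀ i, z q i ^ C i = (zeta uu I i q.out ^ C i)⁻¹ * Complex.exp ((t * (C i * α i) : ℝ) : ℂ) := by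
        intro i
        simp only [z]
        rw [mul_zpow, inv_zpow, ← Complex.exp_int_mul]
        congr 2
        push_cast; ring
      simp_rw [e1]
      rw [Finset.prod_mul_distrib, Finset.prod_inv_distrib]
      have := hcC q
      unfold chi at this
      rw [this]; simp
    · refine Finset.prod_congr rfl fun i _ => ?_
      simp only [z]
      rw [mul_inv, inv_inv, Complex.exp_neg]
  simp_rw [hval] at hsum
  -- inject the lattice
  let φ : (Fin n → ℤ) → (Fin n → ℤ) := fun u a => ipr Δ u (f a)
  have hφ : Function.Injective φ := by
    intro u u' huu'
    funext l
    have e1 := ipr_cov h hI hc u l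
    have e2 := ipr_cov h hI hc u' l
    have : (u l : ℚ) = u' l := by
      rw [e1, e2]
      refine Finset.sum_congr rfl fun i hi => ?_
      obtain ⟨a, rfl⟩ := (hfI i).mp hi
      rw [show ipr Δ u (f a) = ipr Δ u' (f a) from congrFun huu' a]
    exact_mod_cast this
  have hpt : ∀ k : Fin n → ℤ, ∑ q : QI Δ I, ∏ a,
      ((-(if C (f a) < k a then (1:ℂ) else 0) + (if α (f a) < 0 then (1:ℂ) else 0)) *
        z q (f a) ^ (k a)) =
      (∏ a, (-(if C (f a) < k a then (1:ℂ) else 0) + (if α (f a) < 0 then (1:ℂ) else 0))) *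
      (∏ a, Complex.exp ((t * (k a * α (f a)) : ℝ) : ℂ)) *
      (if ∀ l, ∃ m : ℤ, ∑ i ∈ I, ((Function.extend f (fun a => - k a) 0 i : ℤ) : ℚ) * uu I i l = m
        then (gcard Δ I : ℂ) else 0) := by
    intro k
    rw [← chi_orth h hI hc, Finset.mul_sum]
    refine Finset.sum_congr rfl fun q _ => ?_
    unfold chi
    rw [hprod, mul_assoc, ← Finset.prod_mul_distrib, ← Finset.prod_mul_distrib]
    refine Finset.prod_congr rfl fun a _ => ?_
    rw [hf.extend_apply]
    simp only [z]
    rw [mul_zpow, inv_zpow, zpow_neg, ← Complex.exp_int_mul, mul_comm (Complex.exp _)]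
    congr 1
    congr 2
    push_cast; ring
  simp_rw [hpt] at hsum
  rw [← Function.Injective.hasSum_iff hφ] at hsum
  · have := hsum.mul_left ((gcard Δ I : ℂ)⁻¹)
    refine this.congr_fun ?_
    intro u
    have hl : ∀ l, ∃ m : ℤ, ∑ i ∈ I, ((Function.extend f (fun a => - φ u a) 0 i : ℤ) : ℚ) * uu I i l = m := by
      intro l
      refine ⟨-u l, ?_⟩
      push_cast
      rw [ipr_cov h hI hc u l, ← Finset.sum_neg_distrib]
      refine Finset.sum_congr rfl fun i hi => ?_
      obtain ⟨a, rfl⟩ := (hfI i).mp hi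
      rw [hf.extend_apply]
      simp [φ]
    simp only [Function.comp]
    rw [if_pos hl, hprod, ← Complex.exp_sum, ipr_xi h hI hc u ξ α hα]
    have : ∑ x, ((t * (φ u x * α (f x)) : ℝ) : ℂ) = ((t * ∑ i ∈ I, (ipr Δ u i : ℝ) * α i : ℝ) : ℂ) := by
      have hI' : I = Finset.univ.image f := by
        ext i; rw [hfI]; simp
      rw [hI', Finset.sum_image (fun a _ b _ hab => hf hab)]
      push_cast
      rw [Finset.mul_sum]
    rw [this]
    simp only [φ]
    field_simp
  · intro k hk
    rw [if_neg, mul_zero]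
    intro hl
    apply hk
    choose m hm using hl
    refine ⟨fun l => - m l, ?_⟩
    funext a
    have := ipr_of h hI hc (fun i => Function.extend f (fun a => - k a) 0 i) m hm (hfm a)
    rw [hf.extend_apply] at this
    simp only [φ]
    have e : ipr Δ (fun l => - m l) (f a) = - ipr Δ m (f a) := by
      simp [ipr]
    rw [e, this, neg_neg]

end Cone


section Gen2
variable {n d : ℕ} {Δ : LMultiFan n d} {uu : Finset (Fin d) → Fin d → (Fin n → ℚ)}

lemma c_int (h : QDual Δ uu) {c : Fin d → ℝ}
    (hlat : Δ.LatticeVertices c (fun I i k => ((uu I i k : ℝ))))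
    {I : Finset (Fin d)} (hI : I ∈ Δ.S) (hc : I.card = n) {j : Fin d} (hj : j ∈ I) :
    (⌊c j⌋ : ℝ) = c j := by
  have hl := hlat I hI hc
  choose m hm using hl
  have : c j = ((∑ l, m l * Δ.v j l : ℤ) : ℝ) := by
    push_cast
    simp_rw [← hm, Finset.sum_mul]
    rw [Finset.sum_comm]
    have : ∀ i ∈ I, ∑ l, c i * (uu I i l : ℝ) * (Δ.v j l : ℝ) = if i = j then c i else 0 := by
      intro i hi
      have e := congrArg (fun r : ℚ => (r : ℝ)) (h I hI hc i hi j hj)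
      push_cast at e
      calc _ = c i * ∑ l, (uu I i l : ℝ) * (Δ.v j l : ℝ) := by
            rw [Finset.mul_sum]; exact Finset.sum_congr rfl fun k _ => by ring
        _ = _ := by rw [e]; split_ifs <;> simp
    rw [Finset.sum_congr rfl this]
    simp [hj]
  rw [this, Int.floor_intCast]

lemma c_lat (h : QDual Δ uu) {c : Fin d → ℝ}
    (hlat : Δ.LatticeVertices c (fun I i k => ((uu I i k : ℝ))))
    {I : Finset (Fin d)} (hI : I ∈ Δ.S) (hc : I.card = n) (l : Fin n) :
    ∃ m : ℤ, ∑ i ∈ I, ((⌊c i⌋ : ℤ) : ℚ) * uu I i l = m := by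
  obtain ⟨m, hm⟩ := hlat I hI hc l
  refine ⟨m, ?_⟩
  have : ((∑ i ∈ I, ((⌊c i⌋ : ℤ) : ℚ) * uu I i l : ℚ) : ℝ) = m := by
    rw [← hm]
    push_cast
    exact Finset.sum_congr rfl fun i hi => by rw [c_int h hlat hI hc hi]
  exact_mod_cast this

lemma dotp_ipr (u : Fin n → ℤ) (i : Fin d) :
    dotp (fun k => (u k : ℝ)) (Δ.toMF.v i) = (ipr Δ u i : ℝ) := by
  simp [dotp, ipr, LMultiFan.toMF]

lemma half_ne (a b : ℤ) : (a : ℝ) ≠ (b : ℝ) + 1 / 2 := by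
  intro h
  have : (2 * a : ℤ) = 2 * b + 1 := by
    have : (2 * a : ℝ) = 2 * b + 1 := by linarith
    exact_mod_cast this
  omega

lemma half_lt (a b : ℤ) : ((b : ℝ) + 1 / 2 < a) ↔ b < a := by
  constructor
  · intro h
    have : (b : ℝ) < a := by linarith
    exact_mod_cast this
  · intro h
    have : (b : ℝ) + 1 ≤ a := by exact_mod_cast h
    linarith

/-- the contribution of the vertex `u_I` -/
noncomputable def vert (Δ : LMultiFan n d) (uu : Finset (Fin d) → Fin d → (Fin n → ℚ))
    (c : Fin d → ℝ) (ξ : Fin n → ℝ) (I : Finset (Fin d)) (q : QI Δ I) (t : ℝ) : ℂ :=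
  ∏ i ∈ I, Complex.exp ((t * (c i * dotp (fun k => (uu I i k : ℝ)) ξ) : ℝ) : ℂ) /
        (1 - zeta uu I i q.out * Complex.exp (-((t * dotp (fun k => (uu I i k : ℝ)) ξ : ℝ) : ℂ)))

open scoped Classical in
lemma dh_gen (h : QDual Δ uu) {c : Fin d → ℝ} {ξ : Fin n → ℝ}
    (hξ : Δ.toMF.GenericDual (fun I i k => ((uu I i k : ℝ))) ξ)
    (hlat : Δ.LatticeVertices c (fun I i k => ((uu I i k : ℝ)))) (t : ℝ) (ht : t < 0) :
    HasSum (fun u : Fin n → ℤ =>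
      ((Δ.toMF.DH (fun i => c i + 1/2) (fun I i k => ((uu I i k : ℝ))) ξ (fun k => (u k : ℝ)) : ℤ) : ℂ) *
        Complex.exp ((t * ∑ k, (u k : ℝ) * ξ k : ℝ) : ℂ))
      (∑ I ∈ Δ.S.filter (fun I => I.card = n),
        (Δ.w I : ℂ) * ((gcard Δ I : ℂ)⁻¹ * ∑ᶠ q : QI Δ I, vert Δ uu c ξ I q t)) := by
  have key : ∀ I ∈ Δ.S.filter (fun I => I.card = n), HasSum (fun u : Fin n → ℤ =>
      (((if (∀ i ∈ I, (0 < dotp (fun k => (uu I i k : ℝ)) ξ ∧ c i + 1/2 ≤ dotp (fun k => (u k : ℝ)) (Δ.toMF.v i)) ∨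
                 (dotp (fun k => (uu I i k : ℝ)) ξ < 0 ∧ dotp (fun k => (u k : ℝ)) (Δ.toMF.v i) ≤ c i + 1/2))
    then (-1 : ℤ) ^ (I.filter fun i => 0 < dotp (fun k => (uu I i k : ℝ)) ξ).card * Δ.w I
    else 0 : ℤ)) : ℂ) * Complex.exp ((t * ∑ k, (u k : ℝ) * ξ k : ℝ) : ℂ))
      ((Δ.w I : ℂ) * ((gcard Δ I : ℂ)⁻¹ * ∑ᶠ q : QI Δ I, vert Δ uu c ξ I q t)) := by
    intro I hI
    obtain ⟨hI, hc⟩ := Finset.mem_filter.mp hI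
    have := qi_finite h hI hc
    let _ := Fintype.ofFinite (QI Δ I)
    have hs := (cone_sum h hI hc ξ (fun i => dotp (fun k => (uu I i k : ℝ)) ξ) (fun i _ => rfl)
      (fun i hi => hξ I hI hc i hi) (fun i => ⌊c i⌋) (c_lat h hlat hI hc) t ht).mul_left (Δ.w I : ℂ)
    rw [finsum_eq_sum_of_fintype]
    have hv : ∀ q : QI Δ I, (∏ i ∈ I, Complex.exp ((t * (((fun i => ⌊c i⌋) i : ℤ) * dotp (fun k => (uu I i k : ℝ)) ξ) : ℝ) : ℂ) /
        (1 - zeta uu I i q.out * Complex.exp (-((t * dotp (fun k => (uu I i k : ℝ)) ξ : ℝ) : ℂ)))) =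
        vert Δ uu c ξ I q t := by
      intro q
      unfold vert
      refine Finset.prod_congr rfl fun i hi => ?_
      simp only []
      rw [c_int h hlat hI hc hi]
    simp_rw [hv] at hs
    refine hs.congr_fun ?_
    intro u
    have e := dh_term (y := fun i => dotp (fun k => (u k : ℝ)) (Δ.toMF.v i))
      (α := fun i => dotp (fun k => (uu I i k : ℝ)) ξ) I (fun i hi => hξ I hI hc i hi)
      (fun i => c i + 1/2) (fun i hi => by
        rw [dotp_ipr, ← c_int h hlat hI hc hi]; exact half_ne _ _)
    have e2 : ∏ i ∈ I, (- (if c i + 1/2 < dotp (fun k => (u k : ℝ)) (Δ.toMF.v i) then (1:ℤ) else 0) +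
        (if dotp (fun k => (uu I i k : ℝ)) ξ < 0 then (1:ℤ) else 0)) =
        ∏ i ∈ I, (- (if ⌊c i⌋ < ipr Δ u i then (1:ℤ) else 0) +
        (if dotp (fun k => (uu I i k : ℝ)) ξ < 0 then (1:ℤ) else 0)) := by
      refine Finset.prod_congr rfl fun i hi => ?_
      have : (c i + 1/2 < dotp (fun k => (u k : ℝ)) (Δ.toMF.v i)) = (⌊c i⌋ < ipr Δ u i) := by
        rw [dotp_ipr, ← c_int h hlat hI hc hi, half_lt, c_int h hlat hI hc hi]
      simp only [this]
    rw [e2] at e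
    rw [← ite_zero_mul, e]
    push_cast
    ring
  have := hasSum_sum key
  refine this.congr_fun ?_
  intro u
  unfold MultiFan.DH
  rw [Int.cast_sum, Finset.sum_mul]
  rfl

end Gen2

section Asym
open Asymptotics Filter Topology

lemma poly_bigO (p : Polynomial ℂ) (m : ℕ) (hp : ∀ k < m, p.coeff k = 0) :
    (fun x : ℂ => p.eval x) =O[𝓝 0] (fun x => x ^ m) := by
  obtain ⟨q, rfl⟩ := Polynomial.X_pow_dvd_iff.mpr hp
  simp only [Polynomial.eval_mul, Polynomial.eval_pow, Polynomial.eval_X]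
  have : (fun x : ℂ => q.eval x) =O[𝓝 0] (fun _ => (1:ℂ)) :=
    (q.continuous.tendsto 0).isBigO_one ℂ
  simpa using (isBigO_refl (fun x : ℂ => x ^ m) (𝓝 0)).mul this

lemma pow_bigO {a b : ℕ} (h : a ≤ b) : (fun x : ℂ => x ^ b) =O[𝓝 0] (fun x => x ^ a) := by
  have e : (fun x : ℂ => x ^ b) = fun x => (Polynomial.X ^ b : Polynomial ℂ).eval x := by
    funext x; simp
  rw [e]
  apply poly_bigO
  intro k hk
  rw [Polynomial.coeff_X_pow, if_neg (by omega)]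

lemma exp_trunc (c : ℂ) (n : ℕ) :
    (fun x : ℂ => ∑ k ∈ range (n+1), c ^ k / (Nat.factorial k : ℂ) * x ^ k - Complex.exp (c * x))
      =O[𝓝 0] (fun x => x ^ (n+1)) := by
  have h := (Complex.exp_sub_sum_range_isBigO_pow (n+1)).comp_tendsto
    (show Tendsto (fun x : ℂ => c * x) (𝓝 0) (𝓝 0) by
      have : Tendsto (fun x : ℂ => c * x) (𝓝 0) (𝓝 (c * 0)) := (continuous_const.mul continuous_id).tendsto 0
      simpa using this)
  have h2 : ((fun x : ℂ => x ^ (n+1)) ∘ fun x => c * x) =O[𝓝 0] (fun x => x ^ (n+1)) := by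
    have : ((fun x : ℂ => x ^ (n+1)) ∘ fun x => c * x) = fun x => c ^ (n+1) * x ^ (n+1) := by
      funext x; simp [mul_pow]
    rw [this]
    exact isBigO_const_mul_self _ _ _
  have h3 := (h.trans h2).neg_left
  refine h3.congr_left ?_
  intro x
  simp only [Function.comp, neg_sub]
  congr 1
  refine Finset.sum_congr rfl fun k _ => ?_
  rw [mul_pow]; ring

lemma todd_aux {n : ℕ} {td : ℂ → ℕ → ℂ} (htd : ToddCoeffs n td) (ρ : ℂ) :
    (fun x : ℂ => (∑ k ∈ range (n+2), td ρ k * x ^ k) * (1 - ρ * Complex.exp (-x)) - x)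
      =O[𝓝 0] (fun x => x ^ (n+2)) := by
  let P : Polynomial ℂ := ∑ k ∈ range (n+2), Polynomial.monomial k (td ρ k)
  let b : ℕ → ℂ := fun j => if j = 0 then 1 - ρ else -ρ * (-1 : ℂ)^j / ((Nat.factorial j : ℂ))
  let Q : Polynomial ℂ := ∑ k ∈ range (n+2), Polynomial.monomial k (b k)
  have hPc : ∀ k < n + 2, P.coeff k = td ρ k := by
    intro k hk
    simp [P, Polynomial.coeff_monomial, hk]
  have hQc : ∀ k < n + 2, Q.coeff k = b k := by
    intro k hk
    simp [Q, Polynomial.coeff_monomial, hk]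
  have hPe : ∀ x, P.eval x = ∑ k ∈ range (n+2), td ρ k * x ^ k := by
    intro x; simp [P, Polynomial.eval_finsetSum]
  have hQe : ∀ x, Q.eval x = 1 - ρ * ∑ k ∈ range (n+2), (-1 : ℂ) ^ k / (Nat.factorial k : ℂ) * x ^ k := by
    intro x
    simp only [Q, Polynomial.eval_finsetSum, Polynomial.eval_monomial]
    have hb : ∀ k, b k = (if k = 0 then 1 else 0) - ρ * ((-1 : ℂ) ^ k / (Nat.factorial k : ℂ)) := by
      intro k
      simp only [b]
      split_ifs with hk
      · subst hk; simp
      · ring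
    have hb2 : ∀ k, b k * x ^ k = (if k = 0 then 1 else 0) -
        ρ * ((-1 : ℂ) ^ k / (Nat.factorial k : ℂ) * x ^ k) := by
      intro k
      rw [hb]
      split_ifs with hk
      · subst hk; simp
      · ring
    simp_rw [hb2]
    rw [Finset.sum_sub_distrib, ← Finset.mul_sum]
    simp
  have h1 : (fun x : ℂ => (P * Q - Polynomial.X).eval x) =O[𝓝 0] (fun x => x ^ (n+2)) := by
    apply poly_bigO
    intro m hm
    rw [Polynomial.coeff_sub, Polynomial.coeff_mul, Finset.Nat.sum_antidiagonal_eq_sum_range_succ_mk,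
      Polynomial.coeff_X]
    have := htd ρ m (by omega)
    rw [sub_eq_zero]
    have e : (if 1 = m then (1:ℂ) else 0) = if m = 1 then 1 else 0 := by simp [eq_comm]
    rw [e, ← this]
    refine Finset.sum_congr rfl fun k hk => ?_
    rw [Finset.mem_range] at hk
    rw [hPc k (by omega), hQc (m - k) (by omega)]
  have h2 := (exp_trunc (-1) (n+1)).const_mul_left ρ
  have h3 : (fun x : ℂ => P.eval x) =O[𝓝 0] (fun _ => (1:ℂ)) :=
    (P.continuous.tendsto 0).isBigO_one ℂ
  have h4 := h3.mul h2
  simp only [one_mul] at h4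
  have h5 := h1.add h4
  refine h5.congr_left ?_
  intro x
  rw [Polynomial.eval_sub, Polynomial.eval_mul, hQe, hPe, Polynomial.eval_X, neg_one_mul]
  ring

lemma inv_bigO (ρ : ℂ) : (fun x : ℂ => x / (1 - ρ * Complex.exp (-x))) =O[𝓝[≠] 0] (fun _ => (1:ℂ)) := by
  by_cases hρ : ρ = 1
  · subst hρ
    have hd : HasDerivAt (fun x : ℂ => 1 - 1 * Complex.exp (-x)) 1 0 := by
      have := (((hasDerivAt_id (0:ℂ)).neg.cexp).const_mul 1).const_sub 1
      simpa using this
    have h2 := hd.tendsto_slope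
    have h3 := h2.inv₀ one_ne_zero
    refine Tendsto.isBigO_one ℂ (c := (1:ℂ)⁻¹) ?_
    refine h3.congr ?_
    intro x
    simp [slope_def_field]
  · have : Tendsto (fun x : ℂ => x / (1 - ρ * Complex.exp (-x))) (𝓝 0) (𝓝 (0 / (1 - ρ * Complex.exp (-0)))) := by
      apply Tendsto.div tendsto_id
      · exact (by fun_prop : Continuous fun x : ℂ => 1 - ρ * Complex.exp (-x)).tendsto 0
      · simp [sub_eq_zero, Ne.symm hρ]
    exact (this.isBigO_one ℂ).mono nhdsWithin_le_nhds

lemma den_ne (ρ : ℂ) : ∀ᶠ x : ℂ in 𝓝[≠] 0, 1 - ρ * Complex.exp (-x) ≠ 0 := by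
  by_cases hρ : ρ = 1
  · subst hρ
    have hd : HasDerivAt (fun x : ℂ => 1 - 1 * Complex.exp (-x)) 1 0 := by
      have := (((hasDerivAt_id (0:ℂ)).neg.cexp).const_mul 1).const_sub 1
      simpa using this
    exact hd.eventually_ne one_ne_zero
  · have : Tendsto (fun x : ℂ => (1 - ρ * Complex.exp (-x))) (𝓝 0) (𝓝 ((1 - ρ * Complex.exp (-0)))) := 
      (by fun_prop : Continuous fun x : ℂ => 1 - ρ * Complex.exp (-x)).tendsto 0
    have h2 := this.eventually_ne (b₂ := 0) (by simp [sub_eq_zero, Ne.symm hρ])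
    exact h2.filter_mono nhdsWithin_le_nhds

lemma todd_trunc {n : ℕ} {td : ℂ → ℕ → ℂ} (htd : ToddCoeffs n td) (ρ : ℂ) :
    (fun x : ℂ => (∑ k ∈ range (n+1), td ρ k * x ^ k) - x / (1 - ρ * Complex.exp (-x)))
      =O[𝓝[≠] 0] (fun x => x ^ (n+1)) := by
  have h1 := (todd_aux htd ρ).mono (nhdsWithin_le_nhds (s := {0}ᶜ))
  have h2 := h1.mul (inv_bigO ρ)
  have h3 : (fun x : ℂ => (∑ k ∈ range (n+2), td ρ k * x ^ k) - x / (1 - ρ * Complex.exp (-x)))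
      =O[𝓝[≠] 0] (fun x => x ^ (n+1)) := by
    have h4 := h2.mul (isBigO_refl (fun x : ℂ => x⁻¹) (𝓝[≠] 0))
    refine h4.congr' ?_ ?_
    · filter_upwards [den_ne ρ, self_mem_nhdsWithin] with x hx hx0
      have hx0' : x ≠ 0 := hx0
      field_simp
    · filter_upwards [self_mem_nhdsWithin] with x hx0
      have hx0' : x ≠ 0 := hx0
      rw [pow_succ x (n+1)]
      field_simp
  have h5 := ((isBigO_const_mul_self (td ρ (n+1)) (fun x : ℂ => x ^ (n+1)) (𝓝[≠] 0)))
  refine (h3.sub h5).congr_left ?_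
  intro x
  rw [Finset.sum_range_succ _ (n+1)]
  ring

end Asym


section Fin
open Asymptotics Filter Topology
variable {n d : ℕ} {Δ : LMultiFan n d} {uu : Finset (Fin d) → Fin d → (Fin n → ℚ)}

lemma prod_bigO {ι : Type*} (I : Finset ι) (A B : ι → ℝ → ℂ) (g : ℝ → ℂ) (l : Filter ℝ)
    (hg : g =O[l] (fun _ => (1:ℂ)))
    (hAB : ∀ i ∈ I, (fun t => A i t - B i t) =O[l] g)
    (hB : ∀ i ∈ I, B i =O[l] (fun _ => (1:ℂ))) :
    (fun t => ∏ i ∈ I, A i t - ∏ i ∈ I, B i t) =O[l] g ∧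
      (fun t => ∏ i ∈ I, B i t) =O[l] (fun _ => (1:ℂ)) := by
  classical
  induction I using Finset.induction_on with
  | empty => 
    simp only [Finset.prod_empty, sub_self]
    exact ⟨isBigO_zero _ _, isBigO_refl _ _⟩
  | insert j s hj ih =>
    obtain ⟨h1, h2⟩ := ih (fun i hi => hAB i (Finset.mem_insert_of_mem hi))
      (fun i hi => hB i (Finset.mem_insert_of_mem hi))
    have hj1 := hAB j (Finset.mem_insert_self _ _)
    have hj2 := hB j (Finset.mem_insert_self _ _)
    simp only [Finset.prod_insert hj]
    constructor
    · have hA : A j =O[l] (fun _ => (1:ℂ)) := by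
        have := (hj1.trans hg).add hj2
        refine this.congr_left fun t => by ring
      have e1 := hA.mul h1
      have e2 := hj1.mul h2
      simp only [one_mul, mul_one] at e1 e2
      refine (e1.add e2).congr_left fun t => by ring
    · have := hj2.mul h2
      simpa using this

lemma x_tendsto {α : ℝ} (hα : α ≠ 0) :
    Tendsto (fun t : ℝ => ((t * α : ℝ) : ℂ)) (𝓝[<] 0) (𝓝[≠] 0) := by
  apply tendsto_nhdsWithin_of_tendsto_nhds_of_eventually_within
  · have : Tendsto (fun t : ℝ => ((t * α : ℝ) : ℂ)) (𝓝 0) (𝓝 ((0 * α : ℝ) : ℂ)) :=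
      (by fun_prop : Continuous fun t : ℝ => ((t * α : ℝ) : ℂ)).tendsto 0
    rw [zero_mul, Complex.ofReal_zero] at this
    exact this.mono_left nhdsWithin_le_nhds
  · filter_upwards [self_mem_nhdsWithin] with t ht
    have : t ≠ 0 := ne_of_lt ht
    simp [this, hα]

lemma x_pow_bigO (α : ℝ) (m : ℕ) :
    (fun t : ℝ => ((t * α : ℝ) : ℂ) ^ m) =O[𝓝[<] 0] (fun t : ℝ => (t : ℂ) ^ m) := by
  have : (fun t : ℝ => ((t * α : ℝ) : ℂ) ^ m) = fun t : ℝ => (α : ℂ) ^ m * (t : ℂ) ^ m := by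
    funext t; push_cast; rw [mul_pow, mul_comm]
  rw [this]
  exact isBigO_const_mul_self _ _ _

lemma vert_asym (ξ : Fin n → ℝ) (c : Fin d → ℝ) {td : ℂ → ℕ → ℂ} (htd : ToddCoeffs n td)
    {I : Finset (Fin d)} (hc : I.card = n)
    (hα0 : ∀ i ∈ I, dotp (fun k => (uu I i k : ℝ)) ξ ≠ 0) (q : QI Δ I) :
    Tendsto (fun t : ℝ =>
      ((∏ i ∈ I, ∑ k ∈ range (n+1), (c i : ℂ) ^ k / (Nat.factorial k : ℂ) *
          ((t * dotp (fun k => (uu I i k : ℝ)) ξ : ℝ) : ℂ) ^ k) *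
        (∏ i ∈ I, ∑ k ∈ range (n+1), td (zeta uu I i q.out) k *
          ((t * dotp (fun k => (uu I i k : ℝ)) ξ : ℝ) : ℂ) ^ k)) /
        (∏ i ∈ I, ((t * dotp (fun k => (uu I i k : ℝ)) ξ : ℝ) : ℂ)) - vert Δ uu c ξ I q t)
      (𝓝[<] 0) (𝓝 0) := by
  set α : Fin d → ℝ := fun i => dotp (fun k => (uu I i k : ℝ)) ξ with hα
  let g : ℝ → ℂ := fun t => (t : ℂ) ^ (n+1)
  have hg : g =O[𝓝[<] 0] (fun _ => (1:ℂ)) := by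
    have : Tendsto g (𝓝 0) (𝓝 (g 0)) := (by fun_prop : Continuous g).tendsto 0
    exact (this.isBigO_one ℂ).mono nhdsWithin_le_nhds
  let E : Fin d → ℝ → ℂ := fun i t => ∑ k ∈ range (n+1), (c i : ℂ) ^ k / (Nat.factorial k : ℂ) *
          ((t * α i : ℝ) : ℂ) ^ k
  let T : Fin d → ℝ → ℂ := fun i t => ∑ k ∈ range (n+1), td (zeta uu I i q.out) k *
          ((t * α i : ℝ) : ℂ) ^ k
  let E' : Fin d → ℝ → ℂ := fun i t => Complex.exp ((t * (c i * α i) : ℝ) : ℂ)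
  let T' : Fin d → ℝ → ℂ := fun i t => ((t * α i : ℝ) : ℂ) /
    (1 - zeta uu I i q.out * Complex.exp (-((t * α i : ℝ) : ℂ)))
  have hE : ∀ i ∈ I, (fun t => E i t - E' i t) =O[𝓝[<] 0] g := by
    intro i hi
    have h1 := (exp_trunc (c i : ℂ) n).comp_tendsto ((x_tendsto (hα0 i hi)).mono_right nhdsWithin_le_nhds)
    have h2 := h1.trans (x_pow_bigO (α i) (n+1))
    refine h2.congr_left fun t => ?_
    simp only [Function.comp, E, E']
    congr 2
    simp only [hα]
    push_cast; ring
  have hT : ∀ i ∈ I, (fun t => T i t - T' i t) =O[𝓝[<] 0] g := by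
    intro i hi
    have h1 := (todd_trunc htd (zeta uu I i q.out)).comp_tendsto (x_tendsto (hα0 i hi))
    exact h1.trans (x_pow_bigO (α i) (n+1))
  have hE' : ∀ i ∈ I, E' i =O[𝓝[<] 0] (fun _ => (1:ℂ)) := by
    intro i hi
    have : Tendsto (E' i) (𝓝 0) (𝓝 (E' i 0)) := (by fun_prop : Continuous (E' i)).tendsto 0
    exact (this.isBigO_one ℂ).mono nhdsWithin_le_nhds
  have hT' : ∀ i ∈ I, T' i =O[𝓝[<] 0] (fun _ => (1:ℂ)) := by
    intro i hi
    exact (inv_bigO (zeta uu I i q.out)).comp_tendsto (x_tendsto (hα0 i hi))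
  obtain ⟨p1, p2⟩ := prod_bigO I E E' g _ hg hE hE'
  obtain ⟨p3, p4⟩ := prod_bigO I T T' g _ hg hT hT'
  have p5 : (fun t => ∏ i ∈ I, T i t) =O[𝓝[<] 0] (fun _ => (1:ℂ)) :=
    ((p3.trans hg).add p4).congr_left fun t => by ring
  have p6 : (fun t => (∏ i ∈ I, E i t) * (∏ i ∈ I, T i t) - (∏ i ∈ I, E' i t) * (∏ i ∈ I, T' i t))
      =O[𝓝[<] 0] g := by
    have e1 := p1.mul p5
    have e2 := p2.mul p3
    simp only [one_mul, mul_one] at e1 e2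
    exact (e1.add e2).congr_left fun t => by ring
  have p7 := p6.mul (isBigO_const_mul_self ((∏ i ∈ I, (α i : ℂ))⁻¹) (fun t : ℝ => ((t : ℂ) ^ n)⁻¹) (𝓝[<] 0))
  have p8 : (fun t : ℝ => g t * ((t : ℂ) ^ n)⁻¹) =ᶠ[𝓝[<] 0] (fun t : ℝ => (t : ℂ)) := by
    filter_upwards [self_mem_nhdsWithin] with t ht
    have : (t : ℂ) ≠ 0 := by exact_mod_cast ne_of_lt ht
    simp only [g]
    rw [pow_succ]
    field_simp
  have p9 : Tendsto (fun t : ℝ => (t : ℂ)) (𝓝[<] 0) (𝓝 0) := by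
    have : Tendsto (fun t : ℝ => (t : ℂ)) (𝓝 0) (𝓝 ((0:ℝ) : ℂ)) := Complex.continuous_ofReal.tendsto 0
    rw [Complex.ofReal_zero] at this
    exact this.mono_left nhdsWithin_le_nhds
  have p10 := (p7.trans_eventuallyEq p8).trans_tendsto p9
  refine p10.congr' ?_
  filter_upwards [self_mem_nhdsWithin] with t ht
  have ht0 : (t : ℂ) ≠ 0 := by exact_mod_cast ne_of_lt ht
  have hpa : ∏ i ∈ I, ((t * α i : ℝ) : ℂ) = (t : ℂ) ^ n * ∏ i ∈ I, (α i : ℂ) := by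
    simp only [Complex.ofReal_mul]
    rw [Finset.prod_mul_distrib, Finset.prod_const, hc]
  have hpa0 : ∏ i ∈ I, (α i : ℂ) ≠ 0 := by
    rw [Finset.prod_ne_zero_iff]
    intro i hi
    exact_mod_cast hα0 i hi
  have hv : vert Δ uu c ξ I q t = (∏ i ∈ I, E' i t) * (∏ i ∈ I, T' i t) / ∏ i ∈ I, ((t * α i : ℝ) : ℂ) := by
    unfold vert
    rw [← Finset.prod_mul_distrib, ← Finset.prod_div_distrib]
    refine Finset.prod_congr rfl fun i hi => ?_
    have : ((t * α i : ℝ) : ℂ) ≠ 0 := by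
      have h3 : (α i : ℂ) ≠ 0 := by exact_mod_cast hα0 i hi
      push_cast
      exact mul_ne_zero ht0 h3
    simp only [E', T']
    rw [← mul_div_assoc, mul_comm (Complex.exp _) ((t * α i : ℝ) : ℂ), mul_div_assoc,
      mul_div_cancel_left₀ _ this]
  rw [hv, hpa]
  simp only [E, T]
  rw [← sub_div, ← mul_inv, mul_comm ((t : ℂ) ^ n), div_eq_mul_inv]

open MvPolynomial in
lemma iota_exp {I : Finset (Fin d)} (c : Fin d → ℝ) :
    iotaC uu I (expPoly n c) = ∏ i ∈ I, ∑ k ∈ range (n+1),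
      (((c i : ℂ)) ^ k / (Nat.factorial k : ℂ)) • lin (uu I i) ^ k := by
  classical
  unfold expPoly
  rw [map_prod, ← Finset.prod_subset (Finset.subset_univ I)]
  · refine Finset.prod_congr rfl fun i hi => ?_
    rw [map_sum]
    refine Finset.sum_congr rfl fun k _ => ?_
    rw [map_smul, map_pow]
    unfold iotaC
    rw [aeval_X, if_pos hi]
    rfl
  · intro i _ hi
    rw [map_sum, Finset.sum_eq_single 0]
    · simp
    · intro k _ hk
      rw [map_smul, map_pow]
      unfold iotaC
      rw [aeval_X, if_neg hi, zero_pow hk, smul_zero]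
    · simp

open MvPolynomial in
lemma lin_evalt (u : Fin n → ℚ) (ξ : Fin n → ℝ) (t : ℝ) :
    eval (fun k => ((t * ξ k : ℝ) : ℂ)) (lin u) =
      ((t * dotp (fun k => (u k : ℝ)) ξ : ℝ) : ℂ) := by
  simp only [lin, map_sum, smul_eval, eval_X, dotp]
  push_cast
  rw [Finset.mul_sum]
  exact Finset.sum_congr rfl fun k _ => by ring

open MvPolynomial in
lemma rr_main (hC : Δ.toMF.Complete) (c : Fin d → ℝ) 
    (huu : Δ.toMF.DualBasis (fun I i k => ((uu I i k : ℝ))))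
    (ξ : Fin n → ℝ) (hξ : Δ.toMF.GenericDual (fun I i k => ((uu I i k : ℝ))) ξ)
    (hlat : Δ.LatticeVertices c (fun I i k => ((uu I i k : ℝ))))
    (td : ℂ → ℕ → ℂ) (htd : ToddCoeffs n td) :
    ∃ p : MvPolynomial (Fin n) ℂ,
      piShriekC Δ uu (expPoly n c * toddPoly Δ td)
        = algebraMap (MvPolynomial (Fin n) ℂ) (FractionRing (MvPolynomial (Fin n) ℂ)) p ∧
      MvPolynomial.coeff 0 p = (Δ.sharpP c (fun I i k => ((uu I i k : ℝ))) ξ : ℂ) := by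
  classical
  have h := qdual_of Δ uu huu
  set f := expPoly n c * toddPoly Δ td with hf
  obtain ⟨p, hp⟩ := piShriek_poly hC huu f
  refine ⟨p, hp, ?_⟩
  let s := Δ.S.filter (fun I => I.card = n)
  -- value of p along the line
  have hpt : ∀ t : ℝ, t < 0 → ∑ I ∈ s,
      ((Δ.w I : ℂ) / (gcard Δ I : ℂ)) * (eval (fun k => ((t * ξ k : ℝ) : ℂ)) (iotaC uu I f) /
        ∏ i ∈ I, ((t * dotp (fun k => (uu I i k : ℝ)) ξ : ℝ) : ℂ)) =
      eval (fun k => ((t * ξ k : ℝ) : ℂ)) p := by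
    intro t ht
    have := eval_frac (eval (fun k => ((t * ξ k : ℝ) : ℂ))) s
      (fun I => C ((Δ.w I : ℂ) / (gcard Δ I : ℂ)) * iotaC uu I f)
      (fun I => ∏ i ∈ I, lin (uu I i)) (by
        intro I hI
        obtain ⟨hI, hc⟩ := Finset.mem_filter.mp hI
        rw [map_prod, Finset.prod_ne_zero_iff]
        intro i hi
        rw [lin_evalt]
        exact_mod_cast mul_ne_zero ht.ne (hξ I hI hc i hi)) p (by
        rw [← hp, piShriek_eq]
        refine Finset.sum_congr rfl fun I _ => ?_
        unfold term
        rw [map_mul, mul_div_assoc])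
    rw [← this]
    refine Finset.sum_congr rfl fun I _ => ?_
    rw [map_mul (eval _), eval_C, map_prod, mul_div_assoc]
    simp_rw [lin_evalt]
  let F : ℝ → ℂ := fun t => ∑ I ∈ s,
        (Δ.w I : ℂ) * ((gcard Δ I : ℂ)⁻¹ * ∑ᶠ q : QI Δ I, vert Δ uu c ξ I q t)
  have hdiff : Tendsto (fun t : ℝ => eval (fun k => ((t * ξ k : ℝ) : ℂ)) p - F t) (𝓝[<] 0) (𝓝 0) := by
    have hI : ∀ I ∈ s, Tendsto (fun t : ℝ => ((Δ.w I : ℂ) / (gcard Δ I : ℂ)) *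
        (eval (fun k => ((t * ξ k : ℝ) : ℂ)) (iotaC uu I f) /
        ∏ i ∈ I, ((t * dotp (fun k => (uu I i k : ℝ)) ξ : ℝ) : ℂ)) -
        (Δ.w I : ℂ) * ((gcard Δ I : ℂ)⁻¹ * ∑ᶠ q : QI Δ I, vert Δ uu c ξ I q t)) (𝓝[<] 0) (𝓝 0) := by
      intro I hI
      obtain ⟨hI, hc⟩ := Finset.mem_filter.mp hI
      have := qi_finite h hI hc
      let _ := Fintype.ofFinite (QI Δ I)
      have hq := tendsto_finsetSum (Finset.univ : Finset (QI Δ I)) (fun q _ =>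
        vert_asym (Δ := Δ) (uu := uu) ξ c htd hc (fun i hi => hξ I hI hc i hi) q)
      have hq2 := hq.const_mul ((Δ.w I : ℂ) / (gcard Δ I : ℂ))
      rw [Finset.sum_const_zero, mul_zero] at hq2
      refine hq2.congr fun t => ?_
      rw [finsum_eq_sum_of_fintype, Finset.sum_sub_distrib, mul_sub]
      congr 1
      · congr 1
        rw [← Finset.sum_div, ← Finset.mul_sum, hf, map_mul, map_mul, iota_todd h hI hc htd, iota_exp]
        simp only [map_sum, map_prod, smul_eval, map_pow, lin_evalt]
      · rw [div_eq_mul_inv, mul_assoc]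
    have := tendsto_finsetSum s hI
    rw [Finset.sum_const_zero] at this
    refine this.congr' ?_
    filter_upwards [self_mem_nhdsWithin] with t ht
    rw [Finset.sum_sub_distrib, hpt t ht]
  have hp0 : Tendsto (fun t : ℝ => eval (fun k => ((t * ξ k : ℝ) : ℂ)) p) (𝓝[<] 0) (𝓝 (coeff 0 p)) := by
    have hcont : Continuous (fun t : ℝ => eval (fun k => ((t * ξ k : ℝ) : ℂ)) p) :=
      (MvPolynomial.continuous_eval p).comp (by fun_prop)
    have := hcont.tendsto 0
    have e : eval (fun k => ((0 * ξ k : ℝ) : ℂ)) p = coeff 0 p := by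
      have : (fun k : Fin n => ((0 * ξ k : ℝ) : ℂ)) = 0 := by funext k; simp
      rw [this, ← constantCoeff_eq, ← eval_zero]
    rw [e] at this
    exact this.mono_left nhdsWithin_le_nhds
  let D : (Fin n → ℤ) → ℤ := fun u =>
    Δ.toMF.DH (fun i => c i + 1/2) (fun I i k => ((uu I i k : ℝ))) ξ (fun k => (u k : ℝ))
  have hfin : (Function.support D).Finite := by
    apply DH_finite hC huu hξ
    intro u I hI hc i hi
    rw [dotp_ipr, ← c_int h hlat hI hc hi]
    exact half_ne _ _
  have hF : Tendsto F (𝓝[<] 0) (𝓝 ((Δ.sharpP c (fun I i k => ((uu I i k : ℝ))) ξ : ℤ) : ℂ)) := by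
    have e1 : Δ.sharpP c (fun I i k => ((uu I i k : ℝ))) ξ = ∑ u ∈ hfin.toFinset, D u := by
      unfold LMultiFan.sharpP
      exact finsum_eq_sum D hfin
    have hcont : Continuous (fun t : ℝ => ∑ u ∈ hfin.toFinset,
        (D u : ℂ) * Complex.exp ((t * ∑ k, (u k : ℝ) * ξ k : ℝ) : ℂ)) := by fun_prop
    have h0 := (hcont.tendsto 0).mono_left (nhdsWithin_le_nhds (s := Set.Iio 0))
    have e2 : ∑ u ∈ hfin.toFinset,
        (D u : ℂ) * Complex.exp ((0 * ∑ k, (u k : ℝ) * ξ k : ℝ) : ℂ) =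
        ((Δ.sharpP c (fun I i k => ((uu I i k : ℝ))) ξ : ℤ) : ℂ) := by
      rw [e1]; simp
    rw [e2] at h0
    refine h0.congr' ?_
    filter_upwards [self_mem_nhdsWithin] with t ht
    have g1 := dh_gen h hξ hlat t ht
    have g2 : HasSum (fun u : Fin n → ℤ => (D u : ℂ) * Complex.exp ((t * ∑ k, (u k : ℝ) * ξ k : ℝ) : ℂ))
        (∑ u ∈ hfin.toFinset, (D u : ℂ) * Complex.exp ((t * ∑ k, (u k : ℝ) * ξ k : ℝ) : ℂ)) := by
      apply hasSum_sum_of_ne_finset_zero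
      intro u hu
      have : D u = 0 := by
        by_contra hne
        exact hu (hfin.mem_toFinset.mpr hne)
      rw [this]; simp
    have := g2.unique g1
    convert this using 1
  have hlim := hp0.sub hF
  have := tendsto_nhds_unique hlim hdiff
  exact sub_eq_zero.mp this

end Fin

/-- **Theorem 8.5** (combinatorial Riemann–Roch): for a simple lattice multi-polytope `P`
over a complete simplicial multi-fan `Δ`, `∫_Δ e^{c_1(P)} T(Δ) = ♯(P)`.  Concretely,
`π_!` applied to (a lift of) `e^{c_1(P)} T(Δ)` is a polynomial in `H^*(BT;ℂ)` whose
constant term (its image under `H^*(BT) → H^*(BT)/(H^{>0}) = ℂ`) equals `♯(P)`. -/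
theorem stmt17 (n d : ℕ) (Δ : LMultiFan n d) (hC : Δ.toMF.Complete)
    (c : Fin d → ℝ) (uu : Finset (Fin d) → Fin d → (Fin n → ℚ))
    (huu : Δ.toMF.DualBasis (fun I i k => ((uu I i k : ℝ))))
    (ξ : Fin n → ℝ) (hξ : Δ.toMF.GenericDual (fun I i k => ((uu I i k : ℝ))) ξ)
    (hlat : Δ.LatticeVertices c (fun I i k => ((uu I i k : ℝ))))
    (td : ℂ → ℕ → ℂ) (htd : ToddCoeffs n td) :
    ∃ p : MvPolynomial (Fin n) ℂ,
      piShriekC Δ uu (expPoly n c * toddPoly Δ td)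
        = algebraMap (MvPolynomial (Fin n) ℂ) (FractionRing (MvPolynomial (Fin n) ℂ)) p ∧
      MvPolynomial.coeff 0 p = (Δ.sharpP c (fun I i k => ((uu I i k : ℝ))) ξ : ℂ) := by
  exact rr_main hC c huu ξ hξ hlat td htd
end

section
/- For a simple multi-polytope P of dimension n over a complete simplicial multi-fan Δ, vol(P) = (1/n!) ∫_Δ c_1(P)^n = ∫_Δ e^{c_1(P)}. Consequently, as a function of the hyperplane constants (c_1,...,c_d) (via c_1^T(P) = Σ c_i x_i), the volume vol(P) is a homogeneous polynomial of degree n. -/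
open Finset

open scoped Classical in
/-- The restriction `ι_I^*` over `ℝ`. -/
noncomputable def iotaR {n d : ℕ} (uu : Finset (Fin d) → Fin d → (Fin n → ℚ))
    (I : Finset (Fin d)) : MvPolynomial (Fin d) ℝ →ₐ[ℝ] MvPolynomial (Fin n) ℝ :=
  MvPolynomial.aeval
    (fun i => if i ∈ I then ∑ k : Fin n, ((uu I i k : ℝ)) • MvPolynomial.X k else 0)

open scoped Classical in
/-- The index map `π_!` over `ℝ`. -/
noncomputable def piShriekR {n d : ℕ} (Δ : LMultiFan n d)
    (uu : Finset (Fin d) → Fin d → (Fin n → ℚ)) (x : MvPolynomial (Fin d) ℝ) :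
    FractionRing (MvPolynomial (Fin n) ℝ) :=
  ∑ I ∈ Δ.S.filter (fun I => I.card = n),
    algebraMap (MvPolynomial (Fin n) ℝ) (FractionRing (MvPolynomial (Fin n) ℝ))
      (MvPolynomial.C ((Δ.w I : ℝ) /
        (Nat.card ((Fin n → ℤ) ⧸ Submodule.span ℤ (Δ.v '' (I : Set (Fin d)))) : ℝ))) *
    (algebraMap (MvPolynomial (Fin n) ℝ) _ (iotaR uu I x) /
     algebraMap (MvPolynomial (Fin n) ℝ) _
       (∏ i ∈ I, ∑ k : Fin n, ((uu I i k : ℝ)) • MvPolynomial.X k))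


namespace VolProof

open MeasureTheory Filter Topology MultiFan

variable {n d : ℕ}

/-- The matrix of ray vectors of a top simplex. -/
noncomputable def rayMat (Δ : MultiFan n d) (I : Finset (Fin d)) (h : I.card = n) :
    Matrix (Fin n) (Fin n) ℝ :=
  Matrix.of fun j k => Δ.v ((I.equivFinOfCardEq h).symm j).1 k

lemma sum_simplex {M : Type*} [AddCommMonoid M] (I : Finset (Fin d)) (h : I.card = n)
    (f : Fin d → M) :
    ∑ i ∈ I, f i = ∑ j : Fin n, f ((I.equivFinOfCardEq h).symm j).1 := by
  rw [← Finset.sum_coe_sort]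
  exact (Equiv.sum_comp (I.equivFinOfCardEq h).symm (fun i : I => f i.1)).symm

lemma prod_simplex {M : Type*} [CommMonoid M] (I : Finset (Fin d)) (h : I.card = n)
    (f : Fin d → M) :
    ∏ i ∈ I, f i = ∏ j : Fin n, f ((I.equivFinOfCardEq h).symm j).1 := by
  rw [← Finset.prod_coe_sort]
  exact (Equiv.prod_comp (I.equivFinOfCardEq h).symm (fun i : I => f i.1)).symm

lemma dual_mul (Δ : MultiFan n d) {uu : Finset (Fin d) → Fin d → (Fin n → ℝ)}
    (huu : Δ.DualBasis uu) {I : Finset (Fin d)} (hI : I ∈ Δ.S) (h : I.card = n) :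
    (Matrix.of fun j k => uu I ((I.equivFinOfCardEq h).symm j).1 k) * (rayMat Δ I h).transpose
      = (1 : Matrix (Fin n) (Fin n) ℝ) := by
  ext a b
  have := huu I hI h _ ((I.equivFinOfCardEq h).symm a).2 _ ((I.equivFinOfCardEq h).symm b).2
  rw [Matrix.mul_apply, Matrix.one_apply]
  simp only [dotp] at this
  simp only [Matrix.of_apply, Matrix.transpose_apply, rayMat]
  rw [this]
  congr 1
  simp [Subtype.ext_iff.symm]

lemma det_rayMat_ne (Δ : MultiFan n d) {uu : Finset (Fin d) → Fin d → (Fin n → ℝ)}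
    (huu : Δ.DualBasis uu) {I : Finset (Fin d)} (hI : I ∈ Δ.S) (h : I.card = n) :
    (rayMat Δ I h).det ≠ 0 := by
  intro h0
  have := congrArg Matrix.det (dual_mul Δ huu hI h)
  rw [Matrix.det_mul, Matrix.det_transpose, h0] at this
  simp at this

lemma resolution (Δ : MultiFan n d) {uu : Finset (Fin d) → Fin d → (Fin n → ℝ)}
    (huu : Δ.DualBasis uu) {I : Finset (Fin d)} (hI : I ∈ Δ.S) (h : I.card = n)
    (k l : Fin n) : ∑ i ∈ I, Δ.v i k * uu I i l = if k = l then 1 else 0 := by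
  have := mul_eq_one_comm.mp (dual_mul Δ huu hI h)
  have := congrFun (congrFun this k) l
  rw [Matrix.mul_apply, Matrix.one_apply] at this
  rw [sum_simplex I h, ← this]
  rfl

lemma expand_vec (Δ : MultiFan n d) {uu : Finset (Fin d) → Fin d → (Fin n → ℝ)}
    (huu : Δ.DualBasis uu) {I : Finset (Fin d)} (hI : I ∈ Δ.S) (h : I.card = n)
    (ξ : Fin n → ℝ) : ξ = ∑ i ∈ I, dotp (uu I i) ξ • Δ.v i := by
  ext k
  simp only [Finset.sum_apply, Pi.smul_apply, smul_eq_mul, dotp, Finset.sum_mul]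
  rw [Finset.sum_comm]
  have : ∀ l, ∑ i ∈ I, uu I i l * ξ l * Δ.v i k = (if k = l then 1 else 0) * ξ l := by
    intro l
    rw [← resolution Δ huu hI h k l, Finset.sum_mul]
    exact Finset.sum_congr rfl fun i _ => by ring
  simp [this]

lemma dotp_smul_right (u x : Fin n → ℝ) (a : ℝ) : dotp u (a • x) = a * dotp u x := by
  simp only [dotp, Finset.mul_sum, Pi.smul_apply, smul_eq_mul]
  exact Finset.sum_congr rfl fun i _ => by ring

lemma dotp_sum_right {ι : Type*} (s : Finset ι) (u : Fin n → ℝ) (x : ι → Fin n → ℝ) :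
    dotp u (∑ i ∈ s, x i) = ∑ i ∈ s, dotp u (x i) := by
  simp only [dotp, Finset.sum_apply, Finset.mul_sum]
  rw [Finset.sum_comm]

lemma dotp_sub_right (u x y : Fin n → ℝ) : dotp u (x - y) = dotp u x - dotp u y := by
  simp only [dotp, Pi.sub_apply, mul_sub, Finset.sum_sub_distrib]

lemma dotp_neg_right (u x : Fin n → ℝ) : dotp u (-x) = - dotp u x := by
  simp [dotp]

lemma expand_pair (Δ : MultiFan n d) {uu : Finset (Fin d) → Fin d → (Fin n → ℝ)}
    (huu : Δ.DualBasis uu) {I : Finset (Fin d)} (hI : I ∈ Δ.S) (h : I.card = n)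
    (u ξ : Fin n → ℝ) : dotp u ξ = ∑ i ∈ I, dotp (uu I i) ξ * dotp u (Δ.v i) := by
  conv_lhs => rw [expand_vec Δ huu hI h ξ]
  rw [dotp_sum_right]
  simp only [dotp_smul_right]

lemma dotp_span_zero (Δ : MultiFan n d) {uu : Finset (Fin d) → Fin d → (Fin n → ℝ)}
    (huu : Δ.DualBasis uu) {I : Finset (Fin d)} (hI : I ∈ Δ.S) (h : I.card = n)
    {K : Finset (Fin d)} (hK : K ⊆ I) {i : Fin d} (hi : i ∈ I) (hiK : i ∉ K)
    {x : Fin n → ℝ} (hx : x ∈ Submodule.span ℝ (Δ.v '' (K : Set (Fin d)))) :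
    dotp (uu I i) x = 0 := by
  induction hx using Submodule.span_induction with
  | mem x hx =>
    obtain ⟨j, hj, rfl⟩ := hx
    rw [huu I hI h i hi j (hK hj), if_neg]
    rintro rfl
    exact hiK hj
  | zero => simp [dotp]
  | add x y _ _ hx hy =>
    have : dotp (uu I i) (x + y) = dotp (uu I i) x + dotp (uu I i) y := by
      simp [dotp, mul_add, Finset.sum_add_distrib]
    rw [this, hx, hy, add_zero]
  | smul a x _ hx => rw [dotp_smul_right, hx, mul_zero]

lemma generic_of_dual (Δ : MultiFan n d) (hC : Δ.Complete)
    {uu : Finset (Fin d) → Fin d → (Fin n → ℝ)}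
    (huu : Δ.DualBasis uu) {ξ : Fin n → ℝ} (hξ : Δ.GenericDual uu ξ) (K : Finset (Fin d)) :
    Δ.GenericFor K ξ := by
  intro L hL _ hLn hmem
  obtain ⟨I, hI, hLI, hIn⟩ := (hC L hL).1
  have : ∃ i ∈ I, i ∉ L := by
    by_contra hcon
    push Not at hcon
    have := Finset.card_le_card (show I ⊆ L from hcon)
    omega
  obtain ⟨i, hi, hiL⟩ := this
  exact hξ I hI hIn i hi (dotp_span_zero Δ huu hI hIn hLI hi hiL hmem)

lemma inProjCone_iff (Δ : MultiFan n d) {uu : Finset (Fin d) → Fin d → (Fin n → ℝ)}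
    (huu : Δ.DualBasis uu) {ξ : Fin n → ℝ} (hξ : Δ.GenericDual uu ξ)
    {I : Finset (Fin d)} (hI : I ∈ Δ.S) (h : I.card = n)
    {K : Finset (Fin d)} (hK : K ⊆ I) :
    Δ.InProjCone K I ξ ↔ ∀ i ∈ I \ K, 0 < dotp (uu I i) ξ := by
  constructor
  · rintro ⟨a, ha, hmem⟩ i hi
    have hi' := Finset.mem_sdiff.mp hi
    have h0 := dotp_span_zero Δ huu hI h hK hi'.1 hi'.2 hmem
    have h1 : ∑ j ∈ I \ K, dotp (uu I i) (a j • Δ.v j) = a i := by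
      rw [Finset.sum_eq_single_of_mem i hi]
      · rw [dotp_smul_right, huu I hI h i hi'.1 i hi'.1]; simp
      · intro j hj hji
        rw [dotp_smul_right, huu I hI h i hi'.1 j (Finset.mem_sdiff.mp hj).1, if_neg hji.symm,
          mul_zero]
    rw [dotp_sub_right, dotp_sum_right, h1, sub_eq_zero] at h0
    exact lt_of_le_of_ne (h0 ▸ ha i hi) (hξ I hI h i hi'.1).symm
  · intro hp
    refine ⟨fun i => dotp (uu I i) ξ, fun j hj => (hp j hj).le, ?_⟩
    have h1 := expand_vec Δ huu hI h ξ
    rw [← Finset.sum_sdiff hK] at h1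
    have h2 : ξ - ∑ j ∈ I \ K, dotp (uu I j) ξ • Δ.v j = ∑ j ∈ K, dotp (uu I j) ξ • Δ.v j := by
      rw [sub_eq_iff_eq_add']; exact h1
    rw [h2]
    refine Submodule.sum_mem _ fun j hj => Submodule.smul_mem _ _ (Submodule.subset_span ?_)
    exact ⟨j, hj, rfl⟩

open scoped Classical in
/-- Off the hyperplanes, the DH function is an alternating sum of the `d_x` of projected
multi-fans. -/
lemma DH_expand (Δ : MultiFan n d) (c : Fin d → ℝ)
    {uu : Finset (Fin d) → Fin d → (Fin n → ℝ)}
    (huu : Δ.DualBasis uu) {ξ : Fin n → ℝ} (hξ : Δ.GenericDual uu ξ) (u : Fin n → ℝ)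
    (hu : ∀ I ∈ Δ.S, I.card = n → ∀ i ∈ I, dotp u (Δ.v i) ≠ c i) :
    Δ.DH c uu ξ u = ∑ K ∈ Δ.S, if (∀ i ∈ K, dotp u (Δ.v i) < c i) then
      (-1 : ℤ) ^ (n - K.card) * Δ.dv K ξ else 0 := by
  have key : ∀ I ∈ Δ.S.filter (fun I => I.card = n),
      (if (∀ i ∈ I, (0 < dotp (uu I i) ξ ∧ c i ≤ dotp u (Δ.v i)) ∨
                 (dotp (uu I i) ξ < 0 ∧ dotp u (Δ.v i) ≤ c i))
      then (-1 : ℤ) ^ (I.filter fun i => 0 < dotp (uu I i) ξ).card * Δ.w I else 0)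
      = ∑ K ∈ Δ.S, if (∀ i ∈ K, dotp u (Δ.v i) < c i) ∧ K ⊆ I ∧ Δ.InProjCone K I ξ then
        (-1 : ℤ) ^ (n - K.card) * Δ.w I else 0 := by
    intro I hI
    obtain ⟨hI, h⟩ := Finset.mem_filter.mp hI
    have e1 : (if (∀ i ∈ I, (0 < dotp (uu I i) ξ ∧ c i ≤ dotp u (Δ.v i)) ∨
                 (dotp (uu I i) ξ < 0 ∧ dotp u (Δ.v i) ≤ c i))
      then (-1 : ℤ) ^ (I.filter fun i => 0 < dotp (uu I i) ξ).card * Δ.w I else 0)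
      = (∏ i ∈ I, ((if dotp u (Δ.v i) < c i then (1 : ℤ) else 0) +
          (if 0 < dotp (uu I i) ξ then (-1 : ℤ) else 0))) * Δ.w I := by
      have : ∀ i ∈ I, ((if dotp u (Δ.v i) < c i then (1 : ℤ) else 0) +
          (if 0 < dotp (uu I i) ξ then (-1 : ℤ) else 0)) =
          if ((0 < dotp (uu I i) ξ ∧ c i ≤ dotp u (Δ.v i)) ∨
                 (dotp (uu I i) ξ < 0 ∧ dotp u (Δ.v i) ≤ c i)) then
            (if 0 < dotp (uu I i) ξ then (-1 : ℤ) else 1) else 0 := by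
        intro i hi
        have a1 := hu I hI h i hi
        have a2 := hξ I hI h i hi
        rcases lt_or_gt_of_ne a1 with a1 | a1 <;> rcases lt_or_gt_of_ne a2 with a2 | a2 <;>
          simp [a1, a2, a1.le, a1.not_ge, a1.not_gt, a2.not_gt]
      rw [Finset.prod_congr rfl this, Finset.prod_ite_zero, ite_mul, zero_mul]
      congr 2
      rw [Finset.prod_ite, Finset.prod_const, Finset.prod_const_one, mul_one]
    rw [e1, Finset.prod_add, Finset.sum_mul]
    have hsub : I.powerset ⊆ Δ.S := fun K hK => Δ.downClosed I hI K (Finset.mem_powerset.mp hK)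
    rw [← Finset.sum_subset hsub]
    · refine Finset.sum_congr rfl fun K hK => ?_
      have hK := Finset.mem_powerset.mp hK
      rw [inProjCone_iff Δ huu hξ hI h hK, Finset.prod_ite_zero, Finset.prod_ite_zero]
      have hc : (I \ K).card = n - K.card := by rw [Finset.card_sdiff_of_subset hK, h]
      by_cases p : ∀ i ∈ K, dotp u (Δ.v i) < c i
      · by_cases q : ∀ i ∈ I \ K, 0 < dotp (uu I i) ξ
        · rw [if_pos p, if_pos q, if_pos ⟨p, hK, q⟩]; simp [hc]
        · rw [if_pos p, if_neg q, if_neg (fun h => q h.2.2)]; simp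
      · have p' : ¬ ((∀ i ∈ K, dotp u (Δ.v i) < c i) ∧ K ⊆ I ∧
            ∀ i ∈ I \ K, 0 < dotp (uu I i) ξ) := fun h => p h.1
        rw [if_neg p, if_neg p', zero_mul, zero_mul]
    · intro K _ hK
      rw [if_neg]
      intro h
      exact hK (Finset.mem_powerset.mpr h.2.1)
  unfold DH
  rw [Finset.sum_congr rfl key, Finset.sum_comm]
  refine Finset.sum_congr rfl fun K _ => ?_
  split_ifs with p
  · unfold dv
    rw [Finset.mul_sum]
    have : Δ.S.filter (fun I => I.card = n ∧ K ⊆ I ∧ Δ.InProjCone K I ξ) =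
      (Δ.S.filter (fun I => I.card = n)).filter (fun I => K ⊆ I ∧ Δ.InProjCone K I ξ) := by
      rw [Finset.filter_filter]
    rw [this, Finset.sum_filter (fun I => K ⊆ I ∧ Δ.InProjCone K I ξ)]
    refine Finset.sum_congr rfl fun I _ => ?_
    by_cases q : K ⊆ I ∧ Δ.InProjCone K I ξ
    · rw [if_pos q, if_pos ⟨p, q⟩]
    · rw [if_neg q, if_neg (fun h => q h.2)]
  · refine Finset.sum_eq_zero fun I _ => ?_
    rw [if_neg (fun h => p h.1)]

lemma DH_indep (Δ : MultiFan n d) (hC : Δ.Complete) (c : Fin d → ℝ)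
    {uu : Finset (Fin d) → Fin d → (Fin n → ℝ)}
    (huu : Δ.DualBasis uu) {ξ ξ' : Fin n → ℝ} (hξ : Δ.GenericDual uu ξ)
    (hξ' : Δ.GenericDual uu ξ') (u : Fin n → ℝ)
    (hu : ∀ I ∈ Δ.S, I.card = n → ∀ i ∈ I, dotp u (Δ.v i) ≠ c i) :
    Δ.DH c uu ξ u = Δ.DH c uu ξ' u := by
  classical
  rw [DH_expand Δ c huu hξ u hu, DH_expand Δ c huu hξ' u hu]
  refine Finset.sum_congr rfl fun K hK => ?_
  rw [(hC K hK).2 ξ ξ' (generic_of_dual Δ hC huu hξ K) (generic_of_dual Δ hC huu hξ' K)]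

lemma mulVec_rayMat (Δ : MultiFan n d) (I : Finset (Fin d)) (h : I.card = n) (u : Fin n → ℝ)
    (j : Fin n) : Matrix.toLin' (rayMat Δ I h) u j =
      dotp u (Δ.v ((I.equivFinOfCardEq h).symm j).1) := by
  simp only [Matrix.toLin'_apply, Matrix.mulVec, dotProduct, rayMat, Matrix.of_apply, dotp]
  exact Finset.sum_congr rfl fun i _ => mul_comm _ _

lemma ae_off (Δ : MultiFan n d) (c : Fin d → ℝ)
    {uu : Finset (Fin d) → Fin d → (Fin n → ℝ)} (huu : Δ.DualBasis uu) :
    ∀ᵐ u : Fin n → ℝ, ∀ I ∈ Δ.S, I.card = n → ∀ i ∈ I, dotp u (Δ.v i) ≠ c i := by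
  have : ∀ I ∈ Δ.S, ∀ᵐ u : Fin n → ℝ, I.card = n → ∀ i ∈ I, dotp u (Δ.v i) ≠ c i := by
    intro I hI
    by_cases h : I.card = n
    swap
    · exact Eventually.of_forall fun u h' => absurd h' h
    have hm := Real.map_matrix_volume_pi_eq_smul_volume_pi (det_rayMat_ne Δ huu hI h)
    have h1 : ∀ᵐ a : Fin n → ℝ, ∀ j, a j ≠ c ((I.equivFinOfCardEq h).symm j).1 := by
      rw [ae_all_iff]
      intro j
      have := Measure.pi_hyperplane (fun _ : Fin n => (volume : Measure ℝ)) j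
        (c ((I.equivFinOfCardEq h).symm j).1)
      rw [← volume_pi] at this
      rw [ae_iff]
      simpa using this
    have h2 : ∀ᵐ a ∂(Measure.map (Matrix.toLin' (rayMat Δ I h)) volume),
        ∀ j, a j ≠ c ((I.equivFinOfCardEq h).symm j).1 := by
      rw [hm]
      exact Measure.ae_smul_measure h1 _
    have hmeas : AEMeasurable (Matrix.toLin' (rayMat Δ I h)) (volume : Measure (Fin n → ℝ)) :=
      (LinearMap.continuous_of_finiteDimensional _).measurable.aemeasurable
    filter_upwards [ae_of_ae_map hmeas h2] with u hu _ i hi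
    have := hu (I.equivFinOfCardEq h ⟨i, hi⟩)
    rw [mulVec_rayMat] at this
    simpa using this
  have h2 := (Finset.eventually_all Δ.S).mpr this
  exact h2

lemma DH_ae (Δ : MultiFan n d) (hC : Δ.Complete) (c : Fin d → ℝ)
    {uu : Finset (Fin d) → Fin d → (Fin n → ℝ)}
    (huu : Δ.DualBasis uu) {ξ ξ' : Fin n → ℝ} (hξ : Δ.GenericDual uu ξ)
    (hξ' : Δ.GenericDual uu ξ') :
    ∀ᵐ u : Fin n → ℝ, (Δ.DH c uu ξ u : ℝ) = (Δ.DH c uu ξ' u : ℝ) := by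
  filter_upwards [ae_off Δ c huu] with u hu
  rw [DH_indep Δ hC c huu hξ hξ' u hu]

open scoped Classical in
/-- One-dimensional signed half-line exponential. -/
noncomputable def half (p c s a : ℝ) : ℝ :=
  if (0 < p ∧ c ≤ a) ∨ (p < 0 ∧ a ≤ c) then (if 0 < p then -1 else 1) * Real.exp (s * p * a)
  else 0

lemma half_pos {p : ℝ} (hp : 0 < p) (c s : ℝ) :
    half p c s = (Set.Ici c).indicator fun a => -Real.exp (s * p * a) := by
  ext a
  unfold half
  by_cases h : c ≤ a <;> simp [hp, hp.not_gt, h]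

lemma half_neg {p : ℝ} (hp : p < 0) (c s : ℝ) :
    half p c s = (Set.Iic c).indicator fun a => Real.exp (s * p * a) := by
  ext a
  unfold half
  by_cases h : a ≤ c <;> simp [hp, hp.not_gt, h]

lemma half_integrable {p : ℝ} (hp : p ≠ 0) (c : ℝ) {s : ℝ} (hs : s < 0) :
    Integrable (half p c s) := by
  rcases lt_or_gt_of_ne hp with hp | hp
  · rw [half_neg hp, integrable_indicator_iff measurableSet_Iic]
    exact integrableOn_exp_mul_Iic (mul_pos_of_neg_of_neg hs hp) c
  · rw [half_pos hp, integrable_indicator_iff measurableSet_Ici, integrableOn_Ici_iff_integrableOn_Ioi]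
    exact (integrableOn_exp_mul_Ioi (mul_neg_of_neg_of_pos hs hp) c).neg

lemma half_integral {p : ℝ} (hp : p ≠ 0) (c : ℝ) {s : ℝ} (hs : s < 0) :
    ∫ a, half p c s a = Real.exp (s * (c * p)) / (s * p) := by
  have e : s * (c * p) = s * p * c := by ring
  rw [e]
  rcases lt_or_gt_of_ne hp with hp | hp
  · rw [half_neg hp, integral_indicator measurableSet_Iic]
    exact integral_exp_mul_Iic (mul_pos_of_neg_of_neg hs hp) c
  · rw [half_pos hp, integral_indicator measurableSet_Ici, integral_Ici_eq_integral_Ioi,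
      integral_neg, integral_exp_mul_Ioi (mul_neg_of_neg_of_pos hs hp) c]
    ring

open scoped Classical in
lemma cone_term (Δ : MultiFan n d) (c : Fin d → ℝ)
    {uu : Finset (Fin d) → Fin d → (Fin n → ℝ)}
    (huu : Δ.DualBasis uu) (ξ : Fin n → ℝ)
    {I : Finset (Fin d)} (hI : I ∈ Δ.S) (h : I.card = n) (s : ℝ) (u : Fin n → ℝ) :
    ((if (∀ i ∈ I, (0 < dotp (uu I i) ξ ∧ c i ≤ dotp u (Δ.v i)) ∨
                 (dotp (uu I i) ξ < 0 ∧ dotp u (Δ.v i) ≤ c i))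
      then (-1 : ℤ) ^ (I.filter fun i => 0 < dotp (uu I i) ξ).card * Δ.w I else 0 : ℤ) : ℝ)
      * Real.exp (s * dotp u ξ)
    = Δ.w I * ∏ i ∈ I, half (dotp (uu I i) ξ) (c i) s (dotp u (Δ.v i)) := by
  unfold half
  rw [Finset.prod_ite_zero]
  split_ifs with q
  · rw [Finset.prod_mul_distrib, ← Real.exp_sum, Finset.prod_ite, Finset.prod_const,
      Finset.prod_const_one, mul_one, expand_pair Δ huu hI h u ξ, Finset.mul_sum]
    push_cast
    have : ∑ i ∈ I, s * (dotp (uu I i) ξ * dotp u (Δ.v i)) =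
      ∑ i ∈ I, s * dotp (uu I i) ξ * dotp u (Δ.v i) :=
      Finset.sum_congr rfl fun i _ => by ring
    rw [this]
    ring
  · simp

lemma cone_integral (Δ : MultiFan n d) (c : Fin d → ℝ)
    {uu : Finset (Fin d) → Fin d → (Fin n → ℝ)}
    (huu : Δ.DualBasis uu) {ξ : Fin n → ℝ} (hξ : Δ.GenericDual uu ξ)
    {I : Finset (Fin d)} (hI : I ∈ Δ.S) (h : I.card = n) {s : ℝ} (hs : s < 0) :
    Integrable (fun u : Fin n → ℝ =>
      ∏ i ∈ I, half (dotp (uu I i) ξ) (c i) s (dotp u (Δ.v i))) ∧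
    ∫ u : Fin n → ℝ, ∏ i ∈ I, half (dotp (uu I i) ξ) (c i) s (dotp u (Δ.v i)) =
      |(rayMat Δ I h).det|⁻¹ * (Real.exp (s * ∑ i ∈ I, c i * dotp (uu I i) ξ) /
        (s ^ n * ∏ i ∈ I, dotp (uu I i) ξ)) := by
  set e := (I.equivFinOfCardEq h).symm with he
  set g : (Fin n → ℝ) → ℝ := fun a =>
    ∏ j, half (dotp (uu I (e j).1) ξ) (c (e j).1) s (a j) with hg
  have hfun : (fun u : Fin n → ℝ =>
      ∏ i ∈ I, half (dotp (uu I i) ξ) (c i) s (dotp u (Δ.v i))) =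
      fun u => g (Matrix.toLin' (rayMat Δ I h) u) := by
    ext u
    rw [prod_simplex I h]
    simp only [hg, mulVec_rayMat, he]
  have hne : ∀ j, dotp (uu I (e j).1) ξ ≠ 0 := fun j => hξ I hI h _ (e j).2
  have hgint : Integrable g :=
    Integrable.fintype_prod (μ := fun _ => volume)
      (f := fun j a => half (dotp (uu I (e j).1) ξ) (c (e j).1) s a)
      fun j => half_integrable (hne j) _ hs
  have hm := Real.map_matrix_volume_pi_eq_smul_volume_pi (det_rayMat_ne Δ huu hI h)
  have hmeas : AEMeasurable (Matrix.toLin' (rayMat Δ I h)) (volume : Measure (Fin n → ℝ)) :=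
    (LinearMap.continuous_of_finiteDimensional _).measurable.aemeasurable
  have hgint' : Integrable g (Measure.map (Matrix.toLin' (rayMat Δ I h)) volume) := by
    rw [hm]
    exact hgint.smul_measure ENNReal.ofReal_ne_top
  rw [hfun]
  refine ⟨hgint'.comp_aemeasurable hmeas, ?_⟩
  rw [← integral_map hmeas hgint'.aestronglyMeasurable, hm, integral_smul_measure,
    ENNReal.toReal_ofReal (abs_nonneg _), abs_inv, smul_eq_mul]
  congr 1
  simp only [hg]
  rw [integral_fintype_prod_volume_eq_prod
    (fun j a => half (dotp (uu I (e j).1) ξ) (c (e j).1) s a)]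
  rw [Finset.prod_congr rfl fun j _ => half_integral (hne j) _ hs, Finset.prod_div_distrib,
    Finset.prod_mul_distrib, ← Real.exp_sum, ← Finset.mul_sum, Finset.prod_const,
    Finset.card_univ, Fintype.card_fin, sum_simplex I h, prod_simplex I h]

open scoped Classical in
lemma DH_exp (Δ : MultiFan n d) (c : Fin d → ℝ)
    {uu : Finset (Fin d) → Fin d → (Fin n → ℝ)}
    (huu : Δ.DualBasis uu) {ξ : Fin n → ℝ} (hξ : Δ.GenericDual uu ξ)
    (D : Finset (Fin d) → ℝ)
    (hD : ∀ I ∈ Δ.S, ∀ h : I.card = n, D I = |(rayMat Δ I h).det|) {s : ℝ} (hs : s < 0) :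
    Integrable (fun u : Fin n → ℝ => (Δ.DH c uu ξ u : ℝ) * Real.exp (s * dotp u ξ)) ∧
    ∫ u : Fin n → ℝ, (Δ.DH c uu ξ u : ℝ) * Real.exp (s * dotp u ξ) =
      (∑ I ∈ Δ.S.filter (fun I => I.card = n),
        Δ.w I / D I / (∏ i ∈ I, dotp (uu I i) ξ) *
        Real.exp (s * ∑ i ∈ I, c i * dotp (uu I i) ξ)) / s ^ n := by
  have hfun : (fun u : Fin n → ℝ => (Δ.DH c uu ξ u : ℝ) * Real.exp (s * dotp u ξ)) =
      fun u => ∑ I ∈ Δ.S.filter (fun I => I.card = n),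
        Δ.w I * ∏ i ∈ I, half (dotp (uu I i) ξ) (c i) s (dotp u (Δ.v i)) := by
    ext u
    unfold DH
    rw [Int.cast_sum, Finset.sum_mul]
    refine Finset.sum_congr rfl fun I hI => ?_
    obtain ⟨hI, h⟩ := Finset.mem_filter.mp hI
    exact cone_term Δ c huu ξ hI h s u
  have hIntgr : ∀ I ∈ Δ.S.filter (fun I => I.card = n), Integrable (fun u : Fin n → ℝ =>
      Δ.w I * ∏ i ∈ I, half (dotp (uu I i) ξ) (c i) s (dotp u (Δ.v i))) := by
    intro I hI
    obtain ⟨hI, h⟩ := Finset.mem_filter.mp hI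
    exact (cone_integral Δ c huu hξ hI h hs).1.const_mul _
  rw [hfun]
  refine ⟨integrable_finsetSum _ hIntgr, ?_⟩
  rw [integral_finsetSum _ hIntgr, Finset.sum_div]
  refine Finset.sum_congr rfl fun I hI => ?_
  obtain ⟨hI, h⟩ := Finset.mem_filter.mp hI
  rw [integral_const_mul, (cone_integral Δ c huu hξ hI h hs).2, hD I hI h]
  simp only [div_eq_mul_inv, mul_inv]
  ring

lemma genericDual_neg (Δ : MultiFan n d) {uu : Finset (Fin d) → Fin d → (Fin n → ℝ)}
    {ξ : Fin n → ℝ} (hξ : Δ.GenericDual uu ξ) : Δ.GenericDual uu (-ξ) := by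
  intro I hI h i hi
  rw [dotp_neg_right]
  exact neg_ne_zero.mpr (hξ I hI h i hi)

lemma DH_tendsto (Δ : MultiFan n d) (hC : Δ.Complete) (c : Fin d → ℝ)
    {uu : Finset (Fin d) → Fin d → (Fin n → ℝ)}
    (huu : Δ.DualBasis uu) {ξ : Fin n → ℝ} (hξ : Δ.GenericDual uu ξ) :
    Tendsto (fun s : ℝ => ∫ u : Fin n → ℝ, (Δ.DH c uu ξ u : ℝ) * Real.exp (s * dotp u ξ))
      (𝓝[<] 0) (𝓝 (∫ u : Fin n → ℝ, (Δ.DH c uu ξ u : ℝ))) := by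
  classical
  set D : Finset (Fin d) → ℝ := fun I => if h : I.card = n then |(rayMat Δ I h).det| else 0
  have hD : ∀ I ∈ Δ.S, ∀ h : I.card = n, D I = |(rayMat Δ I h).det| :=
    fun I _ h => by simp [D, h]
  have i1 := fun (s : ℝ) (hs : s < 0) => (DH_exp Δ c huu hξ D hD hs).1
  have i2 : Integrable (fun u : Fin n → ℝ => (Δ.DH c uu ξ u : ℝ) * Real.exp (dotp u ξ)) := by
    refine ((DH_exp Δ c huu (genericDual_neg Δ hξ) D hD (s := -1) (by norm_num)).1).congr ?_
    filter_upwards [DH_ae Δ hC c huu hξ (genericDual_neg Δ hξ)] with u hu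
    rw [hu, dotp_neg_right]
    simp
  refine tendsto_integral_filter_of_dominated_convergence
    (fun u => |(Δ.DH c uu ξ u : ℝ) * Real.exp (-1 * dotp u ξ)| +
      |(Δ.DH c uu ξ u : ℝ) * Real.exp (dotp u ξ)|) ?_ ?_ ?_ ?_
  · filter_upwards [self_mem_nhdsWithin] with s hs
    exact (i1 s hs).aestronglyMeasurable
  · have : ∀ᶠ s : ℝ in 𝓝[<] 0, -1 < s :=
      nhdsWithin_le_nhds (lt_mem_nhds (by norm_num))
    filter_upwards [self_mem_nhdsWithin, this] with s hs hs1
    refine Eventually.of_forall fun u => ?_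
    have hs : s < 0 := hs
    rw [Real.norm_eq_abs, abs_mul, abs_mul, abs_mul, ← mul_add]
    refine mul_le_mul_of_nonneg_left ?_ (abs_nonneg _)
    simp only [Real.abs_exp]
    rcases le_total 0 (dotp u ξ) with hx | hx
    · have : Real.exp (s * dotp u ξ) ≤ Real.exp (dotp u ξ) :=
        Real.exp_le_exp.mpr (by nlinarith)
      linarith [Real.exp_pos (-1 * dotp u ξ)]
    · have : Real.exp (s * dotp u ξ) ≤ Real.exp (-1 * dotp u ξ) :=
        Real.exp_le_exp.mpr (by nlinarith)
      linarith [Real.exp_pos (dotp u ξ)]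
  · exact (i1 (-1) (by norm_num)).abs.add i2.abs
  · refine Eventually.of_forall fun u => ?_
    have : Continuous fun s : ℝ => (Δ.DH c uu ξ u : ℝ) * Real.exp (s * dotp u ξ) := by fun_prop
    have := (this.tendsto 0).mono_left (nhdsWithin_le_nhds (s := Set.Iio 0))
    simpa using this

/-- Extracting Taylor coefficients from a limit. -/
lemma taylor_extract {ι : Type*} (T : Finset ι) (A b : ι → ℝ) (n : ℕ) (L : ℝ)
    (hL : Tendsto (fun s : ℝ => (∑ I ∈ T, A I * Real.exp (s * b I)) / s ^ n) (𝓝[<] 0) (𝓝 L)) :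
    (∀ k < n, ∑ I ∈ T, A I * b I ^ k = 0) ∧
      (∑ I ∈ T, A I * b I ^ n) / (n.factorial : ℝ) = L := by
  set m : ℕ → ℝ := fun k => ∑ I ∈ T, A I * b I ^ k with hm
  -- Taylor expansion to order `k`
  have tay : ∀ k : ℕ, (∀ j < k, m j = 0) →
      Tendsto (fun s : ℝ => (∑ I ∈ T, A I * Real.exp (s * b I)) / s ^ k) (𝓝[<] 0)
        (𝓝 (m k / (k.factorial : ℝ))) := by
    intro k hk
    have h1 : ∀ I ∈ T, Tendsto (fun s : ℝ => A I * ((Real.exp (s * b I) -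
        ∑ i ∈ Finset.range (k + 1), (s * b I) ^ i / (i.factorial : ℝ)) / s ^ k))
        (𝓝[<] 0) (𝓝 (A I * 0)) := by
      intro I _
      refine Tendsto.const_mul _ ?_
      have h2 := Real.exp_sub_sum_range_succ_isLittleO_pow k
      have h3 : Tendsto (fun s : ℝ => s * b I) (𝓝[<] 0) (𝓝 0) := by
        have : Continuous fun s : ℝ => s * b I := by fun_prop
        have := (this.tendsto 0).mono_left (nhdsWithin_le_nhds (s := Set.Iio 0))
        simpa using this
      have h4 := h2.comp_tendsto h3
      have h5 : ((fun x : ℝ => x ^ k) ∘ fun s : ℝ => s * b I) =O[𝓝[<] 0] fun s : ℝ => s ^ k := by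
        have : ((fun x : ℝ => x ^ k) ∘ fun s : ℝ => s * b I) = fun s => b I ^ k * s ^ k := by
          ext s; simp [mul_pow, mul_comm]
        rw [this]
        exact Asymptotics.isBigO_const_mul_self _ _ _
      exact (h4.trans_isBigO h5).tendsto_div_nhds_zero
    have h6 := tendsto_finsetSum T h1
    simp only [mul_zero, Finset.sum_const_zero] at h6
    have h7 := h6.add_const (m k / (k.factorial : ℝ))
    rw [zero_add] at h7
    refine h7.congr' ?_
    filter_upwards [self_mem_nhdsWithin] with s hs
    have hs : s ≠ 0 := ne_of_lt hs
    have h8 : ∑ I ∈ T, A I * ∑ i ∈ Finset.range (k + 1), (s * b I) ^ i / (i.factorial : ℝ)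
        = s ^ k * (m k / (k.factorial : ℝ)) := by
      simp only [Finset.mul_sum]
      rw [Finset.sum_comm]
      have : ∀ i, ∑ I ∈ T, A I * ((s * b I) ^ i / (i.factorial : ℝ)) =
          s ^ i * (m i / (i.factorial : ℝ)) := by
        intro i
        rw [hm, Finset.sum_div, Finset.mul_sum]
        exact Finset.sum_congr rfl fun I _ => by rw [mul_pow]; ring
      simp only [this]
      rw [Finset.sum_range_succ, Finset.sum_eq_zero, zero_add]
      intro j hj
      rw [hk j (Finset.mem_range.mp hj)]
      simp
    have h9 : ∑ I ∈ T, A I * ((Real.exp (s * b I) -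
        ∑ i ∈ Finset.range (k + 1), (s * b I) ^ i / (i.factorial : ℝ)) / s ^ k) =
        (∑ I ∈ T, A I * Real.exp (s * b I)) / s ^ k - (s ^ k * (m k / (k.factorial : ℝ))) / s ^ k := by
      rw [← h8, ← sub_div, ← Finset.sum_sub_distrib, Finset.sum_div]
      exact Finset.sum_congr rfl fun I _ => by ring
    rw [h9, mul_div_cancel_left₀ _ (pow_ne_zero k hs)]
    ring
  have hz : ∀ k < n, m k = 0 := by
    intro k
    induction k using Nat.strong_induction_on with
    | _ k ih =>
      intro hkn
      have t1 := tay k fun j hj => ih j hj (hj.trans hkn)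
      have t2 : Tendsto (fun s : ℝ => s ^ (n - k)) (𝓝[<] 0) (𝓝 0) := by
        have : Continuous fun s : ℝ => s ^ (n - k) := by fun_prop
        have := (this.tendsto 0).mono_left (nhdsWithin_le_nhds (s := Set.Iio 0))
        simpa [zero_pow (show n - k ≠ 0 by omega)] using this
      have t3 := hL.mul t2
      rw [mul_zero] at t3
      have t4 : Tendsto (fun s : ℝ => (∑ I ∈ T, A I * Real.exp (s * b I)) / s ^ k) (𝓝[<] 0)
          (𝓝 0) := by
        refine t3.congr' ?_
        filter_upwards [self_mem_nhdsWithin] with s hs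
        have hs : s ≠ 0 := ne_of_lt hs
        have : s ^ n = s ^ k * s ^ (n - k) := by rw [← pow_add]; congr 1; omega
        rw [this]
        have := pow_ne_zero (n - k) hs
        have := pow_ne_zero k hs
        field_simp
      have := tendsto_nhds_unique t1 t4
      have hf : (k.factorial : ℝ) ≠ 0 := by exact_mod_cast k.factorial_ne_zero
      simpa [hf] using this
  exact ⟨hz, tendsto_nhds_unique (tay n hz) hL⟩

open scoped Classical in
/-- The localization formula at a generic vector. -/
lemma vol_formula (Δ : MultiFan n d) (hC : Δ.Complete) (c : Fin d → ℝ)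
    {uu : Finset (Fin d) → Fin d → (Fin n → ℝ)}
    (huu : Δ.DualBasis uu) {ξ : Fin n → ℝ} (hξ : Δ.GenericDual uu ξ)
    (D : Finset (Fin d) → ℝ)
    (hD : ∀ I ∈ Δ.S, ∀ h : I.card = n, D I = |(rayMat Δ I h).det|) :
    (∀ k < n, ∑ I ∈ Δ.S.filter (fun I => I.card = n),
      Δ.w I / D I / (∏ i ∈ I, dotp (uu I i) ξ) * (∑ i ∈ I, c i * dotp (uu I i) ξ) ^ k = 0) ∧
    (∑ I ∈ Δ.S.filter (fun I => I.card = n),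
      Δ.w I / D I / (∏ i ∈ I, dotp (uu I i) ξ) * (∑ i ∈ I, c i * dotp (uu I i) ξ) ^ n) /
      (n.factorial : ℝ) = ∫ u : Fin n → ℝ, (Δ.DH c uu ξ u : ℝ) := by
  refine taylor_extract _ (fun I => Δ.w I / D I / (∏ i ∈ I, dotp (uu I i) ξ))
    (fun I => ∑ i ∈ I, c i * dotp (uu I i) ξ) n _ ?_
  refine (DH_tendsto Δ hC c huu hξ).congr' ?_
  filter_upwards [self_mem_nhdsWithin] with s hs
  exact (DH_exp Δ c huu hξ D hD hs).2

lemma card_quot (Δ : LMultiFan n d) {uu : Finset (Fin d) → Fin d → (Fin n → ℝ)}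
    (huu : Δ.toMF.DualBasis uu) (I : Finset (Fin d)) (hI : I ∈ Δ.toMF.S) (h : I.card = n) :
    (Nat.card ((Fin n → ℤ) ⧸ Submodule.span ℤ (Δ.v '' (I : Set (Fin d)))) : ℝ) =
      |(rayMat Δ.toMF I h).det| := by
  set f : Fin n → (Fin n → ℤ) := fun j => Δ.v ((I.equivFinOfCardEq h).symm j).1 with hf
  have hrange : Δ.v '' (I : Set (Fin d)) = Set.range f := by
    ext x
    constructor
    · rintro ⟨i, hi, rfl⟩
      exact ⟨I.equivFinOfCardEq h ⟨i, hi⟩, by simp [hf]⟩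
    · rintro ⟨j, rfl⟩
      exact ⟨_, ((I.equivFinOfCardEq h).symm j).2, rfl⟩
  have hmap : rayMat Δ.toMF I h = (Matrix.of f).map (Int.castRingHom ℝ) := by
    ext a b
    simp [rayMat, hf, LMultiFan.toMF]
  have hdet : (rayMat Δ.toMF I h).det = ((Matrix.of f).det : ℝ) := by
    rw [hmap, ← RingHom.mapMatrix_apply, ← RingHom.map_det]
    simp
  have hne : (Matrix.of f).det ≠ 0 := by
    intro h0
    apply det_rayMat_ne Δ.toMF huu hI h
    rw [hdet, h0]; simp
  have hli : LinearIndependent ℤ f := by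
    have := Matrix.linearIndependent_rows_of_det_ne_zero hne
    exact this
  rw [hrange, hdet]
  have := Submodule.natAbs_det_basis_change (Pi.basisFun ℤ (Fin n)) _ (Module.Basis.span hli)
  rw [← this]
  have h2 : ((↑) ∘ (Module.Basis.span hli) : Fin n → (Fin n → ℤ)) = f := by
    ext j : 1
    simp [Module.Basis.span_apply]
  rw [h2, Pi.basisFun_det_apply, Nat.cast_natAbs]
  simp

/-- An identity of rational functions follows from its values. -/
lemma ratfun_eq {ι : Type*} (T : Finset ι) (N D : ι → MvPolynomial (Fin n) ℝ)
    (hD : ∀ I ∈ T, D I ≠ 0) (r : ℝ)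
    (h : ∀ x : Fin n → ℝ, (∀ I ∈ T, MvPolynomial.eval x (D I) ≠ 0) →
      ∑ I ∈ T, MvPolynomial.eval x (N I) / MvPolynomial.eval x (D I) = r) :
    ∑ I ∈ T, algebraMap (MvPolynomial (Fin n) ℝ) (FractionRing (MvPolynomial (Fin n) ℝ)) (N I) /
      algebraMap (MvPolynomial (Fin n) ℝ) (FractionRing (MvPolynomial (Fin n) ℝ)) (D I) =
    algebraMap (MvPolynomial (Fin n) ℝ) (FractionRing (MvPolynomial (Fin n) ℝ))
      (MvPolynomial.C r) := by
  classical
  set φ := algebraMap (MvPolynomial (Fin n) ℝ) (FractionRing (MvPolynomial (Fin n) ℝ)) with hφ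
  have hinj : Function.Injective φ := IsFractionRing.injective _ _
  set Q := ∏ I ∈ T, D I with hQ
  have hQ0 : Q ≠ 0 := Finset.prod_ne_zero_iff.mpr hD
  have hpoly : ∑ I ∈ T, N I * ∏ J ∈ T.erase I, D J = MvPolynomial.C r * Q := by
    rw [← sub_eq_zero]
    have : Q * (∑ I ∈ T, N I * ∏ J ∈ T.erase I, D J - MvPolynomial.C r * Q) = 0 := by
      refine MvPolynomial.funext fun x => ?_
      rw [map_mul, map_zero]
      by_cases hx : MvPolynomial.eval x Q = 0
      · rw [hx, zero_mul]
      have hx' : ∀ I ∈ T, MvPolynomial.eval x (D I) ≠ 0 := by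
        rw [hQ, map_prod] at hx
        exact Finset.prod_ne_zero_iff.mp hx
      have e := h x hx'
      simp only [map_sub, map_sum, map_mul, MvPolynomial.eval_C]
      rw [← e, Finset.sum_mul, sub_eq_zero.mpr, mul_zero]
      refine Finset.sum_congr rfl fun I hI => ?_
      rw [hQ, ← Finset.mul_prod_erase T D hI, map_mul]
      have := hx' I hI
      field_simp
    exact (mul_eq_zero.mp this).resolve_left hQ0
  have hφQ : φ Q ≠ 0 := fun h0 => hQ0 (hinj (by rw [h0, map_zero]))
  apply mul_right_cancel₀ hφQ
  rw [← map_mul, ← hpoly, map_sum, Finset.sum_mul]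
  refine Finset.sum_congr rfl fun I hI => ?_
  have hφD : φ (D I) ≠ 0 := fun h0 => hD I hI (hinj (by rw [h0, map_zero]))
  rw [hQ, ← Finset.mul_prod_erase T D hI, map_mul, map_mul]
  field_simp

/-- The linear form `u_i^I` as a polynomial, evaluated. -/
lemma eval_linform (uu : Fin n → ℚ) (x : Fin n → ℝ) :
    MvPolynomial.eval x (∑ k : Fin n, ((uu k : ℝ)) • (MvPolynomial.X k : MvPolynomial (Fin n) ℝ))
      = dotp (fun k => (uu k : ℝ)) x := by
  simp [dotp, MvPolynomial.smul_eval]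

lemma eval_iota (uu : Finset (Fin d) → Fin d → (Fin n → ℚ)) (I : Finset (Fin d))
    (c : Fin d → ℝ) (x : Fin n → ℝ) :
    MvPolynomial.eval x (iotaR uu I (∑ i : Fin d, c i • MvPolynomial.X i)) =
      ∑ i ∈ I, c i * dotp (fun k => (uu I i k : ℝ)) x := by
  classical
  unfold iotaR
  rw [map_sum, map_sum]
  have : ∀ i : Fin d, MvPolynomial.eval x (MvPolynomial.aeval
    (fun i => if i ∈ I then ∑ k : Fin n, ((uu I i k : ℝ)) •
      (MvPolynomial.X k : MvPolynomial (Fin n) ℝ) else 0)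
      (c i • (MvPolynomial.X i : MvPolynomial (Fin d) ℝ))) =
      if i ∈ I then c i * dotp (fun k => (uu I i k : ℝ)) x else 0 := by
    intro i
    rw [map_smul, MvPolynomial.aeval_X, MvPolynomial.smul_eval]
    split_ifs with hi
    · rw [eval_linform]
    · simp
  refine (Finset.sum_congr rfl fun i _ => this i).trans ?_
  simp

open scoped Classical in
lemma piShriek_eq (Δ : LMultiFan n d) (uu : Finset (Fin d) → Fin d → (Fin n → ℚ))
    {ξ : Fin n → ℝ} (hξ : Δ.toMF.GenericDual (fun I i k => ((uu I i k : ℝ))) ξ)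
    (x : MvPolynomial (Fin d) ℝ) (r : ℝ)
    (h : ∀ y : Fin n → ℝ, Δ.toMF.GenericDual (fun I i k => ((uu I i k : ℝ))) y →
      ∑ I ∈ Δ.S.filter (fun I => I.card = n), (Δ.w I : ℝ) /
        (Nat.card ((Fin n → ℤ) ⧸ Submodule.span ℤ (Δ.v '' (I : Set (Fin d)))) : ℝ) /
        (∏ i ∈ I, dotp (fun k => (uu I i k : ℝ)) y) * MvPolynomial.eval y (iotaR uu I x) = r) :
    piShriekR Δ uu x =
      algebraMap (MvPolynomial (Fin n) ℝ) (FractionRing (MvPolynomial (Fin n) ℝ))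
        (MvPolynomial.C r) := by
  have hev : ∀ (I : Finset (Fin d)) (y : Fin n → ℝ), MvPolynomial.eval y
      (∏ i ∈ I, ∑ k : Fin n, ((uu I i k : ℝ)) • (MvPolynomial.X k : MvPolynomial (Fin n) ℝ)) =
      ∏ i ∈ I, dotp (fun k => (uu I i k : ℝ)) y := by
    intro I y
    rw [map_prod]
    exact Finset.prod_congr rfl fun i _ => eval_linform _ _
  rw [← ratfun_eq (Δ.S.filter (fun I => I.card = n))
    (fun I => MvPolynomial.C ((Δ.w I : ℝ) /
        (Nat.card ((Fin n → ℤ) ⧸ Submodule.span ℤ (Δ.v '' (I : Set (Fin d)))) : ℝ)) * iotaR uu I x)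
    (fun I => ∏ i ∈ I, ∑ k : Fin n, ((uu I i k : ℝ)) • MvPolynomial.X k) ?_ r ?_]
  · unfold piShriekR
    refine Finset.sum_congr rfl fun I _ => ?_
    rw [map_mul, mul_div_assoc]
  · intro I hI h0
    obtain ⟨hI, hc⟩ := Finset.mem_filter.mp hI
    have := hev I ξ
    rw [h0, map_zero] at this
    exact Finset.prod_ne_zero_iff.mpr (fun i hi => hξ I hI hc i hi) this.symm
  · intro y hy
    have hgen : Δ.toMF.GenericDual (fun I i k => ((uu I i k : ℝ))) y := by
      intro I hI hc i hi
      have := hy I (Finset.mem_filter.mpr ⟨hI, hc⟩)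
      rw [hev] at this
      exact Finset.prod_ne_zero_iff.mp this i hi
    rw [← h y hgen]
    refine Finset.sum_congr rfl fun I _ => ?_
    rw [hev, map_mul, MvPolynomial.eval_C]
    ring

end VolProof

/-- **Lemma 8.6**: for a simple multi-polytope `P` over a complete simplicial multi-fan,
`vol(P) = (1/n!) ∫_Δ c_1(P)^n = ∫_Δ e^{c_1(P)}` (where `∫_Δ` is realized as the constant
term of `π_!` applied to a lift, the lift of `c_1(P)` being `∑ c_i x_i` and that of
`e^{c_1(P)}` its degree-`≤ n` truncation).  Consequently the volume is a homogeneous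
polynomial of degree `n` in the hyperplane constants `(c_1,…,c_d)`. -/
theorem stmt18 (n d : ℕ) (Δ : LMultiFan n d) (hC : Δ.toMF.Complete)
    (c : Fin d → ℝ) (uu : Finset (Fin d) → Fin d → (Fin n → ℚ))
    (huu : Δ.toMF.DualBasis (fun I i k => ((uu I i k : ℝ))))
    (ξ : Fin n → ℝ) (hξ : Δ.toMF.GenericDual (fun I i k => ((uu I i k : ℝ))) ξ) :
    (∃ p : MvPolynomial (Fin n) ℝ,
      piShriekR Δ uu ((∑ i : Fin d, c i • MvPolynomial.X i) ^ n)
        = algebraMap (MvPolynomial (Fin n) ℝ) (FractionRing (MvPolynomial (Fin n) ℝ)) p ∧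
      (∫ u : Fin n → ℝ, (Δ.toMF.DH c (fun I i k => ((uu I i k : ℝ))) ξ u : ℝ))
        = ((Nat.factorial n : ℝ))⁻¹ * MvPolynomial.coeff 0 p) ∧
    (∃ p : MvPolynomial (Fin n) ℝ,
      piShriekR Δ uu (∑ k ∈ Finset.range (n+1),
          ((Nat.factorial k : ℝ))⁻¹ • (∑ i : Fin d, c i • MvPolynomial.X i) ^ k)
        = algebraMap (MvPolynomial (Fin n) ℝ) (FractionRing (MvPolynomial (Fin n) ℝ)) p ∧
      (∫ u : Fin n → ℝ, (Δ.toMF.DH c (fun I i k => ((uu I i k : ℝ))) ξ u : ℝ))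
        = MvPolynomial.coeff 0 p) ∧
    (∃ V : MvPolynomial (Fin d) ℝ, V.IsHomogeneous n ∧
      ∀ c' : Fin d → ℝ,
        (∫ u : Fin n → ℝ, (Δ.toMF.DH c' (fun I i k => ((uu I i k : ℝ))) ξ u : ℝ))
          = MvPolynomial.eval c' V) := by
  classical
  have hD := VolProof.card_quot Δ huu
  have hF : ((n.factorial : ℕ) : ℝ) ≠ 0 := by exact_mod_cast n.factorial_ne_zero
  -- the localization formula, with the volume independent of the generic vector
  have key : ∀ y : Fin n → ℝ, Δ.toMF.GenericDual (fun I i k => ((uu I i k : ℝ))) y → _ :=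
    fun y hy => VolProof.vol_formula Δ.toMF hC c huu hy _ hD
  have hvol : ∀ y : Fin n → ℝ, Δ.toMF.GenericDual (fun I i k => ((uu I i k : ℝ))) y →
      (∫ u : Fin n → ℝ, (Δ.toMF.DH c (fun I i k => ((uu I i k : ℝ))) y u : ℝ)) =
      ∫ u : Fin n → ℝ, (Δ.toMF.DH c (fun I i k => ((uu I i k : ℝ))) ξ u : ℝ) :=
    fun y hy => MeasureTheory.integral_congr_ae (VolProof.DH_ae Δ.toMF hC c huu hy hξ)
  refine ⟨⟨MvPolynomial.C (n.factorial *
    ∫ u : Fin n → ℝ, (Δ.toMF.DH c (fun I i k => ((uu I i k : ℝ))) ξ u : ℝ)), ?_, ?_⟩,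
    ⟨MvPolynomial.C
    (∫ u : Fin n → ℝ, (Δ.toMF.DH c (fun I i k => ((uu I i k : ℝ))) ξ u : ℝ)), ?_, ?_⟩, ?_⟩
  · refine VolProof.piShriek_eq Δ uu hξ _ _ fun y hy => ?_
    rw [← hvol y hy, ← (key y hy).2, mul_div_cancel₀ _ hF]
    refine Finset.sum_congr rfl fun I _ => ?_
    rw [map_pow, map_pow, VolProof.eval_iota]
    rfl
  · rw [MvPolynomial.coeff_zero_C, inv_mul_cancel_left₀ hF]
  · refine VolProof.piShriek_eq Δ uu hξ _ _ fun y hy => ?_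
    rw [← hvol y hy, ← (key y hy).2]
    have e : ∀ I : Finset (Fin d), MvPolynomial.eval y (iotaR uu I
        (∑ k ∈ Finset.range (n+1),
          ((Nat.factorial k : ℝ))⁻¹ • (∑ i : Fin d, c i • MvPolynomial.X i) ^ k)) =
        ∑ k ∈ Finset.range (n+1), ((Nat.factorial k : ℝ))⁻¹ *
          (∑ i ∈ I, c i * dotp (fun k => (uu I i k : ℝ)) y) ^ k := by
      intro I
      rw [map_sum, map_sum]
      refine Finset.sum_congr rfl fun k _ => ?_
      rw [map_smul, MvPolynomial.smul_eval, map_pow, map_pow, VolProof.eval_iota]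
    simp only [e, Finset.mul_sum]
    rw [Finset.sum_comm, Finset.sum_range_succ, Finset.sum_eq_zero, zero_add, Finset.sum_div]
    · refine Finset.sum_congr rfl fun I _ => ?_
      rw [mul_left_comm, inv_mul_eq_div]
      rfl
    · intro k hk
      have h0 := (key y hy).1 k (Finset.mem_range.mp hk)
      rw [← mul_zero ((Nat.factorial k : ℝ))⁻¹, ← h0, Finset.mul_sum]
      refine Finset.sum_congr rfl fun I _ => ?_
      rw [mul_left_comm]
      rfl
  · rw [MvPolynomial.coeff_zero_C]
  · refine ⟨∑ I ∈ Δ.S.filter (fun I => I.card = n),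
      MvPolynomial.C ((Δ.w I : ℝ) /
        (Nat.card ((Fin n → ℤ) ⧸ Submodule.span ℤ (Δ.v '' (I : Set (Fin d)))) : ℝ) /
        (∏ i ∈ I, dotp (fun k => (uu I i k : ℝ)) ξ) / n.factorial) *
      (∑ i ∈ I, MvPolynomial.C (dotp (fun k => (uu I i k : ℝ)) ξ) * MvPolynomial.X i) ^ n, ?_, ?_⟩
    · refine MvPolynomial.IsHomogeneous.sum _ _ _ fun I _ => ?_
      have h1 : (∑ i ∈ I, MvPolynomial.C (dotp (fun k => (uu I i k : ℝ)) ξ) *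
          (MvPolynomial.X i : MvPolynomial (Fin d) ℝ)).IsHomogeneous 1 :=
        MvPolynomial.IsHomogeneous.sum _ _ _ fun i _ =>
          (MvPolynomial.isHomogeneous_X ℝ i).C_mul _
      have h2 := h1.pow n
      rw [one_mul] at h2
      exact h2.C_mul _
    · intro c'
      rw [← (VolProof.vol_formula Δ.toMF hC c' huu hξ _ hD).2, map_sum, Finset.sum_div]
      refine Finset.sum_congr rfl fun I _ => ?_
      simp only [map_mul, map_pow, map_sum, MvPolynomial.eval_C, MvPolynomial.eval_X]
      have hs : ∑ i ∈ I, dotp (fun k => (uu I i k : ℝ)) ξ * c' i =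
          ∑ i ∈ I, c' i * dotp (fun k => (uu I i k : ℝ)) ξ :=
        Finset.sum_congr rfl fun i _ => mul_comm _ _
      rw [hs, show Δ.toMF.w I = Δ.w I from rfl]
      ring
end
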